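/- Under the hypotheses and with the constants ρ₀, γ ∈ (0,1), ς₀, τ₀ > 0 of the iterative approximation proposition — i.e. u is a κ-grad viscosity solution of (|Du|−κ)₊^q F(D²u) = f in B₁ with F (λ,Λ)-elliptic, 0 ≤ κ ≤ κ₀(n,λ,Λ), μ ∈ (0,1), ‖f‖_{L^∞(B₁)} ≤ ς₀, and |u(x) − (ξ·x + b)| ≤ τ₀ in B₁ for some ξ ∈ ℝⁿ with |ξ| ≥ κ + 3μ — the function u is differentiable at every point of B_{1/2}, and there exists a constant C > 0 depending only on n, λ and Λ such that |Du(x) − Du(0)| ≤ τ₀C|x|^γ for every x ∈ B_{1/2}. -/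

import Mathlib

open Metric Set Matrix MeasureTheory
open scoped RealInnerProductSpace

noncomputable section

abbrev Euc (n : ℕ) := EuclideanSpace ℝ (Fin n)

def EllMat (n : ℕ) (lam Lam : ℝ) : Set (Matrix (Fin n) (Fin n) ℝ) :=
  {A | A.IsSymm ∧ ∀ ξ : Fin n → ℝ,
      lam * (ξ ⬝ᵥ ξ) ≤ ξ ⬝ᵥ A.mulVec ξ ∧ ξ ⬝ᵥ A.mulVec ξ ≤ Lam * (ξ ⬝ᵥ ξ)}

/-- Pucci maximal operator `M⁺`. -/
def pucciSup (n : ℕ) (lam Lam : ℝ) (M : Matrix (Fin n) (Fin n) ℝ) : ℝ :=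
  sSup ((fun A => (A * M).trace) '' EllMat n lam Lam)

/-- Pucci minimal operator `M⁻`. -/
def pucciInf (n : ℕ) (lam Lam : ℝ) (M : Matrix (Fin n) (Fin n) ℝ) : ℝ :=
  sInf ((fun A => (A * M).trace) '' EllMat n lam Lam)

/-- `(λ,Λ)`-ellipticity of `F`. -/
def IsUniformlyElliptic (n : ℕ) (lam Lam : ℝ)
    (F : Matrix (Fin n) (Fin n) ℝ → ℝ) : Prop :=
  ∀ M N : Matrix (Fin n) (Fin n) ℝ, M.IsSymm → N.IsSymm →
    pucciInf n lam Lam (M - N) ≤ F M - F N ∧ F M - F N ≤ pucciSup n lam Lam (M - N)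

/-- Hessian matrix of `φ` at `x`. -/
def hess {n : ℕ} (φ : Euc n → ℝ) (x : Euc n) : Matrix (Fin n) (Fin n) ℝ :=
  fun i j => iteratedFDeriv ℝ 2 φ x ![EuclideanSpace.single i 1, EuclideanSpace.single j 1]

/-- `κ`-grad viscosity subsolution of `G(Du, D²u) = f` in `s`. -/
def GradSubSol {n : ℕ} (κ : ℝ) (G : Euc n → Matrix (Fin n) (Fin n) ℝ → ℝ)
    (f : Euc n → ℝ) (s : Set (Euc n)) (u : Euc n → ℝ) : Prop :=
  ∀ x₀ ∈ s, ∀ φ : Euc n → ℝ, ContDiff ℝ 2 φ →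
    IsLocalMax (fun x => u x - φ x) x₀ → κ < ‖gradient φ x₀‖ →
    f x₀ ≤ G (gradient φ x₀) (hess φ x₀)

/-- `κ`-grad viscosity supersolution of `G(Du, D²u) = f` in `s`. -/
def GradSupSol {n : ℕ} (κ : ℝ) (G : Euc n → Matrix (Fin n) (Fin n) ℝ → ℝ)
    (f : Euc n → ℝ) (s : Set (Euc n)) (u : Euc n → ℝ) : Prop :=
  ∀ x₀ ∈ s, ∀ φ : Euc n → ℝ, ContDiff ℝ 2 φ →
    IsLocalMin (fun x => u x - φ x) x₀ → κ < ‖gradient φ x₀‖ →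
    G (gradient φ x₀) (hess φ x₀) ≤ f x₀

/-- `κ`-grad viscosity solution. -/
def GradSol {n : ℕ} (κ : ℝ) (G : Euc n → Matrix (Fin n) (Fin n) ℝ → ℝ)
    (f : Euc n → ℝ) (s : Set (Euc n)) (u : Euc n → ℝ) : Prop :=
  GradSubSol κ G f s u ∧ GradSupSol κ G f s u

/-- Classical viscosity solution (no restriction on the slope of test functions). -/
def ViscSol {n : ℕ} (G : Euc n → Matrix (Fin n) (Fin n) ℝ → ℝ)
    (f : Euc n → ℝ) (s : Set (Euc n)) (u : Euc n → ℝ) : Prop :=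
  (∀ x₀ ∈ s, ∀ φ : Euc n → ℝ, ContDiff ℝ 2 φ →
    IsLocalMax (fun x => u x - φ x) x₀ → f x₀ ≤ G (gradient φ x₀) (hess φ x₀)) ∧
  (∀ x₀ ∈ s, ∀ φ : Euc n → ℝ, ContDiff ℝ 2 φ →
    IsLocalMin (fun x => u x - φ x) x₀ → G (gradient φ x₀) (hess φ x₀) ≤ f x₀)

/-- The operator `G(ξ, M) = (|ξ|-κ)₊^q F(M)`. -/
def mainG {n : ℕ} (κ q : ℝ) (F : Matrix (Fin n) (Fin n) ℝ → ℝ) :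
    Euc n → Matrix (Fin n) (Fin n) ℝ → ℝ :=
  fun ξ M => max (‖ξ‖ - κ) 0 ^ q * F M

/-- The set `Ω_u` of points of `s` that can be touched from above or below by a `C²`
function with slope larger than `κ`. -/
def omegaSet {n : ℕ} (κ : ℝ) (s : Set (Euc n)) (u : Euc n → ℝ) : Set (Euc n) :=
  {x ∈ s | ∃ φ : Euc n → ℝ, ContDiff ℝ 2 φ ∧
    (IsLocalMax (fun y => u y - φ y) x ∨ IsLocalMin (fun y => u y - φ y) x) ∧
    κ < ‖gradient φ x‖}

/-- Effective viscosity solution of `(|Du|-κ)₊^q F(D²u) = f` in `s`. -/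
def EffectiveSol {n : ℕ} (κ q : ℝ) (F : Matrix (Fin n) (Fin n) ℝ → ℝ)
    (f : Euc n → ℝ) (s : Set (Euc n)) (u : Euc n → ℝ) : Prop :=
  IsOpen (omegaSet κ s u) ∧ ViscSol (mainG κ q F) f (omegaSet κ s u) u

section Regularity

open Filter Topology

section Envelope

variable {E : Type*} [NormedAddCommGroup E] [InnerProductSpace ℝ E]

theorem le_of_forall_pos_mul_sq {a b c : ℝ} (h : ∀ t : ℝ, 0 < t → t < 1 → a * t ≤ b * t + c * t ^ 2) :
    a ≤ b := by
  by_contra hab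
  push Not at hab
  have hc : 0 < |c| + 1 := by positivity
  set t : ℝ := min (1 / 2) ((a - b) / (2 * (|c| + 1))) with ht
  have ht0 : 0 < t := lt_min (by norm_num) (div_pos (by linarith) (by positivity))
  have ht1 : t < 1 := (min_le_left _ _).trans_lt (by norm_num)
  have h1 := h t ht0 ht1
  have h2 : t * (2 * (|c| + 1)) ≤ a - b := by
    rw [← le_div_iff₀ (by positivity)]; exact min_le_right _ _
  have h3 : c ≤ |c| := le_abs_self c
  have h4 : a ≤ b + c * t := by
    have : a * t ≤ (b + c * t) * t := by nlinarith
    exact le_of_mul_le_mul_right this ht0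
  nlinarith [abs_nonneg c]

/-- Two-sided quadratic bound for a semiconcave function which becomes convex after adding a
quadratic. -/
theorem semiconvex_lower_bound {g : E → ℝ} {P : E → E} {A k : ℝ}
    (hup : ∀ x z, g z ≤ g x + ⟪P x, z - x⟫ + A * ‖z - x‖ ^ 2)
    (hconv : ConvexOn ℝ univ fun x => g x + k * ‖x‖ ^ 2) (x z : E) :
    g x + ⟪P x, z - x⟫ - k * ‖z - x‖ ^ 2 ≤ g z := by
  set d := z - x with hd
  have hz : z = x + d := by simp [hd]
  have key : ∀ t : ℝ, 0 < t → t < 1 →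
      (⟪P x, d⟫ + 2 * k * ⟪x, d⟫) * t ≤
        (g z + k * ‖z‖ ^ 2 - (g x + k * ‖x‖ ^ 2)) * t + (A + |k|) * ‖d‖ ^ 2 * t ^ 2 := by
    intro t ht ht1
    have h1 := hup x (x - t • d)
    have h2 := hconv.2 (mem_univ (x - t • d)) (mem_univ (x + t • d))
      (by norm_num : (0 : ℝ) ≤ 1 / 2) (by norm_num : (0 : ℝ) ≤ 1 / 2) (by norm_num)
    have h3 := hconv.2 (mem_univ x) (mem_univ z) (sub_nonneg.mpr ht1.le) ht.le (by ring)
    have e1 : (1 / 2 : ℝ) • (x - t • d) + (1 / 2 : ℝ) • (x + t • d) = x := by module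
    have e2 : (1 - t) • x + t • z = x + t • d := by rw [hz]; module
    rw [e1] at h2
    rw [e2] at h3
    simp only [smul_eq_mul] at h2 h3
    have e3 : x - t • d - x = -(t • d) := by abel
    rw [e3, inner_neg_right, norm_neg, real_inner_smul_right, norm_smul, Real.norm_eq_abs,
      mul_pow, sq_abs] at h1
    have e4 : ‖x - t • d‖ ^ 2 = ‖x‖ ^ 2 - 2 * t * ⟪x, d⟫ + t ^ 2 * ‖d‖ ^ 2 := by
      rw [norm_sub_sq_real, real_inner_smul_right, norm_smul, Real.norm_eq_abs, mul_pow, sq_abs]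
      ring
    rw [e4] at h2
    have h5 : k * (t ^ 2 * ‖d‖ ^ 2) ≤ |k| * (t ^ 2 * ‖d‖ ^ 2) := by
      gcongr; exact le_abs_self k
    nlinarith
  have h := le_of_forall_pos_mul_sq key
  have e5 : ‖z‖ ^ 2 = ‖x‖ ^ 2 + 2 * ⟪x, d⟫ + ‖d‖ ^ 2 := by
    rw [hz, norm_add_sq_real]
  rw [e5] at h
  nlinarith

variable [FiniteDimensional ℝ E]

/-- A bounded lower semicontinuous function plus a quadratic penalisation attains its infimum. -/
theorem exists_min_add_sq {h : E → ℝ} (hl : LowerSemicontinuous h) {M : ℝ}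
    (hM : ∀ x, |h x| ≤ M) {c : ℝ} (hc : 0 < c) (x : E) :
    ∃ y, ∀ z, h y + c * ‖x - y‖ ^ 2 ≤ h z + c * ‖x - z‖ ^ 2 := by
  have hM0 : 0 ≤ M := (abs_nonneg _).trans (hM x)
  set R : ℝ := √(2 * M / c) with hR
  have hR2 : c * R ^ 2 = 2 * M := by
    rw [hR, Real.sq_sqrt (by positivity)]; field_simp
  have hR0 : 0 ≤ R := Real.sqrt_nonneg _
  have hls : LowerSemicontinuous fun y => h y + c * ‖x - y‖ ^ 2 :=
    hl.add (Continuous.lowerSemicontinuous (by fun_prop))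
  obtain ⟨y, hy, hmin⟩ := (hls.lowerSemicontinuousOn (closedBall x R)).exists_isMinOn
    ⟨x, mem_closedBall_self hR0⟩ (isCompact_closedBall x R)
  refine ⟨y, fun z => ?_⟩
  by_cases hz : z ∈ closedBall x R
  · exact hmin hz
  · have h1 : h y + c * ‖x - y‖ ^ 2 ≤ h x + c * ‖x - x‖ ^ 2 := hmin (mem_closedBall_self hR0)
    have h2 : R < ‖x - z‖ := by
      rw [mem_closedBall, dist_comm, dist_eq_norm] at hz; exact not_le.mp hz
    have h3 : c * R ^ 2 ≤ c * ‖x - z‖ ^ 2 := by gcongr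
    have h4 := abs_le.mp (hM x)
    have h5 := abs_le.mp (hM z)
    simp at h1
    linarith

/-- The inf-convolution of a bounded lower semicontinuous function with a quadratic kernel,
together with a choice of minimisers. -/
theorem exists_infConv {h : E → ℝ} (hl : LowerSemicontinuous h) {M : ℝ}
    (hM : ∀ x, |h x| ≤ M) {c : ℝ} (hc : 0 < c) :
    ∃ m : E → ℝ, ∃ y : E → E, (∀ x, m x = h (y x) + c * ‖x - y x‖ ^ 2) ∧
      (∀ x z, m x ≤ h z + c * ‖x - z‖ ^ 2) ∧ (∀ x, |m x| ≤ M) ∧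
      LowerSemicontinuous fun x => - m x := by
  choose y hy using exists_min_add_sq hl hM hc
  refine ⟨fun x => h (y x) + c * ‖x - y x‖ ^ 2, y, fun x => rfl, hy, fun x => ?_, ?_⟩
  · have h1 := hy x x
    have h4 := abs_le.mp (hM x)
    have h5 := abs_le.mp (hM (y x))
    have h6 : 0 ≤ c * ‖x - y x‖ ^ 2 := by positivity
    simp only [sub_self, norm_zero] at h1
    refine abs_le.mpr ⟨by linarith, by linarith⟩
  · intro x a ha
    have hcont : Continuous fun x' => -(h (y x) + c * ‖x' - y x‖ ^ 2) := by fun_prop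
    filter_upwards [(hcont.tendsto x).eventually (lt_mem_nhds ha)] with x' hx'
    exact hx'.trans_le (neg_le_neg (hy x' (y x)))

/-- Lasry--Lions type regularisation from above of a bounded continuous function. -/
theorem exists_envelope {W : E → ℝ} (hW : Continuous W) {M : ℝ} (hM : ∀ x, |W x| ≤ M)
    {t : ℝ} (ht : 0 < t) :
    ∃ g : E → ℝ, ∃ P : E → E,
      (∀ x z, g z ≤ g x + ⟪P x, z - x⟫ + 1 / (2 * t) * ‖z - x‖ ^ 2) ∧
      (∀ x z, g x + ⟪P x, z - x⟫ - 1 / (4 * t) * ‖z - x‖ ^ 2 ≤ g z) ∧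
      (∀ x, W x ≤ g x) ∧
      (∀ x, ∃ ζ, ‖ζ - x‖ ^ 2 ≤ 12 * t * M ∧ g x ≤ W ζ) ∧
      (∀ x p k, k < 1 / t →
        (∀ᶠ z in 𝓝 (0 : E), g (x + z) ≤ g x + ⟪p, z⟫ + k / 2 * ‖z‖ ^ 2) →
        ∃ ζ, ‖ζ - x‖ ^ 2 ≤ 12 * t * M ∧ ∀ z, W (ζ + z) - W ζ ≤ g (x + z) - g x) := by
  have hM0 : 0 ≤ M := (abs_nonneg _).trans (hM 0)
  have hnW : LowerSemicontinuous fun x => - W x := hW.neg.lowerSemicontinuous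
  obtain ⟨m, ζ, hm, hmle, hmM, hml⟩ := exists_infConv hnW (M := M)
    (by intro x; rw [abs_neg]; exact hM x) (c := 1 / (6 * t)) (by positivity)
  obtain ⟨g, y, hg, hgle, hgM, -⟩ := exists_infConv hml (M := M)
    (by intro x; rw [abs_neg]; exact hmM x) (c := 1 / (2 * t)) (by positivity)
  set P : E → E := fun x => (1 / t) • (x - y x) with hP
  have hup : ∀ x z, g z ≤ g x + ⟪P x, z - x⟫ + 1 / (2 * t) * ‖z - x‖ ^ 2 := by
    intro x z
    have h1 := hgle z (y x)
    have e1 : ‖z - y x‖ ^ 2 = ‖z - x‖ ^ 2 + 2 * ⟪x - y x, z - x⟫ + ‖x - y x‖ ^ 2 := by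
      rw [show z - y x = (z - x) + (x - y x) by abel, norm_add_sq_real, real_inner_comm]
    rw [hg x]
    simp only [hP, real_inner_smul_left]
    rw [e1] at h1
    refine h1.trans (le_of_eq ?_)
    field_simp
    ring
  have hWg : ∀ x, W x ≤ g x := by
    intro x
    rw [hg x]
    have h1 := hmle (y x) x
    rw [norm_sub_rev] at h1
    have h2 : 1 / (6 * t) * ‖x - y x‖ ^ 2 ≤ 1 / (2 * t) * ‖x - y x‖ ^ 2 := by
      gcongr; norm_num
    linarith
  have hid : ∀ x y : E, -(1 / (6 * t)) * ‖y‖ ^ 2 + 1 / (2 * t) * ‖x - y‖ ^ 2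
      + 1 / (4 * t) * ‖x‖ ^ 2 = 1 / (12 * t) * ‖(2 : ℝ) • y - (3 : ℝ) • x‖ ^ 2 := by
    intro x y
    rw [norm_sub_sq_real, norm_sub_sq_real, norm_smul, norm_smul, real_inner_smul_left,
      real_inner_smul_right, real_inner_comm]
    simp only [Real.norm_ofNat]
    field_simp
    ring
  -- convexity of `-m + |.|²/(6t)`
  have hcm : ConvexOn ℝ univ fun y => - m y + 1 / (6 * t) * ‖y‖ ^ 2 := by
    refine ⟨convex_univ, fun y₁ _ y₂ _ a b ha hb hab => ?_⟩
    simp only [smul_eq_mul]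
    set w := a • y₁ + b • y₂ with hw
    have h1 := hmle y₁ (ζ w)
    have h2 := hmle y₂ (ζ w)
    rw [hm w]
    have h3 : a * m y₁ + b * m y₂ ≤ a * (-W (ζ w) + 1 / (6 * t) * ‖y₁ - ζ w‖ ^ 2)
        + b * (-W (ζ w) + 1 / (6 * t) * ‖y₂ - ζ w‖ ^ 2) := by gcongr
    have e : ‖w - ζ w‖ ^ 2 - ‖w‖ ^ 2 = a * (‖y₁ - ζ w‖ ^ 2 - ‖y₁‖ ^ 2)
        + b * (‖y₂ - ζ w‖ ^ 2 - ‖y₂‖ ^ 2) := by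
      simp only [norm_sub_sq_real]
      rw [show ⟪w, ζ w⟫ = a * ⟪y₁, ζ w⟫ + b * ⟪y₂, ζ w⟫ by
        conv_lhs => rw [hw, inner_add_left, real_inner_smul_left, real_inner_smul_left]]
      have : b = 1 - a := by linarith
      subst this; ring
    have hab' : W (ζ w) = a * W (ζ w) + b * W (ζ w) := by rw [← add_mul, hab, one_mul]
    have e' := congrArg (fun r => 1 / (6 * t) * r) e
    nlinarith
  have hcg : ConvexOn ℝ univ fun x => g x + 1 / (4 * t) * ‖x‖ ^ 2 := by
    refine ⟨convex_univ, fun x₁ _ x₂ _ a b ha hb hab => ?_⟩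
    simp only [smul_eq_mul]
    have key : ∀ x z, g x + 1 / (4 * t) * ‖x‖ ^ 2 ≤ (- m z + 1 / (6 * t) * ‖z‖ ^ 2)
        + 1 / (12 * t) * ‖(2 : ℝ) • z - (3 : ℝ) • x‖ ^ 2 := by
      intro x z
      rw [← hid x z]; have := hgle x z; linarith
    have keq : ∀ x, g x + 1 / (4 * t) * ‖x‖ ^ 2 = (- m (y x) + 1 / (6 * t) * ‖y x‖ ^ 2)
        + 1 / (12 * t) * ‖(2 : ℝ) • y x - (3 : ℝ) • x‖ ^ 2 := by
      intro x
      rw [← hid x (y x), hg x]; ring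
    rw [keq x₁, keq x₂]
    have h1 := key (a • x₁ + b • x₂) (a • y x₁ + b • y x₂)
    have h2 := hcm.2 (mem_univ (y x₁)) (mem_univ (y x₂)) ha hb hab
    simp only [smul_eq_mul] at h2
    set u₁ := (2 : ℝ) • y x₁ - (3 : ℝ) • x₁
    set u₂ := (2 : ℝ) • y x₂ - (3 : ℝ) • x₂
    have e : (2 : ℝ) • (a • y x₁ + b • y x₂) - (3 : ℝ) • (a • x₁ + b • x₂)
        = a • u₁ + b • u₂ := by simp only [u₁, u₂]; module
    rw [e] at h1
    have h3 : ‖a • u₁ + b • u₂‖ ^ 2 ≤ a * ‖u₁‖ ^ 2 + b * ‖u₂‖ ^ 2 := by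
      have h4 : ‖a • u₁ + b • u₂‖ ≤ a * ‖u₁‖ + b * ‖u₂‖ := by
        refine (norm_add_le _ _).trans ?_
        rw [norm_smul, norm_smul, Real.norm_of_nonneg ha, Real.norm_of_nonneg hb]
      have h5 : ‖a • u₁ + b • u₂‖ ^ 2 ≤ (a * ‖u₁‖ + b * ‖u₂‖) ^ 2 := by gcongr
      have : b = 1 - a := by linarith
      subst this
      nlinarith [mul_nonneg (mul_nonneg ha hb) (sq_nonneg (‖u₁‖ - ‖u₂‖))]
    have h6 : 1 / (12 * t) * ‖a • u₁ + b • u₂‖ ^ 2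
        ≤ 1 / (12 * t) * (a * ‖u₁‖ ^ 2 + b * ‖u₂‖ ^ 2) := by gcongr
    nlinarith
  refine ⟨g, P, hup, semiconvex_lower_bound hup hcg, hWg, fun x => ?_, ?_⟩
  · refine ⟨ζ x, ?_, ?_⟩
    · have h1 := hmle x x
      rw [hm x] at h1
      simp only [sub_self, norm_zero] at h1
      have h2 := abs_le.mp (hM x)
      have h3 := abs_le.mp (hM (ζ x))
      have h4 : 1 / (6 * t) * ‖x - ζ x‖ ^ 2 ≤ 2 * M := by linarith
      rw [norm_sub_rev]
      rw [one_div, inv_mul_le_iff₀ (by positivity)] at h4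
      linarith
    · have h1 := hgle x x
      rw [hm x] at h1
      simp only [sub_self, norm_zero] at h1
      have : 0 ≤ 1 / (6 * t) * ‖x - ζ x‖ ^ 2 := by positivity
      linarith
  · intro x p k hk hloc
    set z₀ := ζ (y x) with hz₀
    -- the point on the segment from `y x` to `z₀` where the envelope meets the paraboloid
    set x' := y x + (1 / 3 : ℝ) • (z₀ - y x) with hx'
    have hmy := hm (y x)
    rw [← hz₀] at hmy
    -- translation bound
    have htr : ∀ z, W z₀ - 1 / (4 * t) * ‖z - z₀‖ ^ 2 ≤ g z := by
      intro z
      rw [hg z]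
      have h1 := hmle (y z) z₀
      have h2 := hid (z - z₀) (y z - z₀)
      have e1 : z - z₀ - (y z - z₀) = z - y z := by abel
      rw [e1] at h2
      have h3 : 0 ≤ 1 / (12 * t) * ‖(2 : ℝ) • (y z - z₀) - (3 : ℝ) • (z - z₀)‖ ^ 2 := by positivity
      linarith
    have hgx' : g (x') = g x + ⟪P x, x' - x⟫ + 1 / (2 * t) * ‖x' - x‖ ^ 2 := by
      apply le_antisymm (hup x x')
      have h1 := htr x'
      refine le_trans (le_of_eq ?_) h1
      have e1 : x' - z₀ = (-(2 / 3) : ℝ) • (z₀ - y x) := by rw [hx']; module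
      have e2 : x' - x = (x' - y x) - (x - y x) := by abel
      have e3 : x' - y x = (1 / 3 : ℝ) • (z₀ - y x) := by rw [hx']; module
      rw [hg x, hmy]
      simp only [hP, real_inner_smul_left]
      rw [e1, e2, norm_sub_sq_real (x' - y x) (x - y x), inner_sub_right,
        real_inner_self_eq_norm_sq, e3, norm_smul,
        norm_smul, real_inner_smul_left, real_inner_smul_right, norm_sub_rev (y x) z₀,
        real_inner_comm (x - y x)]
      simp only [norm_neg, Real.norm_eq_abs]
      rw [abs_of_pos (by norm_num : (0 : ℝ) < 2 / 3), abs_of_pos (by norm_num : (0 : ℝ) < 1 / 3)]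
      field_simp
      ring
    have hxx' : x' = x := by
      by_contra hne
      set d := x' - x with hd
      have hd0 : 0 < ‖d‖ := norm_pos_iff.mpr (sub_ne_zero.mpr hne)
      -- `g` agrees with the paraboloid on the segment
      have hseg : ∀ s : ℝ, 0 < s → s < 1 →
          g x + s * ⟪P x, d⟫ + 1 / (2 * t) * s ^ 2 * ‖d‖ ^ 2 ≤ g (x + s • d) := by
        intro s hs hs1
        have h1 := hup (x + s • d) x
        have h2 := hup (x + s • d) x'
        have e1 : x - (x + s • d) = -(s • d) := by abel
        have e2 : x' - (x + s • d) = (1 - s) • d := by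
          rw [sub_smul, one_smul, hd]; abel
        rw [e1, inner_neg_right, norm_neg, norm_smul, real_inner_smul_right, Real.norm_eq_abs,
          mul_pow, sq_abs] at h1
        rw [e2, norm_smul, real_inner_smul_right, Real.norm_eq_abs, mul_pow, sq_abs, hgx'] at h2
        have h3 := mul_le_mul_of_nonneg_left h1 (sub_nonneg.mpr hs1.le)
        have h4 := mul_le_mul_of_nonneg_left h2 hs.le
        nlinarith
      have hcon : Tendsto (fun s : ℝ => s • d) (𝓝[>] 0) (𝓝 0) := by
        have : Tendsto (fun s : ℝ => s • d) (𝓝 0) (𝓝 ((0 : ℝ) • d)) :=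
          (continuous_id.smul continuous_const).tendsto 0
        rw [zero_smul] at this
        exact this.mono_left nhdsWithin_le_nhds
      have hcon2 : Tendsto (fun s : ℝ => -(s • d)) (𝓝[>] 0) (𝓝 0) := by
        simpa using hcon.neg
      have hev : ∀ᶠ s : ℝ in 𝓝[>] 0, 0 < s ∧ s < 1 ∧
          g (x + s • d) ≤ g x + ⟪p, s • d⟫ + k / 2 * ‖s • d‖ ^ 2 ∧
          g (x + -(s • d)) ≤ g x + ⟪p, -(s • d)⟫ + k / 2 * ‖-(s • d)‖ ^ 2 := by
        filter_upwards [self_mem_nhdsWithin, mem_nhdsWithin_of_mem_nhds (Iio_mem_nhds one_pos),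
          hcon.eventually hloc, hcon2.eventually hloc] with s h1 h2 h3 h4
        exact ⟨h1, h2, h3, h4⟩
      have hlow := semiconvex_lower_bound hup hcg
      -- slopes coincide
      have hslope : ⟪P x, d⟫ = ⟪p, d⟫ := by
        have hall : ∀ᶠ s : ℝ in 𝓝[>] 0,
            |⟪P x, d⟫ - ⟪p, d⟫| ≤ (|k| / 2 + 1 / (4 * t)) * ‖d‖ ^ 2 * s := by
          filter_upwards [hev] with s ⟨h1, h2, h3, h4⟩
          have l1 := hlow x (x + s • d)
          have l2 := hlow x (x + -(s • d))
          simp only [add_sub_cancel_left, inner_neg_right, norm_neg, norm_smul,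
            real_inner_smul_right, Real.norm_eq_abs, mul_pow, sq_abs] at l1 l2 h3 h4
          have hk' : k / 2 * (s ^ 2 * ‖d‖ ^ 2) ≤ |k| / 2 * (s ^ 2 * ‖d‖ ^ 2) := by
            gcongr; exact le_abs_self k
          rw [abs_le]
          constructor
          · have : -((|k| / 2 + 1 / (4 * t)) * ‖d‖ ^ 2 * s) * s ≤ (⟪P x, d⟫ - ⟪p, d⟫) * s := by
              nlinarith
            exact le_of_mul_le_mul_right this h1
          · have : (⟪P x, d⟫ - ⟪p, d⟫) * s ≤ ((|k| / 2 + 1 / (4 * t)) * ‖d‖ ^ 2 * s) * s := by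
              nlinarith
            exact le_of_mul_le_mul_right this h1
        have hlim : Tendsto (fun s : ℝ => (|k| / 2 + 1 / (4 * t)) * ‖d‖ ^ 2 * s) (𝓝[>] 0)
            (𝓝 0) := by
          have : Tendsto (fun s : ℝ => (|k| / 2 + 1 / (4 * t)) * ‖d‖ ^ 2 * s) (𝓝 0)
            (𝓝 ((|k| / 2 + 1 / (4 * t)) * ‖d‖ ^ 2 * 0)) :=
            (continuous_const.mul continuous_id).tendsto 0
          rw [mul_zero] at this
          exact this.mono_left nhdsWithin_le_nhds
        have := ge_of_tendsto hlim hall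
        have h0 := abs_nonpos_iff.mp this
        linarith
      obtain ⟨s, h1, h2, h3, -⟩ := hev.exists
      have h5 := hseg s h1 h2
      simp only [norm_smul, real_inner_smul_right, Real.norm_eq_abs, mul_pow, sq_abs] at h3
      rw [hslope] at h5
      have h6 : 1 / (2 * t) * (s ^ 2 * ‖d‖ ^ 2) ≤ k / 2 * (s ^ 2 * ‖d‖ ^ 2) := by linarith
      have h7 : 0 < s ^ 2 * ‖d‖ ^ 2 := by positivity
      have h8 := le_of_mul_le_mul_right h6 h7
      have h9 : 1 / (2 * t) = 1 / t / 2 := by field_simp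
      linarith
    have hgx : g x = W z₀ - 1 / (4 * t) * ‖x - z₀‖ ^ 2 := by
      have hx3 := hxx'.symm.trans hx'
      have e3 : x - y x = (1 / 3 : ℝ) • (z₀ - y x) := by
        rw [sub_eq_iff_eq_add']
        exact hx3
      have e1 : x - z₀ = (-(2 / 3) : ℝ) • (z₀ - y x) := by
        have : x - z₀ = (x - y x) - (z₀ - y x) := by abel
        rw [this, e3]
        module
      rw [hg x, hmy, e1, e3, norm_smul, norm_smul, norm_sub_rev (y x) z₀]
      simp only [norm_neg, Real.norm_eq_abs]
      rw [abs_of_pos (by norm_num : (0 : ℝ) < 2 / 3), abs_of_pos (by norm_num : (0 : ℝ) < 1 / 3)]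
      field_simp
      ring
    refine ⟨z₀, ?_, fun z => ?_⟩
    · have h1 := hWg x
      have h2 := abs_le.mp (hM x)
      have h3 := abs_le.mp (hM z₀)
      have h4 : 1 / (4 * t) * ‖x - z₀‖ ^ 2 ≤ 2 * M := by linarith
      rw [norm_sub_rev]
      rw [one_div, inv_mul_le_iff₀ (by positivity)] at h4
      nlinarith
    · have : W (z₀ + z) - 1 / (4 * t) * ‖x - z₀‖ ^ 2 ≤ g (x + z) := by
        rw [hg (x + z)]
        have h1 := hmle (y (x + z)) (z₀ + z)
        have h2 := hid (x - z₀) (y (x + z) - (z₀ + z))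
        have e1 : x - z₀ - (y (x + z) - (z₀ + z)) = x + z - y (x + z) := by abel
        rw [e1] at h2
        have h3 : 0 ≤ 1 / (12 * t) *
          ‖(2 : ℝ) • (y (x + z) - (z₀ + z)) - (3 : ℝ) • (x - z₀)‖ ^ 2 := by positivity
        linarith
      linarith

end Envelope

section SecondOrder

variable {E : Type*} [NormedAddCommGroup E] [InnerProductSpace ℝ E]

/-- `g` has a two-sided quadratic Taylor bound with slope field `P`. -/
def QuadBound (A : ℝ) (g : E → ℝ) (P : E → E) : Prop :=
  ∀ x z, |g z - g x - ⟪P x, z - x⟫| ≤ A * ‖z - x‖ ^ 2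

theorem QuadBound.add {A B : ℝ} {g k : E → ℝ} {P Q : E → E} (h : QuadBound A g P)
    (h' : QuadBound B k Q) : QuadBound (A + B) (fun x => g x + k x) (fun x => P x + Q x) := by
  intro x z
  have h1 := abs_le.mp (h x z)
  have h2 := abs_le.mp (h' x z)
  rw [inner_add_left, abs_le]
  constructor <;> nlinarith

theorem QuadBound.neg {A : ℝ} {g : E → ℝ} {P : E → E} (h : QuadBound A g P) :
    QuadBound A (fun x => - g x) (fun x => - P x) := by
  intro x z
  have h1 := abs_le.mp (h x z)
  rw [inner_neg_left, abs_le]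
  constructor <;> linarith

theorem QuadBound.hasFDerivAt {A : ℝ} {g : E → ℝ} {P : E → E} (h : QuadBound A g P) (x : E) :
    HasFDerivAt g (innerSL ℝ (P x)) x := by
  rw [hasFDerivAt_iff_isLittleO_nhds_zero]
  have h1 : (fun z : E => g (x + z) - g x - innerSL ℝ (P x) z) =O[𝓝 0] fun z => ‖z‖ ^ 2 := by
    refine Asymptotics.IsBigO.of_bound A (Eventually.of_forall fun z => ?_)
    have := h x (x + z)
    simp only [add_sub_cancel_left] at this
    simpa using this
  refine h1.trans_isLittleO ?_
  have := (Asymptotics.isLittleO_norm_pow_id (E' := E) one_lt_two)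
  simpa using this

/-- Slopes of two quadratic Taylor bounds on a ball at two points within distance `d` differ
by at most `3 A d`. -/
theorem slope_diff_le {g : E → ℝ} {x y p q : E} {d κ : ℝ} (hd : 0 < d)
    (hp : ∀ z, ‖z‖ = d → |g (y + z) - g x - ⟪p, y + z - x⟫| ≤ κ)
    (hq : ∀ z, ‖z‖ = d → |g (y + z) - g y - ⟪q, z⟫| ≤ κ)
    (hpq : |g y - g x - ⟪p, y - x⟫| ≤ κ) : ‖p - q‖ * d ≤ 3 * κ := by
  rcases eq_or_ne p q with rfl | hne
  · have := (abs_nonneg _).trans hpq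
    simp; exact this
  have hn : 0 < ‖p - q‖ := norm_pos_iff.mpr (sub_ne_zero.mpr hne)
  set z : E := (d / ‖p - q‖) • (p - q) with hz
  have hzn : ‖z‖ = d := by
    rw [hz, norm_smul, Real.norm_of_nonneg (by positivity)]; field_simp
  have h1 := abs_le.mp (hp z hzn)
  have h2 := abs_le.mp (hq z hzn)
  have h3 := abs_le.mp hpq
  have e1 : ⟪p, y + z - x⟫ = ⟪p, y - x⟫ + ⟪p, z⟫ := by
    rw [← inner_add_right]; congr 1; abel
  have e2 : ⟪p, z⟫ - ⟪q, z⟫ = ‖p - q‖ * d := by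
    rw [← inner_sub_left, hz, real_inner_smul_right, real_inner_self_eq_norm_sq]; field_simp
  linarith

theorem QuadBound.norm_sub_le {A : ℝ} {g : E → ℝ} {P : E → E} (h : QuadBound A g P) (x y : E) :
    ‖P x - P y‖ ≤ 12 * A * ‖x - y‖ := by
  rcases eq_or_ne x y with rfl | hne
  · simp
  have hd : 0 < ‖x - y‖ := norm_pos_iff.mpr (sub_ne_zero.mpr hne)
  have hA : 0 ≤ A := by
    have := (abs_nonneg _).trans (h y x)
    exact nonneg_of_mul_nonneg_left this (by positivity)
  have key := slope_diff_le (g := g) (x := x) (y := y) (p := P x) (q := P y)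
    (κ := A * (2 * ‖x - y‖) ^ 2) hd ?_ ?_ ?_
  · have : ‖P x - P y‖ * ‖x - y‖ ≤ (12 * A * ‖x - y‖) * ‖x - y‖ := by nlinarith
    exact le_of_mul_le_mul_right this hd
  · intro z hz
    refine (h x (y + z)).trans ?_
    gcongr
    calc ‖y + z - x‖ = ‖z - (x - y)‖ := by congr 1; abel
      _ ≤ ‖z‖ + ‖x - y‖ := _root_.norm_sub_le _ _
      _ = 2 * ‖x - y‖ := by rw [hz]; ring
  · intro z hz
    have := h y (y + z)
    rw [add_sub_cancel_left] at this
    refine this.trans ?_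
    rw [hz]; gcongr; linarith
  · refine (h x y).trans ?_
    rw [norm_sub_rev y x]; gcongr; linarith

theorem QuadBound.lipschitz {A : ℝ} {g : E → ℝ} {P : E → E} (h : QuadBound A g P) :
    LipschitzWith (Real.toNNReal (12 * A)) P :=
  LipschitzWith.of_dist_le_mul fun x y => by
    rw [dist_eq_norm, dist_eq_norm]
    refine (h.norm_sub_le x y).trans ?_
    gcongr
    exact Real.le_coe_toNNReal _

theorem QuadBound.continuous {A : ℝ} {g : E → ℝ} {P : E → E} (h : QuadBound A g P) :
    Continuous g :=
  continuous_iff_continuousAt.mpr fun x => (h.hasFDerivAt x).continuousAt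

/-- Where the gradient field is differentiable, its derivative is symmetric. -/
theorem QuadBound.symm_fderiv {A : ℝ} {g : E → ℝ} {P : E → E} (h : QuadBound A g P) {x : E}
    {B : E →L[ℝ] E} (hB : HasFDerivAt P B x) (v w : E) : ⟪B v, w⟫ = ⟪B w, v⟫ := by
  have h1 : HasFDerivAt (fun y => innerSL ℝ (P y)) ((innerSL ℝ).comp B) x :=
    ((innerSL ℝ (E := E)).hasFDerivAt (x := P x)).comp x hB
  have := second_derivative_symmetric_of_eventually
    (Eventually.of_forall fun y => h.hasFDerivAt y) h1 v w
  simpa using this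

/-- Second order Taylor expansion at points where the gradient field is differentiable. -/
theorem QuadBound.taylor {A : ℝ} {g : E → ℝ} {P : E → E} (h : QuadBound A g P) {x : E}
    {B : E →L[ℝ] E} (hB : HasFDerivAt P B x) {η : ℝ} (hη : 0 < η) :
    ∀ᶠ z in 𝓝 (0 : E), |g (x + z) - g x - ⟪P x, z⟫ - ⟪B z, z⟫ / 2| ≤ η * ‖z‖ ^ 2 := by
  have h1 := (hasFDerivAt_iff_isLittleO_nhds_zero.mp hB).def hη
  rw [Metric.eventually_nhds_iff_ball] at h1
  obtain ⟨r, hr, h1⟩ := h1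
  rw [Metric.eventually_nhds_iff_ball]
  refine ⟨r, hr, fun z hz => ?_⟩
  rw [mem_ball_zero_iff] at hz
  have hder : ∀ y : E, HasFDerivAt
      (fun z => g (x + z) - g x - ⟪P x, z⟫ - ⟪B z, z⟫ / 2)
      (innerSL ℝ (P (x + y) - P x - B y)) y := by
    intro y
    have d1 : HasFDerivAt (fun z => g (x + z)) (innerSL ℝ (P (x + y))) y := by
      have := h.hasFDerivAt (x + y)
      have h2 : HasFDerivAt (fun z : E => x + z) (ContinuousLinearMap.id ℝ E) y :=
        (hasFDerivAt_id y).const_add x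
      have h3 := HasFDerivAt.comp y this h2
      rwa [ContinuousLinearMap.comp_id] at h3
    have d2 : HasFDerivAt (fun z => ⟪P x, z⟫) (innerSL ℝ (P x)) y :=
      (innerSL ℝ (P x)).hasFDerivAt
    have d3 := (B.hasFDerivAt (x := y)).inner ℝ (hasFDerivAt_id y)
    have d4 := ((d1.sub_const (g x)).sub d2).sub (d3.const_mul (1 / 2 : ℝ))
    refine (d4.congr_fderiv ?_).congr_of_eventuallyEq (Eventually.of_forall fun z => ?_)
    · ext v
      have := h.symm_fderiv hB y v
      simp [fderivInnerCLM_apply]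
      rw [← this]; ring
    · simp; ring
  have := (convex_closedBall (0 : E) ‖z‖).norm_image_sub_le_of_norm_hasFDerivWithin_le
    (f := fun z => g (x + z) - g x - ⟪P x, z⟫ - ⟪B z, z⟫ / 2) (C := η * ‖z‖) (x := 0) (y := z)
    (fun y _ => (hder y).hasFDerivWithinAt) ?_ (by simp) (by simp)
  · simpa [pow_two, mul_assoc] using this
  · intro y hy
    rw [mem_closedBall_zero_iff] at hy
    rw [innerSL_apply_norm]
    refine (h1 y (by rw [mem_ball_zero_iff]; linarith)).trans ?_
    gcongr

variable [FiniteDimensional ℝ E] [MeasurableSpace E] [BorelSpace E]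

theorem measure_lipschitz_image_null (μ : Measure E) [μ.IsAddHaarMeasure] {K : NNReal} {f : E → E}
    (hf : LipschitzWith K f) {s : Set E} (hs : μ s = 0) : μ (f '' s) = 0 := by
  have e1 := Measure.isAddLeftInvariant_eq_smul μ
    (Measure.hausdorffMeasure (Module.finrank ℝ E : ℝ) : Measure E)
  have e2 := Measure.isAddLeftInvariant_eq_smul
    (Measure.hausdorffMeasure (Module.finrank ℝ E : ℝ) : Measure E) μ
  have h1 : (Measure.hausdorffMeasure (Module.finrank ℝ E : ℝ) : Measure E) s = 0 := by
    rw [e2]; simp [hs]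
  have h2 := hf.hausdorffMeasure_image_le (d := (Module.finrank ℝ E : ℝ)) (by positivity) s
  rw [h1, mul_zero, nonpos_iff_eq_zero] at h2
  rw [e1]; simp [h2]

/-- Jensen's lemma: after a small linear perturbation, a strict local minimum of a function with
Lipschitz gradient can be moved off a given null set. -/
theorem QuadBound.jensen (μ : Measure E) [μ.IsAddHaarMeasure] {A : ℝ} {G : E → ℝ} {P : E → E}
    (h : QuadBound A G P) {x₀ c : E} {r δ : ℝ} (hδ : 0 < δ)
    (hx₀ : ‖x₀ - c‖ < r) (hmin : ∀ z, ‖z - c‖ = r → G x₀ + δ ≤ G z) {Z : Set E} (hZ : μ Z = 0) {ε : ℝ}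
    (hε : 0 < ε) :
    ∃ x, ‖x - c‖ < r ∧ x ∉ Z ∧ ‖P x‖ ≤ ε ∧
      ∀ z, ‖z - c‖ ≤ r → G x + ⟪P x, z - x⟫ ≤ G z := by
  have hr : 0 < r := (norm_nonneg _).trans_lt hx₀
  set ε' := min ε (δ / (4 * r)) with hε'
  have hε'0 : 0 < ε' := lt_min hε (by positivity)
  have key : ∀ p ∈ ball (0 : E) ε', ∃ x, ‖x - c‖ < r ∧ P x = p ∧
      ∀ z, ‖z - c‖ ≤ r → G x + ⟪P x, z - x⟫ ≤ G z := by
    intro p hp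
    rw [mem_ball_zero_iff] at hp
    have hcont : Continuous fun z => G z - ⟪p, z⟫ := h.continuous.sub (by fun_prop)
    obtain ⟨x, hx, hxmin⟩ := (isCompact_closedBall c r).exists_isMinOn
      ⟨x₀, by rw [mem_closedBall, dist_eq_norm]; exact hx₀.le⟩ hcont.continuousOn
    have hle : ∀ z, ‖z - c‖ ≤ r → G x - ⟪p, x⟫ ≤ G z - ⟪p, z⟫ := fun z hz =>
      hxmin (by rwa [mem_closedBall, dist_eq_norm])
    rw [mem_closedBall, dist_eq_norm] at hx
    have hlt : ‖x - c‖ < r := by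
      refine lt_of_le_of_ne hx fun heq => ?_
      have h1 := hmin x heq
      have h2 := hle x₀ hx₀.le
      have h3 : ⟪p, x - x₀⟫ ≤ ‖p‖ * ‖x - x₀‖ := real_inner_le_norm _ _
      have h6 : ‖x - x₀‖ ≤ 2 * r := by
        calc ‖x - x₀‖ = ‖(x - c) - (x₀ - c)‖ := by congr 1; abel
          _ ≤ ‖x - c‖ + ‖x₀ - c‖ := _root_.norm_sub_le _ _
          _ ≤ 2 * r := by linarith
      rw [inner_sub_right] at h3
      have h4 : ‖p‖ * ‖x - x₀‖ ≤ δ / (4 * r) * (2 * r) := by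
        have := hp.le.trans (min_le_right _ _)
        gcongr
      have h5 : δ / (4 * r) * (2 * r) = δ / 2 := by field_simp; ring
      linarith
    have hP : P x = p := by
      have hloc : IsLocalMin (fun z => G z - ⟪p, z⟫) x := by
        have : ball c r ∈ 𝓝 x := isOpen_ball.mem_nhds (by rwa [mem_ball, dist_eq_norm])
        filter_upwards [this] with z hz
        rw [mem_ball, dist_eq_norm] at hz
        exact hle z hz.le
      have h1 := hloc.hasFDerivAt_eq_zero ((h.hasFDerivAt x).sub (innerSL ℝ p).hasFDerivAt)
      have h2 : innerSL ℝ (P x) = innerSL ℝ p := sub_eq_zero.mp h1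
      have h3 : ∀ v, ⟪P x, v⟫ = ⟪p, v⟫ := fun v => by
        have := congrArg (fun T => T v) h2
        simpa using this
      exact ext_inner_right ℝ h3
    refine ⟨x, hlt, hP, fun z hz => ?_⟩
    have := hle z hz
    rw [hP, inner_sub_right]; linarith
  by_contra hcon
  push Not at hcon
  have hsub : ball (0 : E) ε' ⊆ P '' Z := by
    intro p hp
    obtain ⟨x, hx, hPx, hle⟩ := key p hp
    by_cases hxZ : x ∈ Z
    · exact ⟨x, hxZ, hPx⟩
    · exfalso
      have hPε : ‖P x‖ ≤ ε := by
        rw [hPx]; rw [mem_ball_zero_iff] at hp; exact hp.le.trans (min_le_left _ _)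
      obtain ⟨z, hz, hz'⟩ := hcon x hx hxZ hPε
      exact absurd (hle z hz) (not_le.mpr hz')
  have h0 : μ (ball (0 : E) ε') = 0 :=
    measure_mono_null hsub (measure_lipschitz_image_null μ h.lipschitz hZ)
  exact (measure_ball_pos μ 0 hε'0).ne' h0

theorem QuadBound.ae_differentiableAt (μ : Measure E) [μ.IsAddHaarMeasure] {A : ℝ} {G : E → ℝ}
    {P : E → E} (h : QuadBound A G P) : μ {x | ¬ DifferentiableAt ℝ P x} = 0 :=
  h.lipschitz.ae_differentiableAt (μ := μ)

end SecondOrder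

section Jets

variable {E : Type*} [NormedAddCommGroup E] [InnerProductSpace ℝ E]

/-- `(p, X)` is a second order superjet of `W` at `x`. -/
def SupJet (W : E → ℝ) (x p : E) (X : E →L[ℝ] E) : Prop :=
  ∀ η : ℝ, 0 < η → ∀ᶠ z in 𝓝 (0 : E),
    W (x + z) ≤ W x + ⟪p, z⟫ + ⟪X z, z⟫ / 2 + η * ‖z‖ ^ 2

/-- `(p, X)` is a second order subjet of `W` at `x`. -/
def SubJet (W : E → ℝ) (x p : E) (X : E →L[ℝ] E) : Prop :=
  ∀ η : ℝ, 0 < η → ∀ᶠ z in 𝓝 (0 : E),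
    W x + ⟪p, z⟫ + ⟪X z, z⟫ / 2 - η * ‖z‖ ^ 2 ≤ W (x + z)

theorem SupJet.neg {W : E → ℝ} {x p : E} {X : E →L[ℝ] E} (h : SupJet W x p X) :
    SubJet (fun y => - W y) x (-p) (-X) := by
  intro η hη
  filter_upwards [h η hη] with z hz
  simp only [inner_neg_left, _root_.neg_apply]
  linarith

theorem SubJet.neg {W : E → ℝ} {x p : E} {X : E →L[ℝ] E} (h : SubJet W x p X) :
    SupJet (fun y => - W y) x (-p) (-X) := by
  intro η hη
  filter_upwards [h η hη] with z hz
  simp only [inner_neg_left, _root_.neg_apply]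
  linarith

theorem QuadBound.supJet {A : ℝ} {g : E → ℝ} {P : E → E} (h : QuadBound A g P) {x : E}
    {B : E →L[ℝ] E} (hB : HasFDerivAt P B x) : SupJet g x (P x) B := fun η hη => by
  filter_upwards [h.taylor hB hη] with z hz
  have := (abs_le.mp hz).2
  linarith

/-- A superjet passes from a function to another one whose increments it controls. -/
theorem SupJet.transfer {W g : E → ℝ} {x ζ p : E} {X : E →L[ℝ] E} (h : SupJet g x p X)
    (hW : ∀ z, W (ζ + z) - W ζ ≤ g (x + z) - g x) : SupJet W ζ p X := fun η hη => by
  filter_upwards [h η hη] with z hz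
  have := hW z
  linarith

/-- At a local minimum, the second derivative is nonnegative. -/
theorem nonneg_of_second_order_min {G : E → ℝ} {x p : E} {B : E →L[ℝ] E}
    (hG : SupJet G x p B) (hmin : ∀ᶠ z in 𝓝 (0 : E), G x + ⟪p, z⟫ ≤ G (x + z)) (v : E) :
    0 ≤ ⟪B v, v⟫ := by
  by_contra hneg
  push Not at hneg
  have hv : 0 < ‖v‖ := by
    rw [norm_pos_iff]; rintro rfl; simp at hneg
  have hη : 0 < -⟪B v, v⟫ / (4 * ‖v‖ ^ 2) := div_pos (by linarith) (by positivity)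
  have hcon : Tendsto (fun s : ℝ => s • v) (𝓝[>] 0) (𝓝 0) := by
    have : Tendsto (fun s : ℝ => s • v) (𝓝 0) (𝓝 ((0 : ℝ) • v)) :=
      (continuous_id.smul continuous_const).tendsto 0
    rw [zero_smul] at this
    exact this.mono_left nhdsWithin_le_nhds
  have hpos : ∀ᶠ s : ℝ in 𝓝[>] 0, 0 < s := self_mem_nhdsWithin
  obtain ⟨s, hs, h1, h2⟩ := (hpos.and
    ((hcon.eventually (hG _ hη)).and (hcon.eventually hmin))).exists
  simp only [map_smul, real_inner_smul_left, real_inner_smul_right, norm_smul, mul_pow,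
    Real.norm_eq_abs, sq_abs] at h1 h2
  have e : -⟪B v, v⟫ / (4 * ‖v‖ ^ 2) * (s ^ 2 * ‖v‖ ^ 2) = -⟪B v, v⟫ / 4 * s ^ 2 := by
    field_simp
  rw [e] at h1
  have : 0 < s ^ 2 := by positivity
  nlinarith

end Jets

section TouchSets

variable {E : Type*} [NormedAddCommGroup E]

/-- Points where `V` is touched from below by a paraboloid of opening `-a`. -/
def touchSet (V : E → ℝ) (a : ℝ) : Set E :=
  {x | ∃ y, ∀ ζ, V x + a / 2 * ‖x - y‖ ^ 2 ≤ V ζ + a / 2 * ‖ζ - y‖ ^ 2}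

theorem touchSet_eq_of_envelope {V e : E → ℝ} {y : E → E} {a : ℝ}
    (h1 : ∀ x ζ, e x + a / 2 * ‖x - y x‖ ^ 2 - a / 2 * ‖ζ - y x‖ ^ 2 ≤ V ζ)
    (h2 : ∀ x y' s, (∀ ζ, s - a / 2 * ‖ζ - y'‖ ^ 2 ≤ V ζ) → s - a / 2 * ‖x - y'‖ ^ 2 ≤ e x) :
    touchSet V a = {x | V x ≤ e x} := by
  ext x
  constructor
  · rintro ⟨y', hy'⟩
    have := h2 x y' (V x + a / 2 * ‖x - y'‖ ^ 2) fun ζ => by have := hy' ζ; linarith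
    simp only [mem_ofPred_eq]; linarith
  · intro hx
    refine ⟨y x, fun ζ => ?_⟩
    have := h1 x ζ
    simp only [mem_ofPred_eq] at hx
    linarith

/-- Truncation of `U` used in the measure estimate. -/
def truncation (U : E → ℝ) (x : E) : ℝ := min (max (U x) 0 + 4 * ‖x‖ ^ 2) 1

theorem truncation_nonneg (U : E → ℝ) (x : E) : 0 ≤ truncation U x :=
  le_min (by positivity) zero_le_one

theorem truncation_le_one (U : E → ℝ) (x : E) : truncation U x ≤ 1 := min_le_right _ _

theorem abs_truncation_le (U : E → ℝ) (x : E) : |truncation U x| ≤ 1 := by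
  rw [abs_of_nonneg (truncation_nonneg U x)]; exact truncation_le_one U x

theorem norm_lt_of_truncation_lt {U : E → ℝ} {x : E} (h : truncation U x < 1) : ‖x‖ < 1 / 2 := by
  have h1 : max (U x) 0 + 4 * ‖x‖ ^ 2 < 1 := by
    rcases min_lt_iff.mp h with h | h
    · exact h
    · exact absurd h (lt_irrefl _)
  have h2 : 0 ≤ max (U x) 0 := le_max_right _ _
  have h3 := norm_nonneg x
  by_contra hcon
  push Not at hcon
  nlinarith

theorem eventually_touch_of_truncation {U : E → ℝ} (hU0 : ∀ x ∈ ball (0 : E) 1, 0 ≤ U x) {z y : E}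
    {b : ℝ} (hz : truncation U z < 1)
    (h : ∀ ζ, truncation U z + b / 2 * ‖z - y‖ ^ 2 ≤ truncation U ζ + b / 2 * ‖ζ - y‖ ^ 2) :
    ∀ᶠ ζ in 𝓝 z, (U z + 8 / 2 * ‖z - 0‖ ^ 2) + b / 2 * ‖z - y‖ ^ 2 ≤
      (U ζ + 8 / 2 * ‖ζ - 0‖ ^ 2) + b / 2 * ‖ζ - y‖ ^ 2 := by
  have hzn := norm_lt_of_truncation_lt hz
  have hb : ball (0 : E) 1 ∈ 𝓝 z := isOpen_ball.mem_nhds (by rw [mem_ball_zero_iff]; linarith)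
  have e1 : truncation U z = U z + 4 * ‖z‖ ^ 2 := by
    have h1 := hU0 z (by rw [mem_ball_zero_iff]; linarith)
    unfold truncation at hz ⊢
    rw [max_eq_left h1] at hz ⊢
    refine min_eq_left ?_
    by_contra hcon
    push Not at hcon
    rw [min_eq_right hcon.le] at hz
    exact lt_irrefl _ hz
  filter_upwards [hb] with ζ hζ
  have h1 := h ζ
  have h2 : truncation U ζ ≤ U ζ + 4 * ‖ζ‖ ^ 2 := by
    unfold truncation
    rw [max_eq_left (hU0 ζ hζ)]
    exact min_le_left _ _
  simp only [sub_zero]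
  linarith

theorem continuous_truncation {U : E → ℝ} (hU : Continuous U) : Continuous (truncation U) := by
  unfold truncation
  fun_prop

theorem compl_touchSet_truncation_subset (U : E → ℝ) {a : ℝ} (ha : 8 ≤ a) :
    (touchSet (truncation U) a)ᶜ ⊆ ball 0 1 := by
  intro x hx
  by_contra hcon
  rw [mem_ball_zero_iff, not_lt] at hcon
  refine hx ⟨x, fun ζ => ?_⟩
  simp only [sub_self, norm_zero]
  have h1 := truncation_le_one U x
  have h2 := truncation_nonneg U ζ
  have h3 := sq_nonneg ‖ζ - x‖
  by_cases hζ : truncation U ζ < 1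
  · have h4 := norm_lt_of_truncation_lt hζ
    have h5 : 1 / 2 ≤ ‖ζ - x‖ := by
      have := norm_sub_norm_le x ζ
      rw [norm_sub_rev] at this
      linarith
    have h6 : 1 / 4 ≤ ‖ζ - x‖ ^ 2 := by nlinarith
    nlinarith
  · push Not at hζ
    nlinarith

end TouchSets

section Decay

variable {E : Type*} [NormedAddCommGroup E] [InnerProductSpace ℝ E]

theorem touchSet_mono {V : E → ℝ} {a b : ℝ} (ha : 0 < a) (hab : a ≤ b) :
    touchSet V a ⊆ touchSet V b := by
  rintro x ⟨y, hy⟩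
  have hb : 0 < b := ha.trans_le hab
  refine ⟨x + (a / b) • (y - x), fun ζ => ?_⟩
  have h1 := hy ζ
  have e1 : x - (x + (a / b) • (y - x)) = (-(a / b)) • (y - x) := by module
  have e2 : ζ - (x + (a / b) • (y - x)) = (ζ - x) - (a / b) • (y - x) := by abel
  have e3 : ζ - y = (ζ - x) - (y - x) := by abel
  rw [e1, e2, norm_sub_sq_real (ζ - x), norm_smul, norm_smul, real_inner_smul_right, mul_pow, mul_pow]
  rw [e3, norm_sub_sq_real (ζ - x), norm_sub_rev x y] at h1
  simp only [Real.norm_eq_abs, sq_abs, abs_neg]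
  have e4 : b / 2 * (‖ζ - x‖ ^ 2 - 2 * (a / b * ⟪ζ - x, y - x⟫) + (a / b) ^ 2 * ‖y - x‖ ^ 2)
      = b / 2 * ‖ζ - x‖ ^ 2 - a * ⟪ζ - x, y - x⟫ + b / 2 * ((a / b) ^ 2 * ‖y - x‖ ^ 2) := by
    field_simp
  rw [e4]
  have : a * ‖ζ - x‖ ^ 2 ≤ b * ‖ζ - x‖ ^ 2 := by gcongr
  nlinarith

variable [FiniteDimensional ℝ E]

/-- The envelope of all paraboloids of opening `-a` below `V`, with a choice of vertices. -/
theorem exists_paraboloid_envelope [MeasurableSpace E] [BorelSpace E] {V : E → ℝ}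
    (hV : Continuous V) {M : ℝ} (hM : ∀ x, |V x| ≤ M)
    {a : ℝ} (ha : 0 < a) : ∃ e : E → ℝ, ∃ y : E → E, Measurable e ∧
      (∀ x ζ, e x + a / 2 * ‖x - y x‖ ^ 2 - a / 2 * ‖ζ - y x‖ ^ 2 ≤ V ζ) ∧
      (∀ x y' s, (∀ ζ, s - a / 2 * ‖ζ - y'‖ ^ 2 ≤ V ζ) → s - a / 2 * ‖x - y'‖ ^ 2 ≤ e x) := by
  obtain ⟨m, w, hm, hmle, hmM, hml⟩ := exists_infConv hV.lowerSemicontinuous hM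
    (c := a / 2) (by positivity)
  obtain ⟨e, y, he, hele, heM, hel⟩ := exists_infConv hml (M := M)
    (by intro x; rw [abs_neg]; exact hmM x) (c := a / 2) (by positivity)
  refine ⟨fun x => - e x, y, hel.measurable, fun x ζ => ?_, fun x y' s hs => ?_⟩
  · have h1 := hmle (y x) ζ
    have h2 := he x
    rw [norm_sub_rev] at h1
    linarith
  · have h1 := hele x y'
    have h2 := hs (w y')
    have h3 := hm y'
    rw [norm_sub_rev (w y') y'] at h2
    linarith

/-- The Hausdorff measure of full dimension. -/
abbrev haus (E : Type*) [NormedAddCommGroup E] [InnerProductSpace ℝ E] [FiniteDimensional ℝ E]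
    [MeasurableSpace E] [BorelSpace E] : Measure E :=
  Measure.hausdorffMeasure (Module.finrank ℝ E : ℝ)

variable [MeasurableSpace E] [BorelSpace E]

theorem measurableSet_touchSet {V : E → ℝ} (hV : Continuous V) {M : ℝ} (hM : ∀ x, |V x| ≤ M)
    {a : ℝ} (ha : 0 < a) : MeasurableSet (touchSet V a) := by
  obtain ⟨e, y, hme, h1, h2⟩ := exists_paraboloid_envelope hV hM ha
  rw [touchSet_eq_of_envelope h1 h2]
  exact measurableSet_le hV.measurable hme

/-- Doubling the opening of the paraboloids captures a fixed fraction of the points not yet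
touched. -/
theorem measure_compl_touchSet_le {V : E → ℝ} (hV : Continuous V) {M : ℝ} (hM : ∀ x, |V x| ≤ M)
    {a : ℝ} (ha : 0 < a) {Q : E → E}
    (hQ : ∀ z y b, (b = a ∨ b = 2 * a) →
      (∀ ζ, V z + b / 2 * ‖z - y‖ ^ 2 ≤ V ζ + b / 2 * ‖ζ - y‖ ^ 2) → b • (y - z) = Q z) :
    haus E (touchSet V a)ᶜ ≤ 2 ^ Module.finrank ℝ E *
      haus E ((fun z => z + (1 / (2 * a)) • Q z) '' (touchSet V (2 * a) ∩ (touchSet V a)ᶜ)) := by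
  obtain ⟨e, y, hme, h1, h2⟩ := exists_paraboloid_envelope hV hM ha
  have hset := touchSet_eq_of_envelope h1 h2
  set T : E → E := fun x => (1 / 2 : ℝ) • (x + y x) with hT
  have hmono : ∀ x x', 0 ≤ ⟪x - x', y x - y x'⟫ := by
    intro x x'
    have k1 := h2 x' (y x) _ (h1 x)
    have k2 := h2 x (y x') _ (h1 x')
    have k3 : a / 2 * (‖x - y x‖ ^ 2 - ‖x' - y x‖ ^ 2 + ‖x' - y x'‖ ^ 2 - ‖x - y x'‖ ^ 2) ≤ 0 := by
      linarith
    have k4 := nonpos_of_mul_nonpos_right k3 (by positivity)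
    simp only [norm_sub_sq_real] at k4
    simp only [inner_sub_left, inner_sub_right]
    linarith
  have hanti : AntilipschitzWith 2 T := by
    refine AntilipschitzWith.of_le_mul_dist fun x x' => ?_
    rw [dist_eq_norm, dist_eq_norm]
    have e1 : T x - T x' = (1 / 2 : ℝ) • ((x - x') + (y x - y x')) := by
      simp only [hT]; module
    rw [e1, norm_smul, Real.norm_of_nonneg (by norm_num)]
    have : ‖x - x'‖ ≤ ‖(x - x') + (y x - y x')‖ := by
      apply le_of_sq_le_sq _ (norm_nonneg _)
      rw [norm_add_sq_real]
      have := hmono x x'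
      nlinarith [sq_nonneg ‖y x - y x'‖]
    simp only [NNReal.coe_ofNat]
    linarith
  have hsub : T '' (touchSet V a)ᶜ ⊆
      (fun z => z + (1 / (2 * a)) • Q z) '' (touchSet V (2 * a) ∩ (touchSet V a)ᶜ) := by
    rintro _ ⟨x, hx, rfl⟩
    obtain ⟨z, hz⟩ := exists_min_add_sq hV.lowerSemicontinuous hM ha (T x)
    have hz' : ∀ ζ, V z + (2 * a) / 2 * ‖z - T x‖ ^ 2 ≤ V ζ + (2 * a) / 2 * ‖ζ - T x‖ ^ 2 := by
      intro ζ
      have := hz ζ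
      rw [norm_sub_rev (T x), norm_sub_rev (T x)] at this
      linarith
    have hQz := hQ z (T x) (2 * a) (Or.inr rfl) hz'
    refine ⟨z, ⟨⟨T x, hz'⟩, ?_⟩, ?_⟩
    · rintro ⟨y', hy'⟩
      have hQz' := hQ z y' a (Or.inl rfl) hy'
      have e1 : y' = (2 : ℝ) • T x - z := by
        have e2 : a • (y' - z) = a • ((2 : ℝ) • (T x - z)) := by
          rw [hQz', ← hQz, smul_smul, mul_comm]
        have e3 := smul_right_injective E ha.ne' e2
        rw [sub_eq_iff_eq_add] at e3
        rw [e3]; module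
      have e2 : y' = x + y x - z := by
        rw [e1]; simp only [hT]; module
      have k1 := h2 x y' (V z + a / 2 * ‖z - y'‖ ^ 2) fun ζ => by have := hy' ζ; linarith
      have k2 := h1 x z
      have k3 : a / 2 * (‖z - y'‖ ^ 2 - ‖x - y'‖ ^ 2 + ‖x - y x‖ ^ 2 - ‖z - y x‖ ^ 2) ≤ 0 := by
        linarith
      have k4 := nonpos_of_mul_nonpos_right k3 (by positivity)
      have k5 : 2 * ‖z - x‖ ^ 2 ≤ 0 := by
        refine le_trans (le_of_eq ?_) k4
        rw [e2]
        have e3 : z - (x + y x - z) = (2 : ℝ) • (z - x) + (x - y x) := by module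
        have e4 : x - (x + y x - z) = (z - x) + (x - y x) := by module
        have e5 : z - y x = (z - x) + (x - y x) := by module
        rw [e3, e4, e5]
        simp only [norm_add_sq_real, norm_smul, real_inner_smul_left, Real.norm_ofNat, mul_pow]
        ring
      have k6 : ‖z - x‖ = 0 := by
        have := sq_nonneg ‖z - x‖
        exact pow_eq_zero_iff two_ne_zero |>.mp (by linarith)
      rw [norm_eq_zero, sub_eq_zero] at k6
      exact hx (k6 ▸ ⟨y', hy'⟩)
    · simp only
      rw [← hQz, smul_smul, one_div, inv_mul_cancel₀ (by positivity), one_smul]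
      abel
  have h3 := hanti.le_hausdorffMeasure_image (d := (Module.finrank ℝ E : ℝ)) (by positivity)
    (touchSet V a)ᶜ
  refine h3.trans ?_
  have e5 : ((2 : NNReal) : ENNReal) ^ (Module.finrank ℝ E : ℝ) = 2 ^ Module.finrank ℝ E := by
    rw [ENNReal.rpow_natCast]; norm_cast
  rw [e5]
  gcongr

end Decay

section Growth

variable {E : Type*} [NormedAddCommGroup E] [InnerProductSpace ℝ E]

theorem quadBound_sq (k : ℝ) (y : E) :
    QuadBound (|k| / 2) (fun x => k / 2 * ‖x - y‖ ^ 2) (fun x => k • (x - y)) := by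
  intro x z
  have e : k / 2 * ‖z - y‖ ^ 2 - k / 2 * ‖x - y‖ ^ 2 - ⟪k • (x - y), z - x⟫
      = k / 2 * ‖z - x‖ ^ 2 := by
    rw [show z - y = (x - y) + (z - x) by abel, norm_add_sq_real, real_inner_smul_left]
    ring
  simp only [e]
  rw [abs_mul, abs_div, abs_of_nonneg (sq_nonneg ‖z - x‖), abs_of_pos (two_pos : (0 : ℝ) < 2)]

theorem hasFDerivAt_smul_sub (k : ℝ) (y x : E) :
    HasFDerivAt (fun x => k • (x - y)) (k • ContinuousLinearMap.id ℝ E) x :=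
  ((hasFDerivAt_id x).sub_const y).const_smul k

theorem norm_apply_le_of_quadForm {S : E →L[ℝ] E} (hS : ∀ v w, ⟪S v, w⟫ = ⟪S w, v⟫) {C : ℝ}
    (hC : 0 < C) (h0 : ∀ v, 0 ≤ ⟪S v, v⟫) (h1 : ∀ v, ⟪S v, v⟫ ≤ C * ‖v‖ ^ 2) : ‖S‖ ≤ C := by
  refine S.opNorm_le_bound hC.le fun v => ?_
  have k := h0 (C • v - S v)
  simp only [map_sub, map_smul, inner_sub_left, inner_sub_right, real_inner_smul_left,
    real_inner_smul_right] at k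
  have k1 := h1 (S v)
  have k2 := h1 v
  have k3 := hS (S v) v
  rw [real_inner_self_eq_norm_sq] at k k3
  have k4 : C * ‖S v‖ ^ 2 ≤ C * (C * ‖v‖) ^ 2 := by
    have k5 := mul_le_mul_of_nonneg_left k2 (mul_nonneg hC.le hC.le)
    nlinarith
  exact le_of_sq_le_sq (le_of_mul_le_mul_left k4 hC) (by positivity)

variable [FiniteDimensional ℝ E] [MeasurableSpace E] [BorelSpace E]

theorem abs_det_le_norm_pow (A : E →L[ℝ] E) : |A.det| ≤ ‖A‖ ^ Module.finrank ℝ E := by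
  set μ := haus E
  have h1 : μ (A '' ball 0 1) = ENNReal.ofReal |A.det| * μ (ball 0 1) :=
    Measure.addHaar_image_continuousLinearMap μ A _
  have h2 : A '' ball 0 1 ⊆ closedBall 0 ‖A‖ := by
    rintro _ ⟨v, hv, rfl⟩
    rw [mem_ball_zero_iff] at hv
    rw [mem_closedBall_zero_iff]
    exact (A.le_opNorm v).trans (mul_le_of_le_one_right (norm_nonneg _) hv.le)
  have h3 := measure_mono (μ := μ) h2
  rw [h1, Measure.addHaar_closedBall μ _ (norm_nonneg _)] at h3
  have h4 := (ENNReal.mul_le_mul_iff_left (measure_ball_pos μ 0 one_pos).ne'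
    measure_ball_lt_top.ne).mp h3
  exact (ENNReal.ofReal_le_ofReal_iff (by positivity)).mp h4

theorem measure_image_le_of_norm_deriv_le {f : E → E} {f' : E → E →L[ℝ] E} {s : Set E}
    (hs : MeasurableSet s) (hf : ∀ x ∈ s, HasFDerivAt f (f' x) x) {C : ℝ}
    (hC : ∀ x ∈ s, ‖f' x‖ ≤ C) :
    haus E (f '' s) ≤ ENNReal.ofReal (C ^ Module.finrank ℝ E) * haus E s := by
  refine (addHaar_image_le_lintegral_abs_det_fderiv (haus E) hs
    fun x hx => (hf x hx).hasFDerivWithinAt).trans ?_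
  rw [← setLIntegral_const]
  refine setLIntegral_mono measurable_const fun x hx => ENNReal.ofReal_le_ofReal ?_
  refine (abs_det_le_norm_pow _).trans ?_
  have := hC x hx
  gcongr

/-- Wherever the second derivative exists, a lower bound for it up to level `K` forces an upper
bound. -/
def HessDichotomy (P : E → E) (Γ ε K : ℝ) : Prop :=
  ∃ Z : Set E, haus E Z = 0 ∧ ∀ x ∈ ball (0 : E) 1, x ∉ Z → ∃ B : E →L[ℝ] E, HasFDerivAt P B x ∧
    ∀ c, 0 ≤ c → c ≤ K → (∀ h, -c * ‖h‖ ^ 2 ≤ ⟪B h, h⟫) → ∀ h, ⟪B h, h⟫ ≤ Γ * (c + ε) * ‖h‖ ^ 2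

theorem measure_compl_touchSet_truncation {A : ℝ} {U : E → ℝ} {P : E → E} (hU : QuadBound A U P)
    (hU0 : ∀ x ∈ ball (0 : E) 1, 0 ≤ U x) {Γ ε K a : ℝ} (hΓ : 0 ≤ Γ) (hε : ε ≤ 1)
    (ha : 8 ≤ a) (hK : 2 * a + 8 ≤ K) (hP : HessDichotomy P Γ ε K) :
    haus E (touchSet (truncation U) a)ᶜ ≤ ENNReal.ofReal ((2 * (2 + 3 * Γ)) ^ Module.finrank ℝ E) *
      haus E (touchSet (truncation U) (2 * a) ∩ (touchSet (truncation U) a)ᶜ) := by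
  classical
  have ha0 : 0 < a := by linarith
  set V := truncation U with hVdef
  have hVc : Continuous V := continuous_truncation hU.continuous
  have hV1 : ∀ x, |V x| ≤ 1 := abs_truncation_le U
  set Q : E → E := fun z => if V z = 1 then 0 else P z + (8 : ℝ) • z with hQdef
  have hlt : ∀ z, V z ≠ 1 → V z < 1 := fun z hz => lt_of_le_of_ne (truncation_le_one U z) hz
  have hder : ∀ z y b, V z < 1 →
      (∀ ζ, V z + b / 2 * ‖z - y‖ ^ 2 ≤ V ζ + b / 2 * ‖ζ - y‖ ^ 2) →
      P z + (8 : ℝ) • z + b • (z - y) = 0 := by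
    intro z y b hz h
    have h1 := eventually_touch_of_truncation hU0 hz h
    have h2 := (hU.add (quadBound_sq 8 0)).add (quadBound_sq b y)
    have h3 := IsLocalMin.hasFDerivAt_eq_zero (f := fun x => U x + 8 / 2 * ‖x - 0‖ ^ 2 +
      b / 2 * ‖x - y‖ ^ 2) (a := z) h1 (h2.hasFDerivAt z)
    have h4 := congrArg (fun T => T (P z + (8 : ℝ) • (z - 0) + b • (z - y))) h3
    simp only [innerSL_apply_apply, _root_.zero_apply, inner_self_eq_zero, sub_zero] at h4
    exact h4
  have hQ : ∀ z y b, (b = a ∨ b = 2 * a) →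
      (∀ ζ, V z + b / 2 * ‖z - y‖ ^ 2 ≤ V ζ + b / 2 * ‖ζ - y‖ ^ 2) → b • (y - z) = Q z := by
    intro z y b hb h
    have hb0 : 0 < b := by rcases hb with rfl | rfl <;> linarith
    by_cases hz : V z = 1
    · have h1 := h y
      have h2 := truncation_le_one U y
      simp only [sub_self, norm_zero] at h1
      have h3 : b / 2 * ‖z - y‖ ^ 2 ≤ 0 := by
        have : V y ≤ 1 := h2
        linarith
      have h4 : ‖z - y‖ ^ 2 ≤ 0 := nonpos_of_mul_nonpos_right h3 (by positivity)
      have h5 : z - y = 0 := by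
        rw [← norm_eq_zero, ← pow_eq_zero_iff two_ne_zero]
        exact le_antisymm h4 (sq_nonneg _)
      rw [sub_eq_zero] at h5
      simp [hQdef, hz, h5.symm]
    · have := hder z y b (hlt z hz) h
      simp only [hQdef, hz, if_false]
      rw [← sub_eq_zero, ← neg_eq_zero, ← this]
      module
  refine (measure_compl_touchSet_le hVc hV1 ha0 hQ).trans ?_
  set S := touchSet V (2 * a) ∩ (touchSet V a)ᶜ with hS
  have hSm : MeasurableSet S :=
    (measurableSet_touchSet hVc hV1 (by positivity)).inter (measurableSet_touchSet hVc hV1 ha0).compl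
  obtain ⟨Z, hZ0, hZ⟩ := hP
  set Z' := toMeasurable (haus E) Z with hZ'
  have hZ'0 : haus E Z' = 0 := by rw [hZ', measure_toMeasurable, hZ0]
  have hZ'm : MeasurableSet Z' := measurableSet_toMeasurable _ _
  set Θ : E → E := fun z => z + (1 / (2 * a)) • Q z with hΘ
  set Θ₂ : E → E := fun z => z + (1 / (2 * a)) • (P z + (8 : ℝ) • (z - 0)) with hΘ₂
  set S₁ := S ∩ {z | V z = 1} with hS₁
  set S₂ := (S ∩ {z | V z = 1}ᶜ) \ Z' with hS₂
  have hVm : MeasurableSet {z | V z = 1} := measurableSet_eq_fun hVc.measurable measurable_const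
  have hcover : Θ '' S ⊆ (S₁ ∪ Θ₂ '' S₂) ∪ Θ₂ '' Z' := by
    rintro _ ⟨z, hz, rfl⟩
    by_cases h1 : V z = 1
    · refine Or.inl (Or.inl ?_)
      have : Θ z = z := by simp [hΘ, hQdef, h1]
      rw [this]; exact ⟨hz, h1⟩
    · have h2 : Θ z = Θ₂ z := by simp [hΘ, hΘ₂, hQdef, h1]
      by_cases h3 : z ∈ Z'
      · exact Or.inr ⟨z, h3, h2.symm⟩
      · exact Or.inl (Or.inr ⟨z, ⟨⟨hz, h1⟩, h3⟩, h2.symm⟩)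
  have hnull : haus E (Θ₂ '' Z') = 0 := by
    have hl : LipschitzWith (1 + ‖(1 / (2 * a) : ℝ)‖₊ * (Real.toNNReal (12 * A) + ‖(8 : ℝ)‖₊ * (1 + 0))) Θ₂ := by
      refine LipschitzWith.id.add ?_
      refine LipschitzWith.comp (f := fun w : E => (1 / (2 * a)) • w) (lipschitzWith_smul _) ?_
      refine hU.lipschitz.add ?_
      exact LipschitzWith.comp (f := fun w : E => (8 : ℝ) • w) (lipschitzWith_smul _)
        (LipschitzWith.id.sub (LipschitzWith.const _))
    exact measure_lipschitz_image_null _ hl hZ'0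
  have hC1 : (1 : ℝ) ≤ 2 + 3 * Γ := by linarith
  have hder2 : ∀ z, ∃ D : E →L[ℝ] E, z ∈ S₂ → HasFDerivAt Θ₂ D z ∧ ‖D‖ ≤ 2 + 3 * Γ := by
    intro z
    by_cases hz : z ∈ S₂
    swap
    · exact ⟨0, fun h => absurd h hz⟩
    obtain ⟨⟨⟨⟨y, hy⟩, -⟩, hV⟩, hzZ⟩ := hz
    have hVz := hlt z hV
    obtain ⟨B, hB, hBc⟩ := hZ z
      (by rw [mem_ball_zero_iff]; have := norm_lt_of_truncation_lt hVz; linarith)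
      fun h => hzZ (subset_toMeasurable _ _ h)
    have h1 := eventually_touch_of_truncation hU0 hVz hy
    have h2 := (hU.add (quadBound_sq 8 0)).add (quadBound_sq (2 * a) y)
    have hd := (hB.add (hasFDerivAt_smul_sub 8 0 z))
    have h3 := h2.supJet (hd.add (hasFDerivAt_smul_sub (2 * a) y z))
    have h0 : P z + (8 : ℝ) • (z - 0) + (2 * a) • (z - y) = 0 := by
      rw [sub_zero]; exact hder z y (2 * a) hVz hy
    have hcon : Tendsto (fun w : E => z + w) (𝓝 0) (𝓝 z) := by
      have : Tendsto (fun w : E => z + w) (𝓝 0) (𝓝 (z + 0)) :=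
        (continuous_const.add continuous_id).tendsto 0
      rwa [add_zero] at this
    have h4 := nonneg_of_second_order_min h3 (by
      filter_upwards [hcon.eventually h1] with w hw
      rw [h0, inner_zero_left, add_zero]; exact hw)
    have h5 : ∀ h, -(2 * a + 8) * ‖h‖ ^ 2 ≤ ⟪B h, h⟫ := by
      intro h
      have := h4 h
      simp only [_root_.add_apply, _root_.smul_apply, ContinuousLinearMap.id_apply,
        inner_add_left, real_inner_smul_left, real_inner_self_eq_norm_sq] at this
      linarith
    have h6 := hBc (2 * a + 8) (by positivity) hK h5
    refine ⟨ContinuousLinearMap.id ℝ E + (1 / (2 * a)) • (B + (8 : ℝ) • ContinuousLinearMap.id ℝ E),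
      fun _ => ⟨(hasFDerivAt_id z).add (hd.const_smul _), ?_⟩⟩
    refine norm_apply_le_of_quadForm ?_ (by linarith) ?_ ?_
    · intro v w
      simp only [_root_.add_apply, _root_.smul_apply, ContinuousLinearMap.id_apply,
        inner_add_left, real_inner_smul_left]
      rw [hU.symm_fderiv hB v w, real_inner_comm v w]
    · intro v
      simp only [_root_.add_apply, _root_.smul_apply, ContinuousLinearMap.id_apply,
        inner_add_left, real_inner_smul_left, real_inner_self_eq_norm_sq]
      have e : ‖v‖ ^ 2 + 1 / (2 * a) * (⟪B v, v⟫ + 8 * ‖v‖ ^ 2)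
          = (⟪B v, v⟫ + (2 * a + 8) * ‖v‖ ^ 2) / (2 * a) := by field_simp; ring
      rw [e]
      have := h5 v
      exact div_nonneg (by linarith) (by positivity)
    · intro v
      simp only [_root_.add_apply, _root_.smul_apply, ContinuousLinearMap.id_apply,
        inner_add_left, real_inner_smul_left, real_inner_self_eq_norm_sq]
      have e : ‖v‖ ^ 2 + 1 / (2 * a) * (⟪B v, v⟫ + 8 * ‖v‖ ^ 2)
          = (⟪B v, v⟫ + (2 * a + 8) * ‖v‖ ^ 2) / (2 * a) := by field_simp; ring
      rw [e, div_le_iff₀ (by positivity)]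
      have h7 := h6 v
      have h8 : Γ * (2 * a + 8 + ε) ≤ Γ * (4 * a) := by gcongr; linarith
      have h9 : Γ * (2 * a + 8 + ε) * ‖v‖ ^ 2 ≤ Γ * (4 * a) * ‖v‖ ^ 2 := by gcongr
      have h10 : 8 * ‖v‖ ^ 2 ≤ a * ‖v‖ ^ 2 := by gcongr
      have h11 : 0 ≤ Γ * a * ‖v‖ ^ 2 := by positivity
      nlinarith
  choose D hD using hder2
  have himg := measure_image_le_of_norm_deriv_le (f := Θ₂) (f' := D) (s := S₂)
    ((hSm.inter hVm.compl).diff hZ'm) (fun x hx => (hD x hx).1) (fun x hx => (hD x hx).2)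
  have hpow : ENNReal.ofReal ((2 * (2 + 3 * Γ)) ^ Module.finrank ℝ E)
      = 2 ^ Module.finrank ℝ E * ENNReal.ofReal ((2 + 3 * Γ) ^ Module.finrank ℝ E) := by
    rw [mul_pow, ENNReal.ofReal_mul (by positivity), ENNReal.ofReal_pow (by norm_num)]
    simp
  rw [hpow, mul_assoc]
  gcongr
  calc haus E (Θ '' S) ≤ haus E ((S₁ ∪ Θ₂ '' S₂) ∪ Θ₂ '' Z') := measure_mono hcover
    _ ≤ haus E (S₁ ∪ Θ₂ '' S₂) + haus E (Θ₂ '' Z') := measure_union_le _ _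
    _ ≤ (haus E S₁ + haus E (Θ₂ '' S₂)) + 0 := by
        rw [hnull]; gcongr; exact measure_union_le _ _
    _ ≤ ENNReal.ofReal ((2 + 3 * Γ) ^ Module.finrank ℝ E) * haus E S₁
        + ENNReal.ofReal ((2 + 3 * Γ) ^ Module.finrank ℝ E) * haus E (S \ {z | V z = 1}) := by
        rw [add_zero]
        gcongr
        · refine le_mul_of_one_le_left zero_le ?_
          rw [← ENNReal.ofReal_one]
          exact ENNReal.ofReal_le_ofReal (one_le_pow₀ hC1)
        · refine himg.trans ?_
          gcongr
          exact sdiff_subset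
    _ = ENNReal.ofReal ((2 + 3 * Γ) ^ Module.finrank ℝ E) * haus E S := by
        rw [← mul_add, measure_inter_add_sdiff S hVm]

end Growth

section ReachingBalls

variable {E : Type*} [NormedAddCommGroup E] [InnerProductSpace ℝ E]
  [FiniteDimensional ℝ E] [MeasurableSpace E] [BorelSpace E]

theorem HessDichotomy.mono {P : E → E} {Γ ε K K' : ℝ} (h : HessDichotomy P Γ ε K) (hK : K' ≤ K) :
    HessDichotomy P Γ ε K' := by
  obtain ⟨Z, hZ, h⟩ := h
  refine ⟨Z, hZ, fun x hx hxZ => ?_⟩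
  obtain ⟨B, hB, h⟩ := h x hx hxZ
  exact ⟨B, hB, fun c hc hcK => h c hc (hcK.trans hK)⟩

/-- If `U` is large on half of a ball, it is bounded below on a small ball. -/
theorem exists_ball_lower_bound (E : Type*) [NormedAddCommGroup E] [InnerProductSpace ℝ E]
    [FiniteDimensional ℝ E] [MeasurableSpace E] [BorelSpace E] {Γ : ℝ} (hΓ : 0 ≤ Γ) :
    ∃ ρ > (0 : ℝ), ρ ≤ 1 / 20 ∧ ∃ K : ℝ, ∀ (U : E → ℝ) (P : E → E) (A ε : ℝ), QuadBound A U P →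
      (∀ x ∈ ball (0 : E) 1, 0 ≤ U x) → ε ≤ 1 → HessDichotomy P Γ ε K →
      (1 / 2 : ENNReal) * haus E (ball 0 (1 / 4)) ≤ haus E {x ∈ ball 0 (1 / 4) | 1 ≤ U x} →
      ∃ x₁ ∈ ball (0 : E) (1 / 4), ∀ z, ‖z - x₁‖ ≤ ρ → 1 / 8 ≤ U z := by
  set D : ℝ := (2 * (2 + 3 * Γ)) ^ Module.finrank ℝ E with hD
  have hD1 : 1 ≤ D := one_le_pow₀ (by linarith)
  set m1 := (haus E (ball 0 1)).toReal with hm1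
  set m4 := (haus E (ball 0 (1 / 4))).toReal with hm4
  have hm4pos : 0 < m4 :=
    ENNReal.toReal_pos (measure_ball_pos _ _ (by norm_num)).ne' measure_ball_lt_top.ne
  have hD2 : 0 ≤ 1 - 1 / D := by
    rw [sub_nonneg, div_le_one (by linarith)]; exact hD1
  have hlim : Tendsto (fun k : ℕ => (1 - 1 / D) ^ k * m1) atTop (𝓝 (0 * m1)) := by
    refine Tendsto.mul_const _ (tendsto_pow_atTop_nhds_zero_of_lt_one hD2 ?_)
    have : 0 < 1 / D := by positivity
    linarith
  rw [zero_mul] at hlim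
  obtain ⟨k, hk⟩ := (hlim.eventually (gt_mem_nhds (show (0 : ℝ) < 1 / 2 * m4 by positivity))).exists
  refine ⟨1 / (20 * 2 ^ k), by positivity, ?_, 400 * 2 ^ k * 2 + 8, ?_⟩
  · have : (1 : ℝ) ≤ 2 ^ k := one_le_pow₀ (by norm_num)
    gcongr; linarith
  intro U P A ε hU hU0 hε hP hmeas
  set V := truncation U with hV
  have hVc : Continuous V := continuous_truncation hU.continuous
  set N : ℕ → Set E := fun j => (touchSet V (400 * 2 ^ j))ᶜ with hN
  have h400 : ∀ j : ℕ, (8 : ℝ) ≤ 400 * 2 ^ j := fun j => by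
    have : (1 : ℝ) ≤ 2 ^ j := one_le_pow₀ (by norm_num)
    linarith
  have hNball : ∀ j, N j ⊆ ball 0 1 := fun j => compl_touchSet_truncation_subset U (h400 j)
  have hfin : ∀ j, haus E (N j) ≠ ⊤ := fun j =>
    ((measure_mono (hNball j)).trans_lt measure_ball_lt_top).ne
  have hstep : ∀ j, j < k + 1 → (haus E (N (j + 1))).toReal ≤ (1 - 1 / D) * (haus E (N j)).toReal := by
    intro j hj
    have h1 := measure_compl_touchSet_truncation hU hU0 hΓ hε (h400 j) (K := 400 * 2 ^ k * 2 + 8)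
      (by
        have : (2 : ℝ) ^ j ≤ 2 ^ k := pow_le_pow_right₀ (by norm_num) (by omega)
        linarith) hP
    have e2 : (2 : ℝ) * (400 * 2 ^ j) = 400 * 2 ^ (j + 1) := by ring
    rw [e2] at h1
    have h2 : haus E (touchSet V (400 * 2 ^ (j + 1)) ∩ N j) + haus E (N (j + 1)) = haus E (N j) := by
      have := measure_inter_add_sdiff (μ := haus E) (N j) (t := touchSet V (400 * 2 ^ (j + 1)))
        (measurableSet_touchSet hVc (abs_truncation_le U) (by positivity))
      rw [inter_comm] at this
      rw [← this]
      congr 2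
      ext x
      simp only [hN, mem_compl_iff, Set.mem_sdiff]
      refine ⟨fun h => ⟨fun h' => h (touchSet_mono (by positivity) ?_ h'), h⟩, fun h => h.2⟩
      gcongr
      · norm_num
      · omega
    have hf3 : haus E (touchSet V (400 * 2 ^ (j + 1)) ∩ N j) ≠ ⊤ :=
      ((measure_mono inter_subset_right).trans_lt (lt_top_iff_ne_top.mpr (hfin j))).ne
    have h3 := congrArg ENNReal.toReal h2
    rw [ENNReal.toReal_add hf3 (hfin _)] at h3
    have h4 := ENNReal.toReal_mono (ENNReal.mul_ne_top ENNReal.ofReal_ne_top hf3) h1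
    rw [ENNReal.toReal_mul, ENNReal.toReal_ofReal (by positivity)] at h4
    have h5 : (haus E (N j)).toReal ≤ D * (haus E (touchSet V (400 * 2 ^ (j + 1)) ∩ N j)).toReal := h4
    have h6 : 1 / D * (haus E (N j)).toReal
        ≤ (haus E (touchSet V (400 * 2 ^ (j + 1)) ∩ N j)).toReal := by
      rw [one_div, inv_mul_le_iff₀ (by linarith)]; exact h5
    linarith
  have hiter : ∀ j, j ≤ k → (haus E (N j)).toReal ≤ (1 - 1 / D) ^ j * m1 := by
    intro j
    induction j with
    | zero =>
      intro _
      rw [pow_zero, one_mul]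
      exact ENNReal.toReal_mono measure_ball_lt_top.ne (measure_mono (hNball 0))
    | succ j ih =>
      intro hj
      refine (hstep j (by omega)).trans ?_
      rw [pow_succ', mul_assoc]
      exact mul_le_mul_of_nonneg_left (ih (by omega)) hD2
  have hex : ∃ x₁ ∈ {x ∈ ball (0 : E) (1 / 4) | 1 ≤ U x}, x₁ ∉ N k := by
    by_contra hcon
    push Not at hcon
    have h1 : (1 / 2 : ENNReal) * haus E (ball 0 (1 / 4)) ≤ haus E (N k) :=
      hmeas.trans (measure_mono hcon)
    have h2 := ENNReal.toReal_mono (hfin k) h1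
    rw [ENNReal.toReal_mul] at h2
    have h3 := hiter k le_rfl
    simp only [ENNReal.toReal_div, ENNReal.toReal_one, ENNReal.toReal_ofNat] at h2
    linarith
  obtain ⟨x₁, ⟨hx₁, hUx₁⟩, hx₁N⟩ := hex
  simp only [hN, mem_compl_iff, not_not] at hx₁N
  obtain ⟨y, hy⟩ := hx₁N
  have hV1 : V x₁ = 1 := by
    simp only [hV, truncation]
    refine min_eq_right ?_
    have := le_max_left (U x₁) 0
    have := sq_nonneg ‖x₁‖
    linarith
  have hyx : y = x₁ := by
    have h1 := hy y
    have h2 := truncation_le_one U y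
    rw [hV1] at h1
    simp only [sub_self, norm_zero] at h1
    have h3 : 400 * 2 ^ k / 2 * ‖x₁ - y‖ ^ 2 ≤ 0 := by linarith
    have h4 : ‖x₁ - y‖ ^ 2 ≤ 0 := nonpos_of_mul_nonpos_right h3 (by positivity)
    have h5 : x₁ - y = 0 := by
      rw [← norm_eq_zero, ← pow_eq_zero_iff two_ne_zero]
      exact le_antisymm h4 (sq_nonneg _)
    exact (sub_eq_zero.mp h5).symm
  refine ⟨x₁, hx₁, fun z hz => ?_⟩
  have h1 := hy z
  rw [hyx, hV1, sub_self, norm_zero] at h1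
  have h2 : 400 * 2 ^ k / 2 * ‖z - x₁‖ ^ 2 ≤ 1 / 2 := by
    have e : 400 * 2 ^ k / 2 * (1 / (20 * 2 ^ k)) ^ 2 = 1 / 2 * (1 / (2 : ℝ) ^ k) := by
      field_simp; norm_num
    have h3 : 1 / (2 : ℝ) ^ k ≤ 1 := by
      rw [div_le_one (by positivity)]; exact one_le_pow₀ (by norm_num)
    calc 400 * 2 ^ k / 2 * ‖z - x₁‖ ^ 2 ≤ 400 * 2 ^ k / 2 * (1 / (20 * 2 ^ k)) ^ 2 := by gcongr
      _ ≤ 1 / 2 := by rw [e]; linarith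
  have h3 : 1 / 2 ≤ V z := by linarith
  have h4 : V z ≤ max (U z) 0 + 4 * ‖z‖ ^ 2 := min_le_left _ _
  have h5 : ‖z‖ ≤ 3 / 10 := by
    have h6 : (1 : ℝ) / (20 * 2 ^ k) ≤ 1 / 20 := by
      have : (1 : ℝ) ≤ 2 ^ k := one_le_pow₀ (by norm_num)
      gcongr; linarith
    rw [mem_ball_zero_iff] at hx₁
    have := norm_sub_norm_le z x₁
    linarith
  rw [max_eq_left (hU0 z (by rw [mem_ball_zero_iff]; linarith))] at h4
  nlinarith [norm_nonneg z]

end ReachingBalls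

section Barrier

variable {E : Type*} [NormedAddCommGroup E] [InnerProductSpace ℝ E]

theorem quadBound_of_lipschitz {A : ℝ} {g : E → ℝ} {P : E → E}
    (hg : ∀ x, HasFDerivAt g (innerSL ℝ (P x)) x) (hP : ∀ x y, ‖P x - P y‖ ≤ A * ‖x - y‖)
    (hA : 0 ≤ A) : QuadBound A g P := by
  intro x z
  have hder : ∀ w, HasFDerivAt (fun w => g w - innerSL ℝ (P x) w) (innerSL ℝ (P w - P x)) w := by
    intro w
    rw [map_sub]
    exact (hg w).sub (innerSL ℝ (P x)).hasFDerivAt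
  have := (convex_closedBall x ‖z - x‖).norm_image_sub_le_of_norm_hasFDerivWithin_le
    (C := A * ‖z - x‖) (x := x) (y := z) (fun w _ => (hder w).hasFDerivWithinAt) ?_
    (mem_closedBall_self (norm_nonneg _)) (by rw [mem_closedBall, dist_eq_norm])
  · rw [Real.norm_eq_abs] at this
    simp only [innerSL_apply_apply] at this
    rw [inner_sub_right]
    calc _ = |g z - ⟪P x, z⟫ - (g x - ⟪P x, x⟫)| := by congr 1; ring
      _ ≤ _ := by rw [pow_two, ← mul_assoc]; exact this
  · intro w hw
    rw [mem_closedBall, dist_eq_norm] at hw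
    rw [innerSL_apply_norm]
    refine (hP w x).trans ?_
    gcongr

/-- Gaussian centred at `y`. -/
def gaussBump (α : ℝ) (y x : E) : ℝ := Real.exp (-(α * ‖x - y‖ ^ 2))

def gaussGrad (α : ℝ) (y x : E) : E := (-(2 * α) * gaussBump α y x) • (x - y)

def gaussHess (α : ℝ) (y x : E) : E →L[ℝ] E :=
  (-(2 * α) * gaussBump α y x) • ContinuousLinearMap.id ℝ E +
    (innerSL ℝ ((-(2 * α)) • gaussGrad α y x)).smulRight (x - y)

theorem hasFDerivAt_gaussBump (α : ℝ) (y x : E) :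
    HasFDerivAt (gaussBump α y) (innerSL ℝ (gaussGrad α y x)) x := by
  have h1 : HasFDerivAt (fun x : E => -(α * ‖x - y‖ ^ 2)) (innerSL ℝ ((-(2 * α)) • (x - y))) x := by
    refine ((quadBound_sq (-(2 * α)) y).hasFDerivAt x).congr_of_eventuallyEq
      (Eventually.of_forall fun z => ?_)
    simp only; ring
  refine h1.exp.congr_fderiv ?_
  ext v
  simp [gaussGrad, gaussBump]
  ring

theorem hasFDerivAt_gaussGrad (α : ℝ) (y x : E) :
    HasFDerivAt (gaussGrad α y) (gaussHess α y x) x := by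
  have h1 := ((hasFDerivAt_gaussBump α y x).const_mul (-(2 * α))).smul
    ((hasFDerivAt_id x).sub_const y)
  refine h1.congr_fderiv ?_
  ext v
  simp [gaussHess]

theorem inner_gaussHess (α : ℝ) (y x v : E) :
    ⟪gaussHess α y x v, v⟫ =
      gaussBump α y x * (-(2 * α) * ‖v‖ ^ 2 + 4 * α ^ 2 * ⟪x - y, v⟫ ^ 2) := by
  simp only [gaussHess, gaussGrad, _root_.add_apply, _root_.smul_apply, ContinuousLinearMap.id_apply,
    ContinuousLinearMap.smulRight_apply, innerSL_apply_apply, inner_add_left,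
    real_inner_smul_left, real_inner_self_eq_norm_sq]
  ring

theorem quadBound_gauss {α : ℝ} (hα : 0 ≤ α) (y : E) :
    QuadBound (6 * α) (gaussBump α y) (gaussGrad α y) := by
  refine quadBound_of_lipschitz (hasFDerivAt_gaussBump α y) (fun x z => ?_) (by positivity)
  refine convex_univ.norm_image_sub_le_of_norm_hasFDerivWithin_le
    (fun w _ => (hasFDerivAt_gaussGrad α y w).hasFDerivWithinAt) (fun w _ => ?_)
    (mem_univ z) (mem_univ x)
  refine ContinuousLinearMap.opNorm_le_bound _ (by positivity) fun v => ?_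
  have hb0 : 0 < gaussBump α y w := Real.exp_pos _
  have hb1 : gaussBump α y w ≤ 1 := by
    rw [gaussBump, Real.exp_le_one_iff]
    have : 0 ≤ α * ‖w - y‖ ^ 2 := by positivity
    linarith
  have hb2 : α * ‖w - y‖ ^ 2 * gaussBump α y w ≤ 1 := by
    rw [gaussBump, Real.exp_neg, mul_inv_le_iff₀ (Real.exp_pos _), one_mul]
    have := Real.add_one_le_exp (α * ‖w - y‖ ^ 2)
    linarith
  have e : gaussHess α y w v = (-(2 * α) * gaussBump α y w) • v
      + (4 * α ^ 2 * gaussBump α y w * ⟪w - y, v⟫) • (w - y) := by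
    simp only [gaussHess, gaussGrad, _root_.add_apply, _root_.smul_apply,
      ContinuousLinearMap.id_apply, ContinuousLinearMap.smulRight_apply, innerSL_apply_apply,
      real_inner_smul_left]
    congr 2; ring
  rw [e]
  refine (norm_add_le _ _).trans ?_
  rw [norm_smul, norm_smul, Real.norm_eq_abs, Real.norm_eq_abs, neg_mul, abs_neg,
    abs_of_nonneg (show 0 ≤ 2 * α * gaussBump α y w by positivity),
    abs_mul (4 * α ^ 2 * gaussBump α y w),
    abs_of_nonneg (show 0 ≤ 4 * α ^ 2 * gaussBump α y w by positivity)]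
  have h1 : |⟪w - y, v⟫| ≤ ‖w - y‖ * ‖v‖ := abs_real_inner_le_norm _ _
  calc 2 * α * gaussBump α y w * ‖v‖ + 4 * α ^ 2 * gaussBump α y w * |⟪w - y, v⟫| * ‖w - y‖
      ≤ 2 * α * 1 * ‖v‖ + 4 * α ^ 2 * gaussBump α y w * (‖w - y‖ * ‖v‖) * ‖w - y‖ := by gcongr
    _ = 2 * α * ‖v‖ + 4 * α * ‖v‖ * (α * ‖w - y‖ ^ 2 * gaussBump α y w) := by ring
    _ ≤ 2 * α * ‖v‖ + 4 * α * ‖v‖ * 1 := by gcongr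
    _ = 6 * α * ‖v‖ := by ring

theorem QuadBound.const_mul {A : ℝ} {g : E → ℝ} {P : E → E} (h : QuadBound A g P) (k : ℝ) :
    QuadBound (|k| * A) (fun x => k * g x) (fun x => k • P x) := by
  intro x z
  rw [real_inner_smul_left, ← mul_sub, ← mul_sub, abs_mul, mul_assoc]
  exact mul_le_mul_of_nonneg_left (h x z) (abs_nonneg _)

/-- Growth lemma for functions with Lipschitz gradient. -/
theorem growth_of_quadBound (E : Type*) [NormedAddCommGroup E] [InnerProductSpace ℝ E]
    [FiniteDimensional ℝ E] [MeasurableSpace E] [BorelSpace E] {Γ : ℝ} (hΓ : 0 ≤ Γ) :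
    ∃ θ > (0 : ℝ), ∃ ε > (0 : ℝ), ∃ K : ℝ, ∀ (U : E → ℝ) (P : E → E) (A : ℝ), QuadBound A U P →
      (∀ x ∈ ball (0 : E) 1, 0 ≤ U x) → HessDichotomy P Γ ε K →
      (1 / 2 : ENNReal) * haus E (ball 0 (1 / 4)) ≤ haus E {x ∈ ball 0 (1 / 4) | 1 ≤ U x} →
      ∀ x ∈ ball (0 : E) (1 / 4), θ ≤ U x := by
  obtain ⟨ρ, hρ, hρ1, K, hK⟩ := exists_ball_lower_bound E hΓ
  set α : ℝ := (2 + Γ) / (2 * ρ ^ 2) with hα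
  have hα0 : 0 < α := by positivity
  set e₁ : ℝ := Real.exp (-(α * (25 / 64))) with he₁
  have he₁0 : 0 < e₁ := Real.exp_pos _
  set ε : ℝ := min 1 (α / 8 * e₁ / (Γ + 1)) with hε
  have hε0 : 0 < ε := lt_min one_pos (by positivity)
  have hεΓ : Γ * ε ≤ α / 8 * e₁ := by
    have h1 : (Γ + 1) * ε ≤ α / 8 * e₁ := by
      rw [← le_div_iff₀' (by linarith)]; exact min_le_right _ _
    linarith
  have hθ : 0 < 1 / 8 * (Real.exp (-(α * (1 / 4))) - e₁) := by
    have : e₁ < Real.exp (-(α * (1 / 4))) := by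
      rw [he₁, Real.exp_lt_exp]; linarith
    linarith
  refine ⟨_, hθ, ε, hε0, max K (α / 4), fun U P A hU hU0 hP hmeas => ?_⟩
  obtain ⟨x₁, hx₁, hx₁U⟩ := hK U P A ε hU hU0 (min_le_left _ _) (hP.mono (le_max_left _ _)) hmeas
  rw [mem_ball_zero_iff] at hx₁
  set G : E → ℝ := fun x => U x + (-(1 / 8 : ℝ)) * gaussBump α x₁ x with hG
  have hGQ := hU.add ((quadBound_gauss hα0.le x₁).const_mul (-(1 / 8 : ℝ)))
  have hkey : ∀ x, ‖x - x₁‖ < 5 / 8 → -(1 / 8 * e₁) ≤ G x := by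
    intro x₀ hx₀
    by_contra hcon
    push Not at hcon
    have hsph : ∀ z, ‖z - x₁‖ = 5 / 8 → G x₀ + (-(1 / 8 * e₁) - G x₀) ≤ G z := by
      intro z hz
      have h1 : gaussBump α x₁ z = e₁ := by
        rw [gaussBump, hz, he₁]; norm_num
      have h2 := hU0 z (by
        rw [mem_ball_zero_iff]
        have := norm_sub_norm_le z x₁
        linarith)
      simp only [hG, h1]; linarith
    obtain ⟨Z, hZ0, hZ⟩ := hP
    set gap := -(1 / 8 * e₁) - G x₀ with hgap
    have hgap0 : 0 < gap := by linarith
    obtain ⟨x, hx, hxZ, hxP, hxmin⟩ := hGQ.jensen (haus E) hgap0 hx₀ hsph hZ0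
      (ε := gap / 2) (by positivity)
    have hxball : x ∈ ball (0 : E) 1 := by
      rw [mem_ball_zero_iff]
      have := norm_sub_norm_le x x₁
      linarith
    obtain ⟨B, hB, hBc⟩ := hZ x hxball hxZ
    have hGx : G x < -(1 / 8 * e₁) := by
      have h1 := hxmin x₀ hx₀.le
      have h2 := abs_le.mp (abs_real_inner_le_norm (P x + (-(1 / 8 : ℝ)) • gaussGrad α x₁ x) (x₀ - x))
      have h3 : ‖x₀ - x‖ ≤ 5 / 4 := by
        calc ‖x₀ - x‖ = ‖(x₀ - x₁) - (x - x₁)‖ := by congr 1; abel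
          _ ≤ ‖x₀ - x₁‖ + ‖x - x₁‖ := norm_sub_le _ _
          _ ≤ 5 / 4 := by linarith
      have h4 : ‖P x + (-(1 / 8 : ℝ)) • gaussGrad α x₁ x‖ * ‖x₀ - x‖ ≤ gap / 2 * (5 / 4) := by
        gcongr
      have h5 : G x + ⟪P x + (-(1 / 8 : ℝ)) • gaussGrad α x₁ x, x₀ - x⟫ ≤ G x₀ := h1
      linarith [h2.1]
    have hfar : ρ < ‖x - x₁‖ := by
      by_contra hle
      push Not at hle
      have h1 := hx₁U x hle
      have h2 : gaussBump α x₁ x ≤ 1 := by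
        rw [gaussBump, Real.exp_le_one_iff]
        have : 0 ≤ α * ‖x - x₁‖ ^ 2 := by positivity
        linarith
      simp only [hG] at hGx
      linarith
    set d := x - x₁ with hd
    set b := gaussBump α x₁ x with hb
    have hb0 : 0 < b := Real.exp_pos _
    have hb1 : e₁ ≤ b := by
      rw [hb, gaussBump, he₁, Real.exp_le_exp, neg_le_neg_iff]
      have : ‖x - x₁‖ ^ 2 ≤ 25 / 64 := by nlinarith [norm_nonneg (x - x₁)]
      gcongr
    have hb2 : b ≤ 1 := by
      rw [hb, gaussBump, Real.exp_le_one_iff]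
      have : 0 ≤ α * ‖x - x₁‖ ^ 2 := by positivity
      linarith
    have hsup := hGQ.supJet (hB.add ((hasFDerivAt_gaussGrad α x₁ x).const_smul (-(1 / 8 : ℝ))))
    have hcon : Tendsto (fun w : E => x + w) (𝓝 0) (𝓝 x) := by
      have : Tendsto (fun w : E => x + w) (𝓝 0) (𝓝 (x + 0)) :=
        (continuous_const.add continuous_id).tendsto 0
      rwa [add_zero] at this
    have hev : ball x₁ (5 / 8) ∈ 𝓝 x := isOpen_ball.mem_nhds (by rwa [mem_ball, dist_eq_norm])
    have hnn := nonneg_of_second_order_min hsup (by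
      filter_upwards [hcon.eventually hev] with w hw
      rw [dist_eq_norm] at hw
      have := hxmin (x + w) hw.le
      rwa [add_sub_cancel_left] at this)
    have hlow : ∀ v, 1 / 8 * (b * (-(2 * α) * ‖v‖ ^ 2 + 4 * α ^ 2 * ⟪d, v⟫ ^ 2)) ≤ ⟪B v, v⟫ := by
      intro v
      have h1 := hnn v
      simp only [_root_.add_apply, _root_.smul_apply, inner_add_left, real_inner_smul_left,
        inner_gaussHess] at h1
      linarith
    have hup := hBc (α / 4 * b) (by positivity)
      (le_trans (mul_le_of_le_one_right (by positivity) hb2) (le_max_right _ _)) (fun v => by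
        have h1 := hlow v
        have h2 : 0 ≤ 1 / 8 * (b * (4 * α ^ 2 * ⟪d, v⟫ ^ 2)) := by positivity
        linarith) d
    have h1 := hlow d
    rw [real_inner_self_eq_norm_sq] at h1
    have hd0 : 0 < ‖d‖ ^ 2 := by
      have : 0 < ‖d‖ := hρ.trans hfar
      positivity
    have h2 : 1 / 8 * b * (-(2 * α) + 4 * α ^ 2 * ‖d‖ ^ 2) ≤ Γ * (α / 4 * b + ε) := by
      have : (1 / 8 * b * (-(2 * α) + 4 * α ^ 2 * ‖d‖ ^ 2)) * ‖d‖ ^ 2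
          ≤ (Γ * (α / 4 * b + ε)) * ‖d‖ ^ 2 := by
        refine le_trans (le_of_eq ?_) (h1.trans hup); ring
      exact le_of_mul_le_mul_right this hd0
    have h3 : 2 + Γ ≤ 2 * α * ‖d‖ ^ 2 := by
      have : 2 * α * ρ ^ 2 = 2 + Γ := by rw [hα]; field_simp
      rw [← this]; gcongr
    have h4 : (2 * α * b) * (2 + Γ) ≤ (2 * α * b) * (2 * α * ‖d‖ ^ 2) := by gcongr
    have h5 : α * e₁ ≤ α * b := by gcongr
    have h6 : 0 < α * b := by positivity
    nlinarith
  intro x hx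
  rw [mem_ball_zero_iff] at hx
  have hxx : ‖x - x₁‖ < 1 / 2 := by
    have := norm_sub_le x x₁
    linarith
  have h1 := hkey x (by linarith)
  have h2 : Real.exp (-(α * (1 / 4))) ≤ gaussBump α x₁ x := by
    rw [gaussBump, Real.exp_le_exp, neg_le_neg_iff]
    have : ‖x - x₁‖ ^ 2 ≤ 1 / 4 := by nlinarith [norm_nonneg (x - x₁)]
    gcongr
  simp only [hG] at h1
  linarith

end Barrier

section JetPairs

variable {E : Type*} [NormedAddCommGroup E] [InnerProductSpace ℝ E]

/-- One-sided Hessian comparison between subjets of `W₁` and superjets of `W₂`. -/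
def JetPair (W₁ W₂ : E → ℝ) (Γ ε : ℝ) (S₁ S₂ : Set E) : Prop :=
  ∀ ζ₁ ∈ S₁, ∀ ζ₂ ∈ S₂, ∀ (p q : E) (Y X : E →L[ℝ] E),
    SubJet W₁ ζ₁ p Y → SupJet W₂ ζ₂ q X →
    (∀ v w, ⟪Y v, w⟫ = ⟪Y w, v⟫) → (∀ v w, ⟪X v, w⟫ = ⟪X w, v⟫) →
    ∀ c, 0 ≤ c → (∀ h, -c * ‖h‖ ^ 2 ≤ ⟪Y h, h⟫ - ⟪X h, h⟫) →
      ∀ h, ⟪Y h, h⟫ - ⟪X h, h⟫ ≤ Γ * (c + ε) * ‖h‖ ^ 2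

theorem SupJet.unscale {W : E → ℝ} {s ρ a : ℝ} {x₀ ζ p : E} {X : E →L[ℝ] E} (hs : 0 < s)
    (hρ : 0 < ρ) (h : SupJet (fun x => s * W (x₀ + ρ • x) + a) ζ p X) :
    SupJet W (x₀ + ρ • ζ) ((1 / (s * ρ)) • p) ((1 / (s * ρ ^ 2)) • X) := by
  intro η hη
  have hcon : Tendsto (fun z : E => ρ⁻¹ • z) (𝓝 0) (𝓝 0) := by
    have : Tendsto (fun z : E => ρ⁻¹ • z) (𝓝 0) (𝓝 (ρ⁻¹ • (0 : E))) :=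
      (continuous_const_smul _).tendsto 0
    rwa [smul_zero] at this
  filter_upwards [hcon.eventually (h (s * ρ ^ 2 * η) (by positivity))] with z hz
  have e1 : x₀ + ρ • (ζ + ρ⁻¹ • z) = x₀ + ρ • ζ + z := by
    rw [smul_add, smul_smul, mul_inv_cancel₀ hρ.ne', one_smul, add_assoc]
  simp only [e1, map_smul, real_inner_smul_left, real_inner_smul_right, norm_smul,
    Real.norm_eq_abs, mul_pow, sq_abs] at hz
  simp only [_root_.smul_apply, real_inner_smul_left]
  have hz' : s * W (x₀ + ρ • ζ + z) ≤ s * (W (x₀ + ρ • ζ) + 1 / (s * ρ) * ⟪p, z⟫ +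
      1 / (s * ρ ^ 2) * ⟪X z, z⟫ / 2 + η * ‖z‖ ^ 2) := by
    have e : s * (W (x₀ + ρ • ζ) + 1 / (s * ρ) * ⟪p, z⟫ +
      1 / (s * ρ ^ 2) * ⟪X z, z⟫ / 2 + η * ‖z‖ ^ 2) = s * W (x₀ + ρ • ζ) + ρ⁻¹ * ⟪p, z⟫ +
      ρ⁻¹ * (ρ⁻¹ * ⟪X z, z⟫) / 2 + s * ρ ^ 2 * η * (ρ⁻¹ ^ 2 * ‖z‖ ^ 2) := by
      field_simp
    rw [e]; linarith
  exact le_of_mul_le_mul_left hz' hs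

theorem SubJet.unscale {W : E → ℝ} {s ρ a : ℝ} {x₀ ζ p : E} {X : E →L[ℝ] E} (hs : 0 < s)
    (hρ : 0 < ρ) (h : SubJet (fun x => s * W (x₀ + ρ • x) + a) ζ p X) :
    SubJet W (x₀ + ρ • ζ) ((1 / (s * ρ)) • p) ((1 / (s * ρ ^ 2)) • X) := by
  have h1 : SupJet (fun x => s * (fun y => -W y) (x₀ + ρ • x) + -a) ζ (-p) (-X) := by
    have := h.neg
    refine fun η hη => (this η hη).mono fun z hz => ?_
    simp only [neg_add] at hz
    simp only [mul_neg]
    linarith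
  have h2 := (SupJet.unscale (W := fun y => -W y) hs hρ h1).neg
  simpa using h2

theorem JetPair.scale {W₁ W₂ : E → ℝ} {Γ ε : ℝ} {S₁ S₂ T₁ T₂ : Set E}
    (h : JetPair W₁ W₂ Γ ε S₁ S₂) {s ρ : ℝ} (hs : 0 < s) (hρ : 0 < ρ) (a b : ℝ) {x₁ x₂ : E}
    (h₁ : ∀ x ∈ T₁, x₁ + ρ • x ∈ S₁) (h₂ : ∀ x ∈ T₂, x₂ + ρ • x ∈ S₂) :
    JetPair (fun x => s * W₁ (x₁ + ρ • x) + a) (fun x => s * W₂ (x₂ + ρ • x) + b)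
      Γ (s * ρ ^ 2 * ε) T₁ T₂ := by
  intro ζ₁ hζ₁ ζ₂ hζ₂ p q Y X hY hX hYs hXs c hc hlow v
  have hk : 0 < s * ρ ^ 2 := by positivity
  have hk' : 0 < 1 / (s * ρ ^ 2) := by positivity
  have := h _ (h₁ _ hζ₁) _ (h₂ _ hζ₂) _ _ _ _ (hY.unscale hs hρ) (hX.unscale hs hρ)
    (fun v w => by simp only [_root_.smul_apply, real_inner_smul_left, hYs v w])
    (fun v w => by simp only [_root_.smul_apply, real_inner_smul_left, hXs v w])
    (1 / (s * ρ ^ 2) * c) (by positivity)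
    (fun v => by
      simp only [_root_.smul_apply, real_inner_smul_left]
      have := mul_le_mul_of_nonneg_left (hlow v) hk'.le
      linarith) v
  simp only [_root_.smul_apply, real_inner_smul_left] at this
  have h3 := mul_le_mul_of_nonneg_left this hk.le
  have e1 : s * ρ ^ 2 * (1 / (s * ρ ^ 2) * ⟪Y v, v⟫ - 1 / (s * ρ ^ 2) * ⟪X v, v⟫)
      = ⟪Y v, v⟫ - ⟪X v, v⟫ := by field_simp
  have e2 : s * ρ ^ 2 * (Γ * (1 / (s * ρ ^ 2) * c + ε) * ‖v‖ ^ 2)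
      = Γ * (c + s * ρ ^ 2 * ε) * ‖v‖ ^ 2 := by field_simp
  rwa [e1, e2] at h3

theorem JetPair.mono {W₁ W₂ : E → ℝ} {Γ ε ε' : ℝ} {S₁ S₂ : Set E} (hΓ : 0 ≤ Γ)
    (h : JetPair W₁ W₂ Γ ε S₁ S₂) (hε : ε ≤ ε') : JetPair W₁ W₂ Γ ε' S₁ S₂ := by
  intro ζ₁ hζ₁ ζ₂ hζ₂ p q Y X hY hX hYs hXs c hc hlow v
  refine (h ζ₁ hζ₁ ζ₂ hζ₂ p q Y X hY hX hYs hXs c hc hlow v).trans ?_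
  gcongr

theorem SupJet.quadForm_ge {G : E → ℝ} {x p : E} {B : E →L[ℝ] E} (hG : SupJet G x p B) {a : ℝ}
    (hmin : ∀ z, G x + ⟪p, z - x⟫ - a * ‖z - x‖ ^ 2 ≤ G z) (v : E) :
    -(2 * a) * ‖v‖ ^ 2 ≤ ⟪B v, v⟫ := by
  have h1 : SupJet (fun y => G y + a * ‖y - x‖ ^ 2) x p
      (B + (2 * a) • ContinuousLinearMap.id ℝ E) := by
    intro η hη
    filter_upwards [hG η hη] with z hz
    simp only [add_sub_cancel_left, sub_self, norm_zero, _root_.add_apply, _root_.smul_apply,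
      ContinuousLinearMap.id_apply, inner_add_left, real_inner_smul_left,
      real_inner_self_eq_norm_sq]
    linarith
  have h2 := nonneg_of_second_order_min h1 (Eventually.of_forall fun z => by
    have := hmin (x + z)
    simp only [add_sub_cancel_left] at this
    simp only [add_sub_cancel_left, sub_self, norm_zero]
    linarith) v
  simp only [_root_.add_apply, _root_.smul_apply, ContinuousLinearMap.id_apply, inner_add_left,
    real_inner_smul_left, real_inner_self_eq_norm_sq] at h2
  linarith

variable [FiniteDimensional ℝ E]

/-- `C^{1,1}` approximation from above whose second derivatives are superjets of the original
function at nearby points. -/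
theorem exists_upper_approx {W : E → ℝ} (hW : Continuous W) {M : ℝ} (hM : ∀ x, |W x| ≤ M)
    {t : ℝ} (ht : 0 < t) :
    ∃ g : E → ℝ, ∃ P : E → E, QuadBound (1 / (2 * t)) g P ∧ (∀ x, W x ≤ g x) ∧
      (∀ x, ∃ ζ, ‖ζ - x‖ ^ 2 ≤ 12 * t * M ∧ g x ≤ W ζ) ∧
      (∀ (x : E) (B : E →L[ℝ] E), HasFDerivAt P B x → ∀ v, -(1 / (2 * t)) * ‖v‖ ^ 2 ≤ ⟪B v, v⟫) ∧
      (∀ (x : E) (B : E →L[ℝ] E) (k : ℝ), HasFDerivAt P B x → k < 1 / t → (∀ v, ⟪B v, v⟫ ≤ k * ‖v‖ ^ 2) →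
        ∃ ζ, ‖ζ - x‖ ^ 2 ≤ 12 * t * M ∧ SupJet W ζ (P x) B) := by
  obtain ⟨g, P, h1, h2, h3, h4, h5⟩ := exists_envelope hW hM ht
  have hQ : QuadBound (1 / (2 * t)) g P := by
    intro x z
    rw [abs_le]
    have e : 1 / (4 * t) ≤ 1 / (2 * t) := one_div_le_one_div_of_le (by positivity) (by linarith)
    have := mul_le_mul_of_nonneg_right e (sq_nonneg ‖z - x‖)
    constructor
    · linarith [h2 x z]
    · linarith [h1 x z]
  refine ⟨g, P, hQ, h3, h4, fun x B hB v => ?_, fun x B k hB hk hBk => ?_⟩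
  · have := (hQ.supJet hB).quadForm_ge (h2 x) v
    have e : 2 * (1 / (4 * t)) = 1 / (2 * t) := by field_simp; norm_num
    rwa [e] at this
  · have hs := hQ.supJet hB
    obtain ⟨ζ, hζ, hζW⟩ := h5 x (P x) ((k + 1 / t) / 2) (by linarith) (by
      filter_upwards [hs ((1 / t - k) / 4) (by linarith)] with z hz
      have := hBk z
      linarith)
    exact ⟨ζ, hζ, hs.transfer hζW⟩

/-- `C^{1,1}` approximation from below whose second derivatives are subjets of the original
function at nearby points. -/
theorem exists_lower_approx {W : E → ℝ} (hW : Continuous W) {M : ℝ} (hM : ∀ x, |W x| ≤ M)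
    {t : ℝ} (ht : 0 < t) :
    ∃ g : E → ℝ, ∃ P : E → E, QuadBound (1 / (2 * t)) g P ∧ (∀ x, g x ≤ W x) ∧
      (∀ x, ∃ ζ, ‖ζ - x‖ ^ 2 ≤ 12 * t * M ∧ W ζ ≤ g x) ∧
      (∀ (x : E) (B : E →L[ℝ] E), HasFDerivAt P B x → ∀ v, ⟪B v, v⟫ ≤ 1 / (2 * t) * ‖v‖ ^ 2) ∧
      (∀ (x : E) (B : E →L[ℝ] E) (k : ℝ), HasFDerivAt P B x → k < 1 / t → (∀ v, -k * ‖v‖ ^ 2 ≤ ⟪B v, v⟫) →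
        ∃ ζ, ‖ζ - x‖ ^ 2 ≤ 12 * t * M ∧ SubJet W ζ (P x) B) := by
  obtain ⟨g, P, hQ, h1, h2, h3, h4⟩ :=
    exists_upper_approx (W := fun x => - W x) hW.neg (M := M) (by simpa using hM) ht
  have hd : ∀ (x : E) (B : E →L[ℝ] E), HasFDerivAt (fun x => - P x) B x → HasFDerivAt P (-B) x := by
    intro x B hB
    have e : P = -fun x => -P x := by ext x; simp
    rw [e]
    exact hB.neg
  refine ⟨_, _, hQ.neg, fun x => by linarith [h1 x], fun x => ?_, fun x B hB v => ?_,
    fun x B k hB hk hBk => ?_⟩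
  · obtain ⟨ζ, h, h'⟩ := h2 x
    exact ⟨ζ, h, by linarith⟩
  · have := h3 x _ (hd x B hB) v
    simp only [_root_.neg_apply, inner_neg_left] at this
    linarith
  · obtain ⟨ζ, h, h'⟩ := h4 x _ k (hd x B hB) hk (fun v => by
      have := hBk v
      simp only [_root_.neg_apply, inner_neg_left]
      linarith)
    refine ⟨ζ, h, ?_⟩
    have := h'.neg
    simpa using this

theorem exists_modulus {W : E → ℝ} (hW : Continuous W) (R : ℝ) {η : ℝ} (hη : 0 < η) :
    ∃ δ > 0, ∀ x ∈ closedBall (0 : E) R, ∀ y ∈ closedBall (0 : E) R, ‖y - x‖ < δ →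
      |W y - W x| < η := by
  have := (isCompact_closedBall (0 : E) R).uniformContinuousOn_of_continuous hW.continuousOn
  rw [Metric.uniformContinuousOn_iff] at this
  obtain ⟨δ, hδ, h⟩ := this η hη
  exact ⟨δ, hδ, fun x hx y hy hxy => h y hy x hx (by rwa [dist_eq_norm])⟩

end JetPairs

section Growth

/-- Growth lemma for the difference of two functions satisfying the jet comparison. -/
theorem growth_of_jetPair (E : Type*) [NormedAddCommGroup E] [InnerProductSpace ℝ E]
    [FiniteDimensional ℝ E] [MeasurableSpace E] [BorelSpace E] {Γ : ℝ} (hΓ : 0 ≤ Γ) :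
    ∃ θ > (0 : ℝ), ∃ ε > (0 : ℝ), ∀ (W₁ W₂ : E → ℝ) (M : ℝ), Continuous W₁ → Continuous W₂ →
      (∀ x, |W₁ x| ≤ M) → (∀ x, |W₂ x| ≤ M) →
      JetPair W₁ W₂ Γ ε (ball 0 2) (ball 0 2) →
      (∀ x ∈ ball (0 : E) 1, 0 ≤ W₁ x - W₂ x) →
      (1 / 2 : ENNReal) * haus E (ball 0 (1 / 4)) ≤
        haus E {x ∈ ball 0 (1 / 4) | 1 ≤ W₁ x - W₂ x} →
      ∀ x ∈ ball (0 : E) (1 / 4), θ ≤ W₁ x - W₂ x := by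
  obtain ⟨θ, hθ, ε, hε, K, hK⟩ := growth_of_quadBound E hΓ
  refine ⟨θ, hθ, ε, hε, fun W₁ W₂ M hc₁ hc₂ hM₁ hM₂ hJ hv hmeas x hx => ?_⟩
  refine le_of_forall_pos_le_add fun η hη => ?_
  have hM : 0 ≤ M := (abs_nonneg _).trans (hM₁ 0)
  obtain ⟨δ₁, hδ₁, hW₁⟩ := exists_modulus hc₁ 2 (half_pos hη)
  obtain ⟨δ₂, hδ₂, hW₂⟩ := exists_modulus hc₂ 2 (half_pos hη)
  set δ := min 1 (min δ₁ δ₂) with hδ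
  have hδ0 : 0 < δ := lt_min one_pos (lt_min hδ₁ hδ₂)
  set K' := max K 1 with hK'
  have hK'0 : 0 < K' := lt_of_lt_of_le one_pos (le_max_right _ _)
  set t := min (δ ^ 2 / (12 * (M + 1))) (1 / (4 * K')) / 2 with ht
  have ht0 : 0 < t := by positivity
  have htM : 12 * t * M < δ ^ 2 := by
    have : t < δ ^ 2 / (12 * (M + 1)) := by
      have h1 : min (δ ^ 2 / (12 * (M + 1))) (1 / (4 * K')) ≤ _ := min_le_left _ _
      have h2 : 0 < δ ^ 2 / (12 * (M + 1)) := by positivity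
      rw [ht]; linarith
    rw [lt_div_iff₀ (by positivity)] at this
    nlinarith
  have htK : K' < 1 / (2 * t) := by
    have : t < 1 / (4 * K') := by
      have h1 : min (δ ^ 2 / (12 * (M + 1))) (1 / (4 * K')) ≤ _ := min_le_right _ _
      have h2 : 0 < 1 / (4 * K') := by positivity
      rw [ht]; linarith
    rw [lt_div_iff₀ (by positivity)] at this
    rw [lt_div_iff₀ (by positivity)]
    nlinarith
  have hnear : ∀ x ζ : E, x ∈ ball (0 : E) 1 → ‖ζ - x‖ ^ 2 ≤ 12 * t * M →
      ‖ζ - x‖ < δ ∧ ζ ∈ ball (0 : E) 2 := by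
    intro x ζ hx hζ
    have h1 : ‖ζ - x‖ < δ := lt_of_pow_lt_pow_left₀ 2 hδ0.le (hζ.trans_lt htM)
    refine ⟨h1, ?_⟩
    rw [mem_ball_zero_iff] at hx ⊢
    have h2 := norm_sub_norm_le ζ x
    have h3 : δ ≤ 1 := min_le_left _ _
    linarith
  have hsub : ball (0 : E) 1 ⊆ closedBall 0 2 :=
    ball_subset_closedBall.trans (closedBall_subset_closedBall (by norm_num))
  obtain ⟨g₁, P₁, hQ₁, hg₁, hg₁', hD₁, hJ₁⟩ := exists_lower_approx hc₁ hM₁ ht0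
  obtain ⟨g₂, P₂, hQ₂, hg₂, hg₂', hD₂, hJ₂⟩ := exists_upper_approx hc₂ hM₂ ht0
  have hU₁ : ∀ x ∈ ball (0 : E) 1, W₁ x - W₂ x ≤ g₁ x + -g₂ x + η := by
    intro x hx
    obtain ⟨ζ₁, hζ₁, h1⟩ := hg₁' x
    obtain ⟨ζ₂, hζ₂, h2⟩ := hg₂' x
    obtain ⟨hn₁, hb₁⟩ := hnear x ζ₁ hx hζ₁
    obtain ⟨hn₂, hb₂⟩ := hnear x ζ₂ hx hζ₂
    have h3 := hW₁ x (hsub hx) ζ₁ (ball_subset_closedBall hb₁)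
      (hn₁.trans_le ((min_le_right _ _).trans (min_le_left _ _)))
    have h4 := hW₂ x (hsub hx) ζ₂ (ball_subset_closedBall hb₂)
      (hn₂.trans_le ((min_le_right _ _).trans (min_le_right _ _)))
    rw [abs_lt] at h3 h4
    linarith [h3.1, h4.2]
  have hQ : QuadBound (1 / (2 * t) + 1 / (2 * t)) (fun x => g₁ x + -g₂ x + η)
      (fun x => P₁ x + -P₂ x) := by
    intro y z
    have := (hQ₁.add hQ₂.neg) y z
    simp only at this ⊢
    rwa [show g₁ z + -g₂ z + η - (g₁ y + -g₂ y + η) = g₁ z + -g₂ z - (g₁ y + -g₂ y) by ring]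
  have hH : HessDichotomy (fun x => P₁ x + -P₂ x) Γ ε K := by
    refine ⟨{x | ¬ DifferentiableAt ℝ P₁ x} ∪ {x | ¬ DifferentiableAt ℝ P₂ x},
      measure_union_null (hQ₁.ae_differentiableAt _) (hQ₂.ae_differentiableAt _), ?_⟩
    intro x hx hxZ
    simp only [Set.mem_union, Set.mem_ofPred_eq, not_or, not_not] at hxZ
    obtain ⟨⟨Y, hY⟩, ⟨X, hX⟩⟩ := hxZ
    refine ⟨Y + -X, hY.add hX.neg, fun c hc hcK hlow v => ?_⟩
    have hcK' : c < 1 / (2 * t) := (hcK.trans (le_max_left _ _)).trans_lt htK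
    have e2 : 1 / (2 * t) + 1 / (2 * t) = 1 / t := by field_simp; norm_num
    have hlow' : ∀ h, -c * ‖h‖ ^ 2 ≤ ⟪Y h, h⟫ - ⟪X h, h⟫ := by
      intro h
      have := hlow h
      rwa [_root_.add_apply, _root_.neg_apply, inner_add_left, inner_neg_left,
        ← sub_eq_add_neg] at this
    obtain ⟨ζ₁, hζ₁, hjY⟩ := hJ₁ x Y (1 / (2 * t) + c) hY (by linarith) (fun h => by
      have h1 := hlow' h
      have h2 := hD₂ x X hX h
      linarith)
    obtain ⟨ζ₂, hζ₂, hjX⟩ := hJ₂ x X (1 / (2 * t) + c) hX (by linarith) (fun h => by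
      have h1 := hlow' h
      have h2 := hD₁ x Y hY h
      linarith)
    have := hJ ζ₁ (hnear x ζ₁ hx hζ₁).2 ζ₂ (hnear x ζ₂ hx hζ₂).2 _ _ Y X hjY hjX
      (hQ₁.symm_fderiv hY) (hQ₂.symm_fderiv hX) c hc hlow' v
    rwa [_root_.add_apply, _root_.neg_apply, inner_add_left, inner_neg_left, ← sub_eq_add_neg]
  have hsub4 : ball (0 : E) (1 / 4) ⊆ ball 0 1 := ball_subset_ball (by norm_num)
  have hfin := hK _ _ _ hQ (fun x hx => (hv x hx).trans (hU₁ x hx)) hH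
    (hmeas.trans (measure_mono fun y hy => ⟨hy.1, hy.2.trans (hU₁ y (hsub4 hy.1))⟩)) x hx
  linarith [hg₁ x, hg₂ x]

/-- Decay of oscillation. -/
theorem oscillation_decay (E : Type*) [NormedAddCommGroup E] [InnerProductSpace ℝ E]
    [FiniteDimensional ℝ E] [MeasurableSpace E] [BorelSpace E] {Γ : ℝ} (hΓ : 0 ≤ Γ) :
    ∃ σ ∈ Ico (1 / 2 : ℝ) 1, ∃ ε > (0 : ℝ), ∀ (k : ℕ) (W₁ W₂ : E → ℝ) (M : ℝ),
      Continuous W₁ → Continuous W₂ → (∀ x, |W₁ x| ≤ M) → (∀ x, |W₂ x| ≤ M) →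
      JetPair W₁ W₂ Γ ε (ball 0 2) (ball 0 2) → JetPair W₂ W₁ Γ ε (ball 0 2) (ball 0 2) →
      (∀ x ∈ ball (0 : E) 1, |W₁ x - W₂ x| ≤ 1) →
      ∃ m : ℝ, ∀ x ∈ ball (0 : E) ((1 / 4) ^ k), |W₁ x - W₂ x - m| ≤ σ ^ k := by
  obtain ⟨θ, hθ, ε, hε, hG⟩ := growth_of_jetPair E hΓ
  set σ := max (1 / 2) (1 - θ / 2) with hσ
  have hσ2 : 1 / 2 ≤ σ := le_max_left _ _
  have hσ0 : 0 < σ := by linarith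
  have hσ1 : σ < 1 := max_lt (by norm_num) (by linarith)
  have hσθ : 1 - θ / 2 ≤ σ := le_max_right _ _
  have hshift : ∀ (W₁ W₂ : E → ℝ) (M : ℝ), Continuous W₁ → Continuous W₂ → (∀ x, |W₁ x| ≤ M) →
      (∀ x, |W₂ x| ≤ M) → JetPair W₁ W₂ Γ ε (ball 0 2) (ball 0 2) →
      (∀ x ∈ ball (0 : E) 1, |W₁ x - W₂ x| ≤ 1) →
      (1 / 2 : ENNReal) * haus E (ball 0 (1 / 4)) ≤
        haus E {x ∈ ball 0 (1 / 4) | 0 ≤ W₁ x - W₂ x} →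
      ∀ x ∈ ball (0 : E) (1 / 4), θ - 1 ≤ W₁ x - W₂ x := by
    intro W₁ W₂ M hc₁ hc₂ hM₁ hM₂ hJ hv hmeas x hx
    have hJ' := hJ.scale (s := 1) (ρ := 1) one_pos one_pos 1 0 (x₁ := 0) (x₂ := 0)
      (T₁ := ball 0 2) (T₂ := ball 0 2) (by simp) (by simp)
    simp only [one_mul, one_smul, zero_add, one_pow, add_zero] at hJ'
    have h1 := hG (fun x => W₁ x + 1) W₂ (M + 1) (hc₁.add continuous_const) hc₂
      (fun x => (abs_add_le _ _).trans (by rw [abs_one]; linarith [hM₁ x]))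
      (fun x => by linarith [hM₂ x]) hJ'
      (fun x hx => by linarith [(abs_le.mp (hv x hx)).1])
      (hmeas.trans (measure_mono fun y hy => ⟨hy.1, by linarith [hy.2]⟩)) x hx
    linarith
  refine ⟨σ, ⟨hσ2, hσ1⟩, ε, hε, fun k => ?_⟩
  induction k with
  | zero =>
    intro W₁ W₂ M _ _ _ _ _ _ hv
    exact ⟨0, fun x hx => by simpa using hv x (by simpa using hx)⟩
  | succ k ih =>
    intro W₁ W₂ M hc₁ hc₂ hM₁ hM₂ hJ hJ' hv
    obtain ⟨m, hm⟩ : ∃ m : ℝ, ∀ x ∈ ball (0 : E) (1 / 4), |W₁ x - W₂ x - m| ≤ σ := by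
      have hsub4 : ball (0 : E) (1 / 4) ⊆ ball 0 1 := ball_subset_ball (by norm_num)
      have hdich : (1 / 2 : ENNReal) * haus E (ball 0 (1 / 4)) ≤
          haus E {x ∈ ball 0 (1 / 4) | 0 ≤ W₁ x - W₂ x} ∨
          (1 / 2 : ENNReal) * haus E (ball 0 (1 / 4)) ≤
          haus E {x ∈ ball 0 (1 / 4) | 0 ≤ W₂ x - W₁ x} := by
        by_contra hcon
        push Not at hcon
        have h1 := ENNReal.add_lt_add hcon.1 hcon.2
        rw [← add_mul, ENNReal.add_halves, one_mul] at h1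
        refine absurd h1 (not_lt.mpr ((measure_mono ?_).trans (measure_union_le _ _)))
        intro y hy
        rcases le_total (W₂ y) (W₁ y) with h | h
        · exact Or.inl ⟨hy, by linarith⟩
        · exact Or.inr ⟨hy, by linarith⟩
      rcases hdich with h | h
      · refine ⟨θ / 2, fun x hx => ?_⟩
        have h1 := hshift W₁ W₂ M hc₁ hc₂ hM₁ hM₂ hJ hv h x hx
        have h2 := abs_le.mp (hv x (hsub4 hx))
        rw [abs_le]
        constructor <;> linarith [h2.2]
      · refine ⟨-(θ / 2), fun x hx => ?_⟩
        have h1 := hshift W₂ W₁ M hc₂ hc₁ hM₂ hM₁ hJ'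
          (fun x hx => by rw [abs_sub_comm]; exact hv x hx) h x hx
        have h2 := abs_le.mp (hv x (hsub4 hx))
        rw [abs_le]
        constructor <;> linarith [h2.1]
    have hin : ∀ x ∈ ball (0 : E) 2, (0 : E) + (1 / 4 : ℝ) • x ∈ ball (0 : E) 2 := by
      intro x hx
      rw [mem_ball_zero_iff] at hx
      rw [zero_add, mem_ball_zero_iff, norm_smul]
      norm_num
      linarith
    have hσi : 0 < σ⁻¹ := inv_pos.mpr hσ0
    have hεle : σ⁻¹ * (1 / 4) ^ 2 * ε ≤ ε := by
      have : σ⁻¹ ≤ 2 := by rw [inv_le_comm₀ hσ0 two_pos]; linarith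
      have h3 : σ⁻¹ * (1 / 4) ^ 2 ≤ 1 := by linarith
      exact mul_le_of_le_one_left hε.le h3
    have hs₁ := (hJ.scale hσi (by norm_num : (0 : ℝ) < 1 / 4) (-(σ⁻¹ * m)) 0 hin hin).mono hΓ hεle
    have hs₂ := (hJ'.scale hσi (by norm_num : (0 : ℝ) < 1 / 4) 0 (-(σ⁻¹ * m)) hin hin).mono hΓ hεle
    have hcs : Continuous fun x : E => (0 : E) + (1 / 4 : ℝ) • x := by fun_prop
    obtain ⟨m', hm'⟩ := ih _ _ (σ⁻¹ * M + |σ⁻¹ * m|)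
      (((hc₁.comp hcs).const_mul σ⁻¹).add_const (-(σ⁻¹ * m)))
      (((hc₂.comp hcs).const_mul σ⁻¹).add_const 0)
      (fun x => by
        refine (abs_add_le _ _).trans ?_
        rw [abs_mul, abs_of_pos hσi, abs_neg]
        gcongr
        exact hM₁ _)
      (fun x => by
        rw [add_zero, abs_mul, abs_of_pos hσi]
        have := mul_le_mul_of_nonneg_left (hM₂ ((0 : E) + (1 / 4 : ℝ) • x)) hσi.le
        have h2 := abs_nonneg (σ⁻¹ * m)
        simp only [Function.comp_apply]
        linarith) hs₁ hs₂ (fun x hx => by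
        have h1 : (0 : E) + (1 / 4 : ℝ) • x ∈ ball (0 : E) (1 / 4) := by
          rw [mem_ball_zero_iff] at hx
          rw [zero_add, mem_ball_zero_iff, norm_smul]
          norm_num
          linarith
        have h2 := hm _ h1
        simp only [Function.comp_apply]
        rw [show σ⁻¹ * W₁ (0 + (1 / 4 : ℝ) • x) + -(σ⁻¹ * m) - (σ⁻¹ * W₂ (0 + (1 / 4 : ℝ) • x) + 0)
          = σ⁻¹ * (W₁ (0 + (1 / 4 : ℝ) • x) - W₂ (0 + (1 / 4 : ℝ) • x) - m) by ring, abs_mul,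
          abs_of_pos hσi, inv_mul_le_iff₀ hσ0, mul_one]
        exact h2)
    refine ⟨m + σ * m', fun x hx => ?_⟩
    have h1 := hm' ((4 : ℝ) • x) (by
      rw [mem_ball_zero_iff] at hx ⊢
      rw [norm_smul]
      rw [pow_succ] at hx
      norm_num at hx ⊢
      linarith)
    have e : (0 : E) + (1 / 4 : ℝ) • (4 : ℝ) • x = x := by
      rw [zero_add, smul_smul]; norm_num
    simp only [Function.comp_apply, e] at h1
    rw [pow_succ', show W₁ x - W₂ x - (m + σ * m')
      = σ * (σ⁻¹ * W₁ x + -(σ⁻¹ * m) - (σ⁻¹ * W₂ x + 0) - m') by field_simp; ring, abs_mul,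
      abs_of_pos hσ0]
    gcongr

end Growth

section Doubling

variable {E : Type*} [NormedAddCommGroup E] [InnerProductSpace ℝ E]

theorem QuadBound.comp_fst {A : ℝ} {g : E → ℝ} {P : E → E} (hA : 0 ≤ A) (h : QuadBound A g P)
    (a : E) : QuadBound A (fun z : WithLp 2 (E × E) => g (a + z.fst))
      (fun z => WithLp.toLp 2 (P (a + z.fst), 0)) := by
  intro x z
  have h1 := h (a + x.fst) (a + z.fst)
  rw [add_sub_add_left_eq_sub] at h1
  rw [WithLp.prod_inner_apply]
  simp only [inner_zero_left, add_zero]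
  refine h1.trans ?_
  rw [WithLp.prod_norm_sq_eq_of_L2]
  have : 0 ≤ A * ‖(z - x).snd‖ ^ 2 := by positivity
  simp only [WithLp.sub_fst] at *
  linarith

theorem QuadBound.comp_snd {A : ℝ} {g : E → ℝ} {P : E → E} (hA : 0 ≤ A) (h : QuadBound A g P)
    (a : E) : QuadBound A (fun z : WithLp 2 (E × E) => g (a + z.snd))
      (fun z => WithLp.toLp 2 (0, P (a + z.snd))) := by
  intro x z
  have h1 := h (a + x.snd) (a + z.snd)
  rw [add_sub_add_left_eq_sub] at h1
  rw [WithLp.prod_inner_apply]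
  simp only [inner_zero_left, zero_add]
  refine h1.trans ?_
  rw [WithLp.prod_norm_sq_eq_of_L2]
  have : 0 ≤ A * ‖(z - x).fst‖ ^ 2 := by positivity
  simp only [WithLp.sub_snd] at *
  linarith

/-- The quadratic penalization used when doubling variables. -/
def penalty (p₁ p₂ : E) (S : E →L[ℝ] E) (K σ : ℝ) (h k : E) : ℝ :=
  ⟪p₁, h - k⟫ + ⟪p₂, h⟫ + ⟪S (h - k), h - k⟫ / 2 + K * ‖h‖ ^ 2 + σ * (‖h‖ ^ 2 + ‖k‖ ^ 2)

theorem penalty_add (p₁ p₂ : E) {S : E →L[ℝ] E} (hS : ∀ v w, ⟪S v, w⟫ = ⟪S w, v⟫) (K σ : ℝ)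
    (h k a b : E) :
    penalty p₁ p₂ S K σ (h + a) (k + b) = penalty p₁ p₂ S K σ h k +
      (⟪p₁ + p₂ + S (h - k) + (2 * K + 2 * σ) • h, a⟫ + ⟪-p₁ - S (h - k) + (2 * σ) • k, b⟫) +
      (⟪S (a - b), a - b⟫ / 2 + K * ‖a‖ ^ 2 + σ * (‖a‖ ^ 2 + ‖b‖ ^ 2)) := by
  simp only [penalty]
  have e : h + a - (k + b) = (h - k) + (a - b) := by abel
  rw [e]
  generalize hd : h - k = d
  have h1 := hS (a - b) d
  simp only [map_add, inner_add_left, inner_add_right, norm_add_sq_real, real_inner_smul_left,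
    inner_sub_left, inner_neg_left]
  simp only [inner_sub_right] at h1 ⊢
  rw [h1]
  ring

theorem quadBound_penalty (p₁ p₂ : E) {S : E →L[ℝ] E} (hS : ∀ v w, ⟪S v, w⟫ = ⟪S w, v⟫) {K σ : ℝ}
    (hK : 0 ≤ K) (hσ : 0 ≤ σ) :
    QuadBound (‖S‖ + K + σ) (fun z : WithLp 2 (E × E) => penalty p₁ p₂ S K σ z.fst z.snd)
      (fun z => WithLp.toLp 2 (p₁ + p₂ + S (z.fst - z.snd) + (2 * K + 2 * σ) • z.fst,
        -p₁ - S (z.fst - z.snd) + (2 * σ) • z.snd)) := by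
  intro x z
  have h1 := penalty_add p₁ p₂ hS K σ x.fst x.snd (z.fst - x.fst) (z.snd - x.snd)
  rw [add_sub_cancel, add_sub_cancel] at h1
  rw [WithLp.prod_inner_apply, WithLp.prod_norm_sq_eq_of_L2]
  simp only [WithLp.ofLp_fst, WithLp.ofLp_snd, WithLp.sub_fst, WithLp.sub_snd]
  rw [h1]
  set a := z.fst - x.fst
  set b := z.snd - x.snd
  rw [add_assoc, add_sub_cancel_left, add_sub_cancel_left]
  have h2 : |⟪S (a - b), a - b⟫| ≤ ‖S‖ * ‖a - b‖ ^ 2 := by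
    refine (abs_real_inner_le_norm _ _).trans ?_
    rw [pow_two, ← mul_assoc]
    exact mul_le_mul_of_nonneg_right (S.le_opNorm _) (norm_nonneg _)
  have h3 : ‖a - b‖ ^ 2 ≤ 2 * (‖a‖ ^ 2 + ‖b‖ ^ 2) := by
    have := parallelogram_law_with_norm ℝ a b
    nlinarith [sq_nonneg ‖a + b‖]
  have h4 := mul_le_mul_of_nonneg_left h3 (norm_nonneg S)
  rw [abs_le] at h2 ⊢
  have h5 : 0 ≤ K * ‖a‖ ^ 2 := by positivity
  have h6 : 0 ≤ K * ‖b‖ ^ 2 := by positivity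
  have h7 : 0 ≤ σ * (‖a‖ ^ 2 + ‖b‖ ^ 2) := by positivity
  constructor <;> nlinarith

variable [FiniteDimensional ℝ E] [MeasurableSpace E] [BorelSpace E]

/-- Jets produced by doubling of variables. -/
theorem exists_jets_of_doubling {W₁ W₂ : E → ℝ} (hc₁ : Continuous W₁) (hc₂ : Continuous W₂)
    {M : ℝ} (hM₁ : ∀ x, |W₁ x| ≤ M) (hM₂ : ∀ x, |W₂ x| ≤ M) {S : E →L[ℝ] E}
    (hS : ∀ v w, ⟪S v, w⟫ = ⟪S w, v⟫) {K r₀ : ℝ} (hK : 0 ≤ K) (hr₀ : 0 < r₀) {x y p₁ p₂ : E}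
    (hmax : ∀ h k, ‖h‖ ≤ r₀ → ‖k‖ ≤ r₀ → W₁ (x + h) - W₂ (y + k) ≤
      W₁ x - W₂ y + penalty p₁ p₂ S K 0 h k) {δ : ℝ} (hδ : 0 < δ) :
    ∃ ζ₁ ζ₂ p q : E, ∃ X Y : E →L[ℝ] E, ‖ζ₁ - x‖ ≤ δ ∧ ‖ζ₂ - y‖ ≤ δ ∧ ‖p - (p₁ + p₂)‖ ≤ δ ∧
      ‖q - p₁‖ ≤ δ ∧ SupJet W₁ ζ₁ p X ∧ SubJet W₂ ζ₂ q Y ∧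
      (∀ v w, ⟪X v, w⟫ = ⟪X w, v⟫) ∧ (∀ v w, ⟪Y v, w⟫ = ⟪Y w, v⟫) ∧
      ∀ h k, ⟪X h, h⟫ - ⟪Y k, k⟫ ≤
        ⟪S (h - k), h - k⟫ + 2 * K * ‖h‖ ^ 2 + δ * (‖h‖ ^ 2 + ‖k‖ ^ 2) := by
  have hM : 0 ≤ M := (abs_nonneg _).trans (hM₁ 0)
  set σ := δ / 2 with hσ
  have hσ0 : 0 < σ := by positivity
  set b₀ := 2 * ‖S‖ + 2 * K + 2 * σ with hb₀
  have hb₀0 : 0 < b₀ := by positivity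
  set r := min r₀ (min (δ / 2) (δ / (2 * b₀))) with hr
  have hr0 : 0 < r := by positivity
  have hrr₀ : r ≤ r₀ := min_le_left _ _
  have hrδ : r ≤ δ / 2 := (min_le_right _ _).trans (min_le_left _ _)
  have hrb : b₀ * r ≤ δ / 2 := by
    have : r ≤ δ / (2 * b₀) := (min_le_right _ _).trans (min_le_right _ _)
    rw [le_div_iff₀ (by positivity)] at this
    linarith
  set η := σ * r ^ 2 / 4 with hη
  have hη0 : 0 < η := by positivity
  set R := max ‖x‖ ‖y‖ + r + δ with hR
  obtain ⟨δ₁, hδ₁, hW₁⟩ := exists_modulus hc₁ R hη0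
  obtain ⟨δ₂, hδ₂, hW₂⟩ := exists_modulus hc₂ R hη0
  set δ' := min (δ / 2) (min δ₁ δ₂) with hδ'
  have hδ'0 : 0 < δ' := by positivity
  set t := min (δ' ^ 2 / (12 * (M + 1))) (1 / b₀) / 2 with ht
  have ht0 : 0 < t := by positivity
  have htM : 12 * t * M < δ' ^ 2 := by
    have : t < δ' ^ 2 / (12 * (M + 1)) := by
      have h1 : min (δ' ^ 2 / (12 * (M + 1))) (1 / b₀) ≤ _ := min_le_left _ _
      have h2 : 0 < δ' ^ 2 / (12 * (M + 1)) := by positivity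
      rw [ht]; linarith
    rw [lt_div_iff₀ (by positivity)] at this
    nlinarith
  have htb : b₀ < 1 / t := by
    have : t < 1 / b₀ := by
      have h1 : min (δ' ^ 2 / (12 * (M + 1))) (1 / b₀) ≤ _ := min_le_right _ _
      have h2 : 0 < 1 / b₀ := by positivity
      rw [ht]; linarith
    rw [lt_div_iff₀ (by positivity)] at this
    rw [lt_div_iff₀ (by positivity)]
    linarith
  have hnear : ∀ z ζ : E, ‖ζ - z‖ ^ 2 ≤ 12 * t * M → ‖ζ - z‖ < δ' := fun z ζ hζ =>
    lt_of_pow_lt_pow_left₀ 2 hδ'0.le (hζ.trans_lt htM)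
  have hnear' : ∀ z h ζ : E, ‖z‖ ≤ max ‖x‖ ‖y‖ → ‖h‖ ≤ r → ‖ζ - (z + h)‖ ^ 2 ≤ 12 * t * M →
      ζ ∈ closedBall (0 : E) R ∧ z + h ∈ closedBall (0 : E) R := by
    intro z h ζ hz hh hζ
    have h1 := hnear _ _ hζ
    have h2 := norm_add_le z h
    have h3 := norm_sub_norm_le ζ (z + h)
    have h4 : δ' ≤ δ / 2 := min_le_left _ _
    rw [mem_closedBall_zero_iff, mem_closedBall_zero_iff]
    constructor <;> linarith
  obtain ⟨g₁, P₁, hQ₁, hg₁, hg₁', -, hJ₁⟩ := exists_upper_approx hc₁ hM₁ ht0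
  obtain ⟨g₂, P₂, hQ₂, hg₂, hg₂', -, hJ₂⟩ := exists_lower_approx hc₂ hM₂ ht0
  have hA : 0 ≤ 1 / (2 * t) := by positivity
  have hG := ((hQ₁.neg.comp_fst hA x).add (hQ₂.comp_snd hA y)).add
    (quadBound_penalty p₁ p₂ hS hK hσ0.le)
  set G : WithLp 2 (E × E) → ℝ := fun z => -g₁ (x + z.fst) + g₂ (y + z.snd) +
    penalty p₁ p₂ S K σ z.fst z.snd with hGdef
  set PG : WithLp 2 (E × E) → WithLp 2 (E × E) := fun z =>
    WithLp.toLp 2 (-P₁ (x + z.fst), 0) + WithLp.toLp 2 (0, P₂ (y + z.snd)) +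
      WithLp.toLp 2 (p₁ + p₂ + S (z.fst - z.snd) + (2 * K + 2 * σ) • z.fst,
        -p₁ - S (z.fst - z.snd) + (2 * σ) • z.snd) with hPG
  have hfst : ∀ z, (PG z).fst =
      -P₁ (x + z.fst) + (p₁ + p₂ + S (z.fst - z.snd) + (2 * K + 2 * σ) • z.fst) := fun z => by
    simp only [hPG, WithLp.add_fst, WithLp.toLp_fst, add_zero]
  have hsnd : ∀ z, (PG z).snd =
      P₂ (y + z.snd) + (-p₁ - S (z.fst - z.snd) + (2 * σ) • z.snd) := fun z => by
    simp only [hPG, WithLp.add_snd, WithLp.toLp_snd, zero_add]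
  have hpen : ∀ h k, penalty p₁ p₂ S K σ h k =
      penalty p₁ p₂ S K 0 h k + σ * (‖h‖ ^ 2 + ‖k‖ ^ 2) := fun h k => by
    simp only [penalty]; ring
  have hG0 : G 0 ≤ -W₁ x + W₂ y := by
    have : penalty p₁ p₂ S K σ 0 0 = 0 := by simp [penalty]
    simp only [hGdef, WithLp.zero_fst, WithLp.zero_snd, add_zero, this]
    linarith [hg₁ x, hg₂ y]
  have hsph : ∀ z : WithLp 2 (E × E), ‖z - 0‖ = r → G 0 + σ * r ^ 2 / 2 ≤ G z := by
    intro z hz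
    rw [sub_zero] at hz
    have hf : ‖z.fst‖ ≤ r := hz ▸ WithLp.norm_fst_le E z
    have hs : ‖z.snd‖ ≤ r := hz ▸ WithLp.norm_snd_le E z
    have h1 := hmax z.fst z.snd (hf.trans hrr₀) (hs.trans hrr₀)
    obtain ⟨ζ₁, hζ₁, hζ₁'⟩ := hg₁' (x + z.fst)
    obtain ⟨ζ₂, hζ₂, hζ₂'⟩ := hg₂' (y + z.snd)
    have h2 := hnear' x z.fst ζ₁ (le_max_left _ _) hf hζ₁
    have h3 := hnear' y z.snd ζ₂ (le_max_right _ _) hs hζ₂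
    have h4 := hW₁ _ h2.2 _ h2.1 ((hnear _ _ hζ₁).trans_le ((min_le_right _ _).trans (min_le_left _ _)))
    have h5 := hW₂ _ h3.2 _ h3.1 ((hnear _ _ hζ₂).trans_le ((min_le_right _ _).trans (min_le_right _ _)))
    rw [abs_lt] at h4 h5
    have h6 := WithLp.prod_norm_sq_eq_of_L2 z
    rw [hz] at h6
    simp only [hGdef] at hG0 ⊢
    rw [hpen z.fst z.snd, ← h6]
    linarith [h4.2, h5.1]
  obtain ⟨z, hz, hzZ, hzP, hzmin⟩ := hG.jensen (haus (WithLp 2 (E × E))) (x₀ := 0) (c := 0)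
    (r := r) (by positivity) (by simpa using hr0) hsph
    (hG.ae_differentiableAt (haus (WithLp 2 (E × E)))) (half_pos hδ)
  rw [sub_zero] at hz
  change ‖PG z‖ ≤ δ / 2 at hzP
  simp only [Set.mem_ofPred_eq, not_not] at hzZ
  obtain ⟨D, hD⟩ := hzZ
  change HasFDerivAt PG D z at hD
  have hf : ‖z.fst‖ ≤ r := (WithLp.norm_fst_le E z).trans hz.le
  have hs : ‖z.snd‖ ≤ r := (WithLp.norm_snd_le E z).trans hz.le
  have hconf : HasFDerivAt (fun z : WithLp 2 (E × E) => z.fst) (WithLp.fstL 2 ℝ E E) z :=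
    (WithLp.fstL 2 ℝ E E).hasFDerivAt
  have hcons : HasFDerivAt (fun z : WithLp 2 (E × E) => z.snd) (WithLp.sndL 2 ℝ E E) z :=
    (WithLp.sndL 2 ℝ E E).hasFDerivAt
  have hDf : HasFDerivAt (fun z => (PG z).fst) ((WithLp.fstL 2 ℝ E E).comp D) z :=
    (WithLp.fstL 2 ℝ E E).hasFDerivAt.comp z hD
  have hDs : HasFDerivAt (fun z => (PG z).snd) ((WithLp.sndL 2 ℝ E E).comp D) z :=
    (WithLp.sndL 2 ℝ E E).hasFDerivAt.comp z hD
  have hSd : HasFDerivAt (fun z : WithLp 2 (E × E) => S (z.fst - z.snd))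
      (S.comp (WithLp.fstL 2 ℝ E E - WithLp.sndL 2 ℝ E E)) z :=
    S.hasFDerivAt.comp z (hconf.sub hcons)
  have hins : ∀ a b : E, (WithLp.prodContinuousLinearEquiv 2 ℝ E E).symm (a, b) =
      WithLp.toLp 2 (a, b) := fun _ _ => rfl
  obtain ⟨X, hX⟩ : DifferentiableAt ℝ P₁ (x + z.fst) := by
    have hφ : DifferentiableAt ℝ (fun w : E => (WithLp.toLp 2 (w - x, z.snd) : WithLp 2 (E × E)))
        (x + z.fst) := by
      simp only [← hins]
      exact (WithLp.prodContinuousLinearEquiv 2 ℝ E E).symm.differentiableAt.comp _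
        ((differentiableAt_id.sub_const x).prodMk (differentiableAt_const _))
    have hz' : (WithLp.toLp 2 (x + z.fst - x, z.snd) : WithLp 2 (E × E)) = z := by
      rw [add_sub_cancel_left]; rfl
    have h1 : DifferentiableAt ℝ (fun w : E => (PG (WithLp.toLp 2 (w - x, z.snd))).fst)
        (x + z.fst) := by
      refine DifferentiableAt.comp (x + z.fst) (g := fun z => (PG z).fst) ?_ hφ
      rw [hz']
      exact hDf.differentiableAt
    have e : P₁ = fun w => (p₁ + p₂ + S (w - x - z.snd) + (2 * K + 2 * σ) • (w - x)) -
        (PG (WithLp.toLp 2 (w - x, z.snd))).fst := by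
      ext w
      rw [hfst]
      simp only [WithLp.toLp_fst, WithLp.toLp_snd, add_sub_cancel]
      abel
    rw [e]
    refine DifferentiableAt.sub ?_ h1
    fun_prop
  obtain ⟨Y, hY⟩ : DifferentiableAt ℝ P₂ (y + z.snd) := by
    have hφ : DifferentiableAt ℝ (fun w : E => (WithLp.toLp 2 (z.fst, w - y) : WithLp 2 (E × E)))
        (y + z.snd) := by
      simp only [← hins]
      exact (WithLp.prodContinuousLinearEquiv 2 ℝ E E).symm.differentiableAt.comp _
        ((differentiableAt_const _).prodMk (differentiableAt_id.sub_const y))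
    have hz' : (WithLp.toLp 2 (z.fst, y + z.snd - y) : WithLp 2 (E × E)) = z := by
      rw [add_sub_cancel_left]; rfl
    have h1 : DifferentiableAt ℝ (fun w : E => (PG (WithLp.toLp 2 (z.fst, w - y))).snd)
        (y + z.snd) := by
      refine DifferentiableAt.comp (y + z.snd) (g := fun z => (PG z).snd) ?_ hφ
      rw [hz']
      exact hDs.differentiableAt
    have e : P₂ = fun w => (PG (WithLp.toLp 2 (z.fst, w - y))).snd -
        (-p₁ - S (z.fst - (w - y)) + (2 * σ) • (w - y)) := by
      ext w
      rw [hsnd]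
      simp only [WithLp.toLp_fst, WithLp.toLp_snd, add_sub_cancel]
      abel
    rw [e]
    refine DifferentiableAt.sub h1 ?_
    fun_prop
  have hDf' : ∀ a b, (D (WithLp.toLp 2 (a, b))).fst =
      -X a + (S (a - b) + (2 * K + 2 * σ) • a) := by
    intro a b
    have h1 : HasFDerivAt (fun z : WithLp 2 (E × E) => P₁ (x + z.fst))
        (X.comp (WithLp.fstL 2 ℝ E E)) z := HasFDerivAt.comp z hX (hconf.const_add x)
    have h2 := h1.neg.add ((hSd.const_add (p₁ + p₂)).add (hconf.const_smul (2 * K + 2 * σ)))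
    have h3 := congrArg (fun T => T (WithLp.toLp 2 (a, b)))
      (hDf.unique (h2.congr_of_eventuallyEq (Eventually.of_forall hfst)))
    exact h3
  have hDs' : ∀ a b, (D (WithLp.toLp 2 (a, b))).snd = Y b + (-S (a - b) + (2 * σ) • b) := by
    intro a b
    have h1 : HasFDerivAt (fun z : WithLp 2 (E × E) => P₂ (y + z.snd))
        (Y.comp (WithLp.sndL 2 ℝ E E)) z := HasFDerivAt.comp z hY (hcons.const_add y)
    have h2 := h1.add ((hSd.const_sub (-p₁)).add (hcons.const_smul (2 * σ)))
    have h3 := congrArg (fun T => T (WithLp.toLp 2 (a, b)))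
      (hDs.unique (h2.congr_of_eventuallyEq (Eventually.of_forall hsnd)))
    exact h3
  have hquad : ∀ a b, ⟪X a, a⟫ - ⟪Y b, b⟫ ≤
        ⟪S (a - b), a - b⟫ + 2 * K * ‖a‖ ^ 2 + δ * (‖a‖ ^ 2 + ‖b‖ ^ 2) := by
    intro a b
    have hev : ∀ᶠ w in 𝓝 (0 : WithLp 2 (E × E)), G z + ⟪PG z, w⟫ ≤ G (z + w) := by
      have hcon : Tendsto (fun w : WithLp 2 (E × E) => z + w) (𝓝 0) (𝓝 z) := by
        have : Tendsto (fun w => z + w) (𝓝 0) (𝓝 (z + 0)) :=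
          (continuous_const.add continuous_id).tendsto 0
        rwa [add_zero] at this
      filter_upwards [hcon.eventually (ball_mem_nhds z (sub_pos.mpr hz))] with w hw
      have h1 := hzmin (z + w) (by
        rw [sub_zero]
        have h2 := norm_sub_norm_le (z + w) z
        rw [dist_eq_norm] at hw
        linarith)
      rwa [add_sub_cancel_left] at h1
    have h1 := nonneg_of_second_order_min (hG.supJet hD) hev (WithLp.toLp 2 (a, b))
    rw [WithLp.prod_inner_apply] at h1
    change 0 ≤ ⟪(D (WithLp.toLp 2 (a, b))).fst, a⟫ + ⟪(D (WithLp.toLp 2 (a, b))).snd, b⟫ at h1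
    rw [hDf', hDs'] at h1
    simp only [inner_add_left, inner_neg_left, real_inner_smul_left,
      real_inner_self_eq_norm_sq] at h1
    rw [inner_sub_right]
    rw [hσ] at h1
    linarith
  have hSn : ∀ v, ⟪S v, v⟫ ≤ ‖S‖ * ‖v‖ ^ 2 := fun v => by
    refine (real_inner_le_norm _ _).trans ?_
    rw [pow_two, ← mul_assoc]
    exact mul_le_mul_of_nonneg_right (S.le_opNorm _) (norm_nonneg _)
  have hpos : ∀ v : E, 0 ≤ ‖S‖ * ‖v‖ ^ 2 ∧ 0 ≤ K * ‖v‖ ^ 2 := fun v =>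
    ⟨by positivity, by positivity⟩
  obtain ⟨ζ₁, hζ₁, hj₁⟩ := hJ₁ _ X b₀ hX htb (fun v => by
    have h1 := hquad v 0
    have h2 := hSn v
    have h3 := (hpos v).1
    simp only [map_zero, inner_zero_left, sub_zero, norm_zero] at h1
    rw [hb₀, hσ]
    linarith)
  obtain ⟨ζ₂, hζ₂, hj₂⟩ := hJ₂ _ Y b₀ hY htb (fun v => by
    have h1 := hquad 0 v
    have h2 := hSn v
    have h3 := hpos v
    simp only [map_zero, inner_zero_left, zero_sub, norm_zero, map_neg, inner_neg_neg] at h1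
    rw [hb₀, hσ]
    linarith)
  have hδ'δ : δ' ≤ δ / 2 := min_le_left _ _
  have hSzz : ‖S (z.fst - z.snd)‖ ≤ ‖S‖ * (2 * r) := by
    refine (S.le_opNorm _).trans ?_
    gcongr
    exact (_root_.norm_sub_le _ _).trans (by linarith)
  have hsmul₁ : ‖(2 * K + 2 * σ) • z.fst‖ ≤ (2 * K + 2 * σ) * r := by
    rw [norm_smul, Real.norm_eq_abs, abs_of_nonneg (by positivity)]
    gcongr
  have hsmul₂ : ‖(2 * σ) • z.snd‖ ≤ (2 * σ) * r := by
    rw [norm_smul, Real.norm_eq_abs, abs_of_nonneg (by positivity)]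
    gcongr
  have hKr : 0 ≤ K * r := by positivity
  refine ⟨ζ₁, ζ₂, _, _, X, Y, ?_, ?_, ?_, ?_, hj₁, hj₂, hQ₁.symm_fderiv hX, hQ₂.symm_fderiv hY, hquad⟩
  · have h1 := norm_sub_norm_le (ζ₁ - x) z.fst
    rw [sub_sub] at h1
    linarith [hnear _ _ hζ₁]
  · have h1 := norm_sub_norm_le (ζ₂ - y) z.snd
    rw [sub_sub] at h1
    linarith [hnear _ _ hζ₂]
  · have h1 : P₁ (x + z.fst) - (p₁ + p₂) =
        S (z.fst - z.snd) + (2 * K + 2 * σ) • z.fst - (PG z).fst := by rw [hfst]; abel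
    rw [h1]
    have h2 := (_root_.norm_sub_le (S (z.fst - z.snd) + (2 * K + 2 * σ) • z.fst) (PG z).fst)
    have h3 := norm_add_le (S (z.fst - z.snd)) ((2 * K + 2 * σ) • z.fst)
    have h4 := (WithLp.norm_fst_le E (PG z)).trans hzP
    rw [hb₀] at hrb
    linarith
  · have h1 : P₂ (y + z.snd) - p₁ =
        (PG z).snd + S (z.fst - z.snd) - (2 * σ) • z.snd := by rw [hsnd]; abel
    rw [h1]
    have h2 := (_root_.norm_sub_le ((PG z).snd + S (z.fst - z.snd)) ((2 * σ) • z.snd))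
    have h3 := norm_add_le (PG z).snd (S (z.fst - z.snd))
    have h4 := (WithLp.norm_snd_le E (PG z)).trans hzP
    rw [hb₀] at hrb
    linarith

end Doubling

section IshiiLions

variable {E : Type*} [NormedAddCommGroup E] [InnerProductSpace ℝ E]

/-- Hessian comparison between subjets and superjets of `W` of slope at most `N`. -/
def SlopeJetPair (W : E → ℝ) (Γ N : ℝ) (s : Set E) : Prop :=
  ∀ ζ₁ ∈ s, ∀ ζ₂ ∈ s, ∀ (p q : E) (Y X : E →L[ℝ] E), ‖p‖ ≤ N → ‖q‖ ≤ N →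
    SubJet W ζ₁ p Y → SupJet W ζ₂ q X →
    (∀ v w, ⟪Y v, w⟫ = ⟪Y w, v⟫) → (∀ v w, ⟪X v, w⟫ = ⟪X w, v⟫) →
    ∀ c, 0 ≤ c → (∀ h, -c * ‖h‖ ^ 2 ≤ ⟪Y h, h⟫ - ⟪X h, h⟫) →
      ∀ h, ⟪Y h, h⟫ - ⟪X h, h⟫ ≤ Γ * (c + 1) * ‖h‖ ^ 2

/-- Second order expansion of the norm from above. -/
theorem norm_add_le_expansion {z d e : E} {r : ℝ} (hr : 0 < r) (hr1 : r ≤ 1) (he : ‖e‖ = 1)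
    (hz : z = r • e) (hd : ‖d‖ ≤ r ^ 2 / 2) :
    ‖z + d‖ ≤ r + ⟪e, d⟫ + (‖d‖ ^ 2 - ⟪e, d⟫ ^ 2) / (2 * r) + (‖d‖ ^ 2 - ⟪e, d⟫ ^ 2) / 2 := by
  set a := ⟪e, d⟫ with ha
  have h1 : |a| ≤ ‖d‖ := by
    have := abs_real_inner_le_norm e d
    rwa [he, one_mul] at this
  have hb : 0 ≤ ‖d‖ ^ 2 - a ^ 2 := by
    have := sq_le_sq' (by linarith [norm_nonneg d, (abs_le.mp h1).1]) (abs_le.mp h1).2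
    linarith
  set b := ‖d‖ ^ 2 - a ^ 2 with hbdef
  have h2 : ‖z + d‖ ^ 2 = (r + a) ^ 2 + b := by
    rw [hz, norm_add_sq_real, norm_smul, he, real_inner_smul_left, ← ha, mul_one,
      Real.norm_eq_abs, sq_abs]
    ring
  have ha' := abs_le.mp (h1.trans hd)
  have hra : 0 < r + a := by nlinarith
  have hkey : b ≤ 2 * (r + a) * (b / (2 * r) + b / 2) := by
    have e1 : 2 * (r + a) * (b / (2 * r) + b / 2) - b = b * (r ^ 2 + a + a * r) / r := by
      field_simp; ring
    have h3 : 0 ≤ r ^ 2 + a + a * r := by nlinarith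
    have : 0 ≤ b * (r ^ 2 + a + a * r) / r := by positivity
    linarith
  have hc : 0 ≤ b / (2 * r) + b / 2 := by positivity
  have hfin : ‖z + d‖ ^ 2 ≤ (r + a + (b / (2 * r) + b / 2)) ^ 2 := by
    rw [h2]; nlinarith [sq_nonneg (b / (2 * r) + b / 2)]
  have := abs_le_of_sq_le_sq hfin (by positivity)
  have h5 := (abs_le.mp this).2
  linarith

variable [FiniteDimensional ℝ E]

set_option maxHeartbeats 1000000 in
/-- Interior Lipschitz estimate. -/
theorem lipschitz_of_slopeJetPair {Γ L : ℝ} (hΓ : 0 ≤ Γ)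
    (hL : L = 1000 * (1 + Γ)) {W : E → ℝ} (hW : Continuous W) (hM : ∀ x, |W x| ≤ 1)
    (hJ : SlopeJetPair W Γ (2 * L) (ball 0 (15 / 16))) {x y : E} (hx : x ∈ ball (0 : E) (3 / 4))
    (hy : y ∈ ball (0 : E) (3 / 4)) : |W x - W y| ≤ L * ‖x - y‖ := by
  have hL1 : 1000 ≤ L := by rw [hL]; linarith
  have key : ∀ x₀ ∈ ball (0 : E) (3 / 4), ∀ y₀, ‖x₀ - y₀‖ ≤ 1 / 16 →
      W x₀ - W y₀ ≤ L * ‖x₀ - y₀‖ := by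
    intro x₀ hx₀ y₀ hxy
    by_contra hcon
    push Not at hcon
    set Φ : E × E → ℝ := fun p => W p.1 - W p.2 - L * (‖p.1 - p.2‖ - ‖p.1 - p.2‖ ^ 2) -
      768 * ‖p.1 - x₀‖ ^ 2 with hΦ
    set s : Set (E × E) := {p | ‖p.1 - p.2‖ ≤ 1 / 16 ∧ ‖p.1 - x₀‖ ≤ 1 / 16} with hs
    have hΦc : Continuous Φ := by fun_prop
    have hscl : IsClosed s := by
      have e : s = {p | ‖p.1 - p.2‖ ≤ 1 / 16} ∩ {p | ‖p.1 - x₀‖ ≤ 1 / 16} := rfl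
      rw [e]
      exact (isClosed_le (by fun_prop) continuous_const).inter
        (isClosed_le (by fun_prop) continuous_const)
    have hscomp : IsCompact s := by
      refine ((isCompact_closedBall x₀ (1 / 16)).prod (isCompact_closedBall x₀ (1 / 8))).of_isClosed_subset
        hscl fun p hp => ⟨?_, ?_⟩
      · rw [mem_closedBall, dist_eq_norm]; exact hp.2
      · rw [mem_closedBall, dist_eq_norm]
        have h1 := hp.1
        have h2 := hp.2
        rw [norm_sub_rev] at h1
        calc ‖p.2 - x₀‖ = ‖(p.2 - p.1) + (p.1 - x₀)‖ := by congr 1; abel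
          _ ≤ _ := (norm_add_le _ _).trans (by linarith)
    have hmem : (x₀, y₀) ∈ s := ⟨hxy, by simp⟩
    obtain ⟨⟨x, y⟩, hxys, hmax⟩ := hscomp.exists_isMaxOn ⟨_, hmem⟩ hΦc.continuousOn
    have hpos : 0 < Φ (x, y) := by
      refine lt_of_lt_of_le ?_ (hmax hmem)
      simp only [hΦ, sub_self, norm_zero]
      nlinarith [sq_nonneg ‖x₀ - y₀‖]
    set r := ‖x - y‖ with hr
    have hW2 : W x - W y ≤ 2 := by linarith [(abs_le.mp (hM x)).2, (abs_le.mp (hM y)).1]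
    have hpos' : 0 < W x - W y - L * (r - r ^ 2) - 768 * ‖x - x₀‖ ^ 2 := hpos
    have hr0 : 0 < r := by
      rcases (norm_nonneg (x - y)).eq_or_lt with h | h
      · exfalso
        have hxy' : x = y := sub_eq_zero.mp (norm_eq_zero.mp h.symm)
        rw [hr, ← h, hxy'] at hpos'
        nlinarith [sq_nonneg ‖y - x₀‖]
      · exact h
    have hr16 : r ≤ 1 / 16 := hxys.1
    have hx16 : ‖x - x₀‖ ≤ 1 / 16 := hxys.2
    have hLr : 0 ≤ L * (r - r ^ 2) := mul_nonneg (by linarith) (by nlinarith)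
    have hr16' : r < 1 / 16 := by
      refine lt_of_le_of_ne hr16 fun h => ?_
      rw [h] at hpos'
      nlinarith [sq_nonneg ‖x - x₀‖]
    have hx16' : ‖x - x₀‖ < 1 / 16 := by
      refine lt_of_le_of_ne hx16 fun h => ?_
      rw [h] at hpos'
      linarith
    set e : E := r⁻¹ • (x - y) with he
    have hen : ‖e‖ = 1 := by
      rw [he, norm_smul, norm_inv, Real.norm_eq_abs, abs_of_pos hr0, ← hr, inv_mul_cancel₀ hr0.ne']
    have hxye : x - y = r • e := by
      rw [he, smul_smul, mul_inv_cancel₀ hr0.ne', one_smul]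
    set S : E →L[ℝ] E := (L * (1 / r - 1)) • ContinuousLinearMap.id ℝ E -
      (L / r) • (innerSL ℝ e).smulRight e with hS
    have hSf : ∀ v w, ⟪S v, w⟫ = L * (1 / r - 1) * ⟪v, w⟫ - L / r * (⟪e, v⟫ * ⟪e, w⟫) := by
      intro v w
      simp only [hS, _root_.sub_apply, _root_.smul_apply, ContinuousLinearMap.id_apply,
        ContinuousLinearMap.smulRight_apply, innerSL_apply_apply, inner_sub_left,
        real_inner_smul_left]
    have hSsymm : ∀ v w, ⟪S v, w⟫ = ⟪S w, v⟫ := by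
      intro v w
      rw [hSf, hSf, real_inner_comm v w]
      ring
    set r₀ := min (r ^ 2 / 4) (min ((1 / 16 - r) / 2) (1 / 16 - ‖x - x₀‖)) with hr₀
    have hr₀0 : 0 < r₀ := lt_min (by positivity) (lt_min (by linarith) (by linarith))
    have hr₀1 : r₀ ≤ r ^ 2 / 4 := min_le_left _ _
    have hr₀2 : r₀ ≤ (1 / 16 - r) / 2 := (min_le_right _ _).trans (min_le_left _ _)
    have hr₀3 : r₀ ≤ 1 / 16 - ‖x - x₀‖ := (min_le_right _ _).trans (min_le_right _ _)
    have hpen : ∀ h k, ‖h‖ ≤ r₀ → ‖k‖ ≤ r₀ → W (x + h) - W (y + k) ≤ W x - W y +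
        penalty ((L * (1 - 2 * r)) • e) ((2 * 768 : ℝ) • (x - x₀)) S 768 0 h k := by
      intro h k hh hk
      have hd : ‖h - k‖ ≤ 2 * r₀ := (norm_sub_le _ _).trans (by linarith)
      have e1 : x + h - (y + k) = (x - y) + (h - k) := by abel
      have e2 : x + h - x₀ = (x - x₀) + h := by abel
      have hin : (x + h, y + k) ∈ s := by
        refine ⟨?_, ?_⟩
        · simp only [e1]
          refine (norm_add_le _ _).trans ?_
          rw [← hr]; linarith
        · simp only [e2]
          refine (norm_add_le _ _).trans ?_
          linarith
      have h1 : Φ (x + h, y + k) ≤ Φ (x, y) := hmax hin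
      have h2 := norm_add_le_expansion hr0 (by linarith) hen hxye
        (d := h - k) (by linarith)
      have h3 : ‖x - y + (h - k)‖ ^ 2 = r ^ 2 + 2 * r * ⟪e, h - k⟫ + ‖h - k‖ ^ 2 := by
        rw [norm_add_sq_real, ← hr]
        conv_lhs => rw [hxye, real_inner_smul_left]
        ring
      have h4 : ‖x - x₀ + h‖ ^ 2 = ‖x - x₀‖ ^ 2 + 2 * ⟪x - x₀, h⟫ + ‖h‖ ^ 2 := norm_add_sq_real _ _
      simp only [hΦ, e1, e2, h3, h4, ← hr] at h1
      simp only [penalty, hSf, real_inner_smul_left, real_inner_self_eq_norm_sq]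
      set a := ⟪e, h - k⟫
      set D := ‖h - k‖
      have h5 := mul_le_mul_of_nonneg_left h2 (show 0 ≤ L by linarith)
      have h6 : 0 ≤ L * a ^ 2 / 2 := by positivity
      have e3 : L * (r + a + (D ^ 2 - a ^ 2) / (2 * r) + (D ^ 2 - a ^ 2) / 2) =
        L * r + L * a + (L * (1 / r - 1) * D ^ 2 - L / r * (a * a)) / 2 + L * D ^ 2
          - L * a ^ 2 / 2 := by
        field_simp; ring
      rw [e3] at h5
      linarith
    obtain ⟨ζ₁, ζ₂, p, q, X, Y, hζ₁, hζ₂, hp, hq, hjX, hjY, hXs, hYs, hXY⟩ := by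
      letI : MeasurableSpace E := borel E
      haveI : BorelSpace E := ⟨rfl⟩
      exact exists_jets_of_doubling hW hW hM hM hSsymm (by norm_num) hr₀0 hpen
        (show (0 : ℝ) < 1 / 32 by norm_num)
    rw [mem_ball_zero_iff] at hx₀
    have hxn : ‖x‖ < 13 / 16 := by
      have := norm_sub_norm_le x x₀
      linarith
    have hyn : ‖y‖ < 14 / 16 := by
      have := norm_sub_norm_le y x
      rw [norm_sub_rev] at this
      linarith
    have hζ₁' : ζ₁ ∈ ball (0 : E) (15 / 16) := by
      rw [mem_ball_zero_iff]
      have := norm_sub_norm_le ζ₁ x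
      linarith
    have hζ₂' : ζ₂ ∈ ball (0 : E) (15 / 16) := by
      rw [mem_ball_zero_iff]
      have := norm_sub_norm_le ζ₂ y
      linarith
    have hp₁ : ‖(L * (1 - 2 * r)) • e‖ ≤ L := by
      rw [norm_smul, hen, mul_one, Real.norm_eq_abs, abs_of_nonneg (by
        apply mul_nonneg <;> linarith)]
      nlinarith
    have hp₂ : ‖(2 * 768 : ℝ) • (x - x₀)‖ ≤ 96 := by
      rw [norm_smul, Real.norm_eq_abs, abs_of_pos (by norm_num)]
      linarith
    have hpn : ‖p‖ ≤ 2 * L := by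
      have hgen : ∀ v₁ v₂ : E, ‖v₁‖ ≤ L → ‖v₂‖ ≤ 96 → ‖p - (v₁ + v₂)‖ ≤ 1 / 32 → ‖p‖ ≤ 2 * L := by
        intro v₁ v₂ g₁ g₂ g₃
        have h1 := norm_sub_norm_le p (v₁ + v₂)
        have h2 := norm_add_le v₁ v₂
        linarith
      exact hgen _ _ hp₁ hp₂ hp
    have hqn : ‖q‖ ≤ 2 * L := by
      have h1 := norm_sub_norm_le q ((L * (1 - 2 * r)) • e)
      linarith
    have h1 := hJ ζ₂ hζ₂' ζ₁ hζ₁' q p Y X hqn hpn hjY hjX hYs hXs 1540 (by norm_num)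
      (fun h => by
        have := hXY h h
        simp only [sub_self, map_zero, inner_zero_left] at this
        nlinarith [sq_nonneg ‖h‖]) e
    have h2 := hXY e (-e)
    rw [sub_neg_eq_add, hSf] at h2
    simp only [map_neg, inner_neg_neg, inner_add_left, inner_add_right,
      real_inner_self_eq_norm_sq, norm_neg, hen] at h1 h2
    have e4 : L * (1 / r - 1) * (1 ^ 2 + 1 ^ 2 + (1 ^ 2 + 1 ^ 2)) -
        L / r * ((1 ^ 2 + 1 ^ 2) * (1 ^ 2 + 1 ^ 2)) = -(4 * L) := by
      field_simp; ring
    rw [e4] at h2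
    have h3 : ⟪Y e, e⟫ - ⟪X e, e⟫ ≤ Γ * 1541 := by
      refine h1.trans (le_of_eq ?_)
      norm_num
    have h4 : ⟪X e, e⟫ - ⟪Y e, e⟫ ≤ -(4 * L) + 1537 := by
      refine h2.trans ?_
      rw [one_pow]
      linarith
    rw [hL] at h4
    linarith
  rcases le_or_gt ‖x - y‖ (1 / 16) with h | h
  · have h1 := key x hx y h
    have h2 := key y hy x (by rwa [norm_sub_rev])
    rw [norm_sub_rev] at h2
    rw [abs_le]
    constructor <;> linarith
  · have h1 : |W x - W y| ≤ 2 := (abs_sub _ _).trans (by linarith [hM x, hM y])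
    nlinarith

end IshiiLions

section Increments

variable {E : Type*} [NormedAddCommGroup E] [InnerProductSpace ℝ E]

theorem SupJet.norm_le_of_lipschitz {W : E → ℝ} {L : ℝ} {s : Set E} (hL : 0 ≤ L)
    (hLip : ∀ x ∈ s, ∀ y ∈ s, |W x - W y| ≤ L * ‖x - y‖) {ζ p : E} {X : E →L[ℝ] E}
    (hs : s ∈ 𝓝 ζ) (h : SupJet W ζ p X) : ‖p‖ ≤ L := by
  have hcon : Tendsto (fun t : ℝ => -(t • p)) (𝓝[>] 0) (𝓝 0) := by
    have : Tendsto (fun t : ℝ => -(t • p)) (𝓝 0) (𝓝 (-((0 : ℝ) • p))) :=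
      (Continuous.tendsto (by fun_prop) 0)
    rw [zero_smul, neg_zero] at this
    exact this.mono_left nhdsWithin_le_nhds
  have hs' : ∀ᶠ z in 𝓝 (0 : E), ζ + z ∈ s := by
    have : Tendsto (fun z : E => ζ + z) (𝓝 0) (𝓝 ζ) := by
      have hc : Continuous fun z : E => ζ + z := by fun_prop
      simpa using hc.tendsto 0
    exact this.eventually hs
  have hev : ∀ᶠ t : ℝ in 𝓝[>] 0, ‖p‖ ^ 2 ≤ L * ‖p‖ + t * (⟪X p, p⟫ / 2 + ‖p‖ ^ 2) := by
    filter_upwards [hcon.eventually (h 1 one_pos), hcon.eventually hs', self_mem_nhdsWithin]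
      with t ht hts htpos
    have htpos' : 0 < t := htpos
    have h1 := (abs_le.mp (hLip _ hts ζ (mem_of_mem_nhds hs))).1
    have e1 : ζ + -(t • p) - ζ = -(t • p) := by abel
    rw [e1, norm_neg, norm_smul, Real.norm_eq_abs, abs_of_pos htpos'] at h1
    simp only [map_neg, map_smul, inner_neg_right, inner_neg_left, real_inner_smul_left,
      real_inner_smul_right, norm_neg, norm_smul, Real.norm_eq_abs, abs_of_pos htpos',
      real_inner_self_eq_norm_sq, neg_neg] at ht
    have h2 : t * ‖p‖ ^ 2 ≤ t * (L * ‖p‖ + t * (⟪X p, p⟫ / 2 + ‖p‖ ^ 2)) := by linarith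
    exact le_of_mul_le_mul_left h2 htpos'
  have hlim : Tendsto (fun t : ℝ => L * ‖p‖ + t * (⟪X p, p⟫ / 2 + ‖p‖ ^ 2)) (𝓝[>] 0)
      (𝓝 (L * ‖p‖ + 0 * (⟪X p, p⟫ / 2 + ‖p‖ ^ 2))) :=
    (Continuous.tendsto (by fun_prop) 0).mono_left nhdsWithin_le_nhds
  have h3 := ge_of_tendsto hlim hev
  rw [zero_mul, add_zero] at h3
  by_contra hcon
  push Not at hcon
  nlinarith

theorem SlopeJetPair.jetPair {W : E → ℝ} {Γ N L : ℝ} {s t : Set E} (hJ : SlopeJetPair W Γ N s)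
    (hL : 0 ≤ L) (hLN : L ≤ N) (ht : IsOpen t) (hts : t ⊆ s)
    (hLip : ∀ x ∈ t, ∀ y ∈ t, |W x - W y| ≤ L * ‖x - y‖) : JetPair W W Γ 1 t t := by
  intro ζ₁ hζ₁ ζ₂ hζ₂ p q Y X hY hX
  refine hJ ζ₁ (hts hζ₁) ζ₂ (hts hζ₂) p q Y X ?_ ?_ hY hX
  · have hLip' : ∀ x ∈ t, ∀ y ∈ t, |-W x - -W y| ≤ L * ‖x - y‖ := by
      intro x hx y hy
      rw [← neg_sub', abs_neg]
      exact hLip x hx y hy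
    have := SupJet.norm_le_of_lipschitz hL hLip' (ht.mem_nhds hζ₁) hY.neg
    rw [norm_neg] at this
    exact this.trans hLN
  · exact (SupJet.norm_le_of_lipschitz hL hLip (ht.mem_nhds hζ₂) hX).trans hLN

/-- A function whose increments decay geometrically on quarter scales is Hölder at the origin. -/
theorem exists_exponent {σ : ℝ} (hσ : σ ∈ Ico (1 / 2 : ℝ) 1) :
    ∃ γ ∈ Ioo (0 : ℝ) 1, ∀ t : ℝ, 0 < t → t ≤ 1 / 4 →
      ∃ k : ℕ, Real.sqrt t < (1 / 4) ^ k ∧ σ ^ k ≤ 4 * t ^ γ := by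
  have hσ0 : 0 < σ := by linarith [hσ.1]
  have hl4 : 0 < Real.log 4 := Real.log_pos (by norm_num)
  have hl42 : Real.log 4 = 2 * Real.log 2 := by
    rw [show (4 : ℝ) = 2 ^ 2 by norm_num, Real.log_pow]; norm_num
  have hlσ : Real.log σ < 0 := Real.log_neg hσ0 hσ.2
  have hlσ2 : -Real.log 2 ≤ Real.log σ := by
    rw [← Real.log_inv]
    exact Real.log_le_log (by norm_num) (by linarith [hσ.1])
  set α := -Real.log σ / Real.log 4 with hα
  have hα0 : 0 < α := div_pos (by linarith) hl4
  have hα1 : α ≤ 1 / 2 := by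
    rw [hα, div_le_iff₀ hl4]; linarith
  have hσα : σ = (1 / 4 : ℝ) ^ α := by
    rw [Real.rpow_def_of_pos (by norm_num), hα, one_div, Real.log_inv,
      show -Real.log 4 * (-Real.log σ / Real.log 4) = Real.log σ by field_simp, Real.exp_log hσ0]
  refine ⟨α / 2, ⟨by linarith, by linarith⟩, fun t ht ht4 => ?_⟩
  have hst : 0 < Real.sqrt t := Real.sqrt_pos.mpr ht
  have hst1 : 2 * Real.sqrt t ≤ 1 := by
    have : Real.sqrt t ≤ 1 / 2 := by
      rw [Real.sqrt_le_left (by norm_num)]; linarith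
    linarith
  obtain ⟨k, hk1, hk2⟩ := exists_nat_pow_near_of_lt_one (x := 2 * Real.sqrt t) (y := 1 / 4)
    (by positivity) hst1 (by norm_num) (by norm_num)
  refine ⟨k, by linarith, ?_⟩
  have e1 : t ^ (α / 2) = Real.sqrt t ^ α := by
    rw [Real.sqrt_eq_rpow, ← Real.rpow_mul ht.le]; congr 1; ring
  have h1 : σ ^ (k + 1) ≤ (2 * Real.sqrt t) ^ α := by
    rw [hσα, ← Real.rpow_natCast, ← Real.rpow_mul (by norm_num), mul_comm α, Real.rpow_mul (by norm_num),
      Real.rpow_natCast]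
    exact Real.rpow_le_rpow (by positivity) hk1.le hα0.le
  have h2 : (2 * Real.sqrt t) ^ α ≤ 2 * Real.sqrt t ^ α := by
    rw [Real.mul_rpow (by norm_num) hst.le]
    gcongr
    calc (2 : ℝ) ^ α ≤ 2 ^ (1 : ℝ) := Real.rpow_le_rpow_of_exponent_le (by norm_num) (by linarith)
      _ = 2 := Real.rpow_one 2
  have h3 : σ ^ k * (1 / 2) ≤ σ ^ (k + 1) := by
    rw [pow_succ]
    gcongr
    exact hσ.1
  rw [e1]
  linarith

/-- Second differences of `W` are of order `1 + γ`. -/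
theorem second_difference_le (E : Type*) [NormedAddCommGroup E] [InnerProductSpace ℝ E]
    [FiniteDimensional ℝ E] [MeasurableSpace E] [BorelSpace E] {Γ L : ℝ} (hΓ : 0 ≤ Γ)
    (hL : 0 ≤ L) :
    ∃ γ ∈ Ioo (0 : ℝ) 1, ∃ C > (0 : ℝ), ∀ W : E → ℝ, Continuous W → (∀ x, |W x| ≤ 1) →
      (∀ x ∈ ball (0 : E) (3 / 4), ∀ y ∈ ball (0 : E) (3 / 4), |W x - W y| ≤ L * ‖x - y‖) →
      JetPair W W Γ 1 (ball 0 (3 / 4)) (ball 0 (3 / 4)) →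
      ∀ x ∈ ball (0 : E) (9 / 16), ∀ h : E,
        |W (x + (h + h)) - 2 * W (x + h) + W x| ≤ C * ‖h‖ ^ (1 + γ) := by
  obtain ⟨σ, hσ, ε, hε, hdec⟩ := oscillation_decay E hΓ
  obtain ⟨γ, hγ, hexp⟩ := exists_exponent hσ
  set M₀ := L + 1 / ε with hM₀
  have hM₀0 : 0 < M₀ := by positivity
  refine ⟨γ, hγ, 8 * M₀ + 4 * 256 ^ 2, by positivity, fun W hWc hW1 hLip hJ x hx h => ?_⟩
  rw [mem_ball_zero_iff] at hx
  rcases eq_or_ne h 0 with rfl | hne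
  · rw [norm_zero, Real.zero_rpow (by linarith [hγ.1])]
    simp only [add_zero, mul_zero]
    rw [show W x - 2 * W x + W x = 0 by ring, abs_zero]
  have hh : 0 < ‖h‖ := norm_pos_iff.mpr hne
  have hpow : 0 < ‖h‖ ^ (1 + γ) := Real.rpow_pos_of_pos hh _
  rcases le_or_gt ‖h‖ (1 / 256) with hsmall | hlarge
  · obtain ⟨k, hk1, hk2⟩ := hexp ‖h‖ hh (by linarith)
    set ρ := Real.sqrt ‖h‖ with hρ
    have hρ0 : 0 < ρ := Real.sqrt_pos.mpr hh
    have hρ2 : ρ ^ 2 = ‖h‖ := Real.sq_sqrt hh.le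
    have hρ16 : ρ ≤ 1 / 16 := by
      rw [hρ, Real.sqrt_le_left (by norm_num)]; linarith
    set s := 1 / (M₀ * ‖h‖) with hs
    have hs0 : 0 < s := by positivity
    have hsρ : s * ρ ^ 2 * 1 ≤ ε := by
      rw [hs, hρ2, mul_one, div_mul_eq_mul_div, one_mul, div_le_iff₀ (by positivity)]
      have : 1 ≤ ε * M₀ := by
        rw [hM₀, mul_add, mul_one_div_cancel hε.ne']
        have := mul_nonneg hε.le hL
        linarith
      nlinarith
    have hin : ∀ z ∈ ball (0 : E) 2, x + ρ • z ∈ ball (0 : E) (3 / 4) := by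
      intro z hz
      rw [mem_ball_zero_iff] at hz ⊢
      have h1 := norm_add_le x (ρ • z)
      rw [norm_smul, Real.norm_eq_abs, abs_of_pos hρ0] at h1
      nlinarith [norm_nonneg z]
    have hin' : ∀ z ∈ ball (0 : E) 2, x + h + ρ • z ∈ ball (0 : E) (3 / 4) := by
      intro z hz
      rw [mem_ball_zero_iff] at hz ⊢
      have h1 := norm_add_le (x + h) (ρ • z)
      have h2 := norm_add_le x h
      rw [norm_smul, Real.norm_eq_abs, abs_of_pos hρ0] at h1
      nlinarith [norm_nonneg z]
    have hbd : ∀ y, |s * W y + 0| ≤ s := by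
      intro y
      rw [add_zero, abs_mul, abs_of_pos hs0]
      exact mul_le_of_le_one_right hs0.le (hW1 y)
    obtain ⟨m, hm⟩ := hdec k _ _ s
      (show Continuous fun z => s * W (x + h + ρ • z) + 0 by fun_prop)
      (show Continuous fun z => s * W (x + ρ • z) + 0 by fun_prop)
      (fun z => hbd _) (fun z => hbd _)
      ((hJ.scale hs0 hρ0 0 0 hin' hin).mono hΓ hsρ)
      ((hJ.scale hs0 hρ0 0 0 hin hin').mono hΓ hsρ)
      (by
        intro z hz
        have hz2 := ball_subset_ball (by norm_num : (1 : ℝ) ≤ 2) hz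
        have h1 := hLip _ (hin' z hz2) _ (hin z hz2)
        rw [show x + h + ρ • z - (x + ρ • z) = h by abel] at h1
        rw [show s * W (x + h + ρ • z) + 0 - (s * W (x + ρ • z) + 0)
          = s * (W (x + h + ρ • z) - W (x + ρ • z)) by ring, abs_mul, abs_of_pos hs0]
        refine (mul_le_mul_of_nonneg_left h1 hs0.le).trans ?_
        rw [hs, div_mul_eq_mul_div, one_mul, div_le_one (by positivity)]
        gcongr
        rw [hM₀]
        have : 0 < 1 / ε := by positivity
        linarith)
    have hzn : ‖ρ⁻¹ • h‖ = ρ := by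
      rw [norm_smul, norm_inv, Real.norm_eq_abs, abs_of_pos hρ0, ← hρ2]
      field_simp
    have h1 := abs_le.mp (hm (ρ⁻¹ • h) (by rwa [mem_ball_zero_iff, hzn]))
    have h2 := abs_le.mp (hm 0 (mem_ball_self (by positivity)))
    simp only [smul_smul, mul_inv_cancel₀ hρ0.ne', one_smul, smul_zero, add_zero] at h1 h2
    rw [show x + h + h = x + (h + h) by abel] at h1
    have h3 : s * |W (x + (h + h)) - 2 * W (x + h) + W x| ≤ 2 * σ ^ k := by
      have e : s * |W (x + (h + h)) - 2 * W (x + h) + W x|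
          = |s * (W (x + (h + h)) - 2 * W (x + h) + W x)| := by rw [abs_mul, abs_of_pos hs0]
      rw [e, abs_le]
      constructor <;> linarith [h1.1, h1.2, h2.1, h2.2]
    have h4 : s * |W (x + (h + h)) - 2 * W (x + h) + W x| ≤ 8 * ‖h‖ ^ γ := by linarith
    rw [hs, div_mul_eq_mul_div, one_mul, div_le_iff₀ (by positivity)] at h4
    rw [Real.rpow_add hh, Real.rpow_one] at hpow ⊢
    nlinarith
  · have h1 : |W (x + (h + h)) - 2 * W (x + h) + W x| ≤ 4 := by
      have a1 := abs_le.mp (hW1 (x + (h + h)))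
      have a2 := abs_le.mp (hW1 (x + h))
      have a3 := abs_le.mp (hW1 x)
      rw [abs_le]
      constructor <;> linarith [a1.1, a1.2, a2.1, a2.2, a3.1, a3.2]
    have h2 : (1 / 256 : ℝ) ^ 2 ≤ ‖h‖ ^ (1 + γ) := by
      calc (1 / 256 : ℝ) ^ 2 = (1 / 256 : ℝ) ^ (2 : ℝ) := by norm_num
        _ ≤ (1 / 256 : ℝ) ^ (1 + γ) :=
          Real.rpow_le_rpow_of_exponent_ge (by norm_num) (by norm_num) (by linarith [hγ.2])
        _ ≤ ‖h‖ ^ (1 + γ) := Real.rpow_le_rpow (by norm_num) hlarge.le (by linarith [hγ.1])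
    nlinarith

end Increments

section SecondDifferences

variable {E : Type*} [NormedAddCommGroup E] [InnerProductSpace ℝ E]

theorem dyadic_rpow {C γ t : ℝ} (ht : 0 ≤ t) (k : ℕ) :
    2 ^ k * (C * ((1 / 2) ^ k * t) ^ (1 + γ)) = C * t ^ (1 + γ) * ((1 / 2 : ℝ) ^ γ) ^ k := by
  have hk : (0 : ℝ) < (1 / 2) ^ k := by positivity
  rw [Real.mul_rpow hk.le ht, Real.rpow_add hk, Real.rpow_one,
    Real.rpow_pow_comm (by norm_num : (0 : ℝ) ≤ 1 / 2)]
  have e : (2 : ℝ) ^ k * (1 / 2) ^ k = 1 := by rw [← mul_pow]; norm_num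
  linear_combination (C * ((1 / 2 : ℝ) ^ k) ^ γ * t ^ (1 + γ)) * e

theorem hasFDerivAt_of_rpow_bound {W : E → ℝ} {y p : E} {C γ : ℝ} (hγ : 0 < γ)
    (h : ∀ z, |W (y + z) - W y - ⟪p, z⟫| ≤ C * ‖z‖ ^ (1 + γ)) :
    HasFDerivAt W (innerSL ℝ p) y := by
  rw [hasFDerivAt_iff_isLittleO_nhds_zero]
  have h1 : (fun z : E => W (y + z) - W y - innerSL ℝ p z) =O[𝓝 0] fun z => ‖z‖ ^ (1 + γ) := by
    refine Asymptotics.IsBigO.of_bound C (Eventually.of_forall fun z => ?_)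
    have := h z
    rwa [Real.norm_eq_abs, innerSL_apply_apply, Real.norm_eq_abs,
      abs_of_nonneg (Real.rpow_nonneg (norm_nonneg z) _)]
  refine h1.trans_isLittleO ?_
  rw [Asymptotics.isLittleO_iff]
  intro c hc
  have h2 : Tendsto (fun z : E => ‖z‖ ^ γ) (𝓝 0) (𝓝 0) := by
    have hc : Continuous fun z : E => ‖z‖ ^ γ :=
      continuous_norm.rpow_const fun _ => Or.inr hγ.le
    have := hc.tendsto 0
    rwa [norm_zero, Real.zero_rpow hγ.ne'] at this
  filter_upwards [h2.eventually (gt_mem_nhds hc)] with z hz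
  rw [Real.norm_eq_abs, abs_of_nonneg (Real.rpow_nonneg (norm_nonneg z) _)]
  rcases eq_or_ne z 0 with rfl | hne
  · rw [norm_zero, Real.zero_rpow (by linarith)]; simp
  · rw [Real.rpow_add (norm_pos_iff.mpr hne), Real.rpow_one, mul_comm]
    gcongr

variable [FiniteDimensional ℝ E]

/-- First order expansion from bounds on second differences. -/
theorem exists_slope_of_second_difference {W : E → ℝ} (hW : Continuous W) {C γ : ℝ} (hC : 0 ≤ C)
    (hγ : 0 < γ) {U : Set E}
    (hS : ∀ x ∈ U, ∀ h : E, |W (x + (h + h)) - 2 * W (x + h) + W x| ≤ C * ‖h‖ ^ (1 + γ)) {y : E}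
    (hy : U ∈ 𝓝 y) :
    ∃ p : E, ∀ h, |W (y + h) - W y - ⟪p, h⟫| ≤ C / (1 - (1 / 2) ^ γ) * ‖h‖ ^ (1 + γ) := by
  set θ : ℝ := (1 / 2) ^ γ with hθ
  have hθ0 : 0 < θ := Real.rpow_pos_of_pos (by norm_num) _
  have hθ1 : θ < 1 := Real.rpow_lt_one (by norm_num) (by norm_num) hγ
  have hyU : y ∈ U := mem_of_mem_nhds hy
  set f : E → ℕ → ℝ := fun h k => 2 ^ k * (W (y + (1 / 2 : ℝ) ^ k • h) - W y) with hf
  have hstep : ∀ h k, dist (f h k) (f h (k + 1)) ≤ C * ‖h‖ ^ (1 + γ) * θ ^ k := by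
    intro h k
    set g : E := (1 / 2 : ℝ) ^ (k + 1) • h with hg
    have eg : (1 / 2 : ℝ) ^ k • h = g + g := by
      rw [hg, ← add_smul, pow_succ]; congr 1; ring
    have h1 := hS y hyU g
    rw [Real.dist_eq]
    have e : f h k - f h (k + 1) = 2 ^ k * (W (y + (g + g)) - 2 * W (y + g) + W y) := by
      simp only [hf, eg, ← hg, pow_succ (2 : ℝ)]; ring
    rw [e, abs_mul, abs_of_pos (by positivity), ← dyadic_rpow (norm_nonneg h)]
    refine mul_le_mul_of_nonneg_left (h1.trans ?_) (by positivity)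
    gcongr
    rw [hg, norm_smul, Real.norm_eq_abs, abs_of_pos (by positivity)]
    gcongr ?_ * _
    exact pow_le_pow_of_le_one (by norm_num) (by norm_num) (Nat.le_succ k)
  choose D hD using fun h => cauchySeq_tendsto_of_complete
    (cauchySeq_of_le_geometric θ (C * ‖h‖ ^ (1 + γ)) hθ1 (hstep h))
  have hbound : ∀ h, |W (y + h) - W y - D h| ≤ C / (1 - θ) * ‖h‖ ^ (1 + γ) := by
    intro h
    have h1 := dist_le_of_le_geometric_of_tendsto₀ θ _ hθ1 (hstep h) (hD h)
    simp only [hf, pow_zero, one_smul, one_mul, Real.dist_eq] at h1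
    rwa [mul_div_right_comm] at h1
  have hadd : ∀ a b, D (a + b) = D a + D b := by
    intro a b
    have hlim : Tendsto (fun k => f a k + f b k - f (a + b) (k + 1)) atTop
        (𝓝 (D a + D b - D (a + b))) :=
      ((hD a).add (hD b)).sub ((hD (a + b)).comp (tendsto_add_atTop_nat 1))
    have hz : Tendsto (fun k => C * ‖(1 / 2 : ℝ) • (b - a)‖ ^ (1 + γ) * θ ^ k) atTop (𝓝 0) := by
      have := (tendsto_pow_atTop_nhds_zero_of_lt_one hθ0.le hθ1).const_mul
        (C * ‖(1 / 2 : ℝ) • (b - a)‖ ^ (1 + γ))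
      rwa [mul_zero] at this
    have hin : ∀ᶠ k : ℕ in atTop, y + (1 / 2 : ℝ) ^ k • a ∈ U := by
      have h1 : Tendsto (fun k : ℕ => y + (1 / 2 : ℝ) ^ k • a) atTop (𝓝 (y + (0 : ℝ) • a)) :=
        ((tendsto_pow_atTop_nhds_zero_of_lt_one (by norm_num) (by norm_num)).smul_const a).const_add y
      rw [zero_smul, add_zero] at h1
      exact h1.eventually hy
    have hz' : Tendsto (fun k => f a k + f b k - f (a + b) (k + 1)) atTop (𝓝 0) := by
      refine squeeze_zero_norm' ?_ hz
      filter_upwards [hin] with k hk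
      set g : E := (1 / 2 : ℝ) ^ k • ((1 / 2 : ℝ) • (b - a)) with hg
      have h1 := hS _ hk g
      have e1 : y + (1 / 2 : ℝ) ^ k • a + g = y + (1 / 2 : ℝ) ^ (k + 1) • (a + b) := by
        rw [hg, pow_succ]; module
      have e2 : y + (1 / 2 : ℝ) ^ k • a + (g + g) = y + (1 / 2 : ℝ) ^ k • b := by
        rw [hg]; module
      rw [e1, e2] at h1
      have e : f a k + f b k - f (a + b) (k + 1) = 2 ^ k * (W (y + (1 / 2 : ℝ) ^ k • b)
          - 2 * W (y + (1 / 2 : ℝ) ^ (k + 1) • (a + b)) + W (y + (1 / 2 : ℝ) ^ k • a)) := by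
        simp only [hf, pow_succ (2 : ℝ)]; ring
      rw [Real.norm_eq_abs, e, abs_mul, abs_of_pos (by positivity), ← dyadic_rpow (norm_nonneg _)]
      refine mul_le_mul_of_nonneg_left (h1.trans ?_) (by positivity)
      rw [hg, norm_smul ((1 / 2 : ℝ) ^ k), Real.norm_eq_abs, abs_of_pos (by positivity)]
    have := tendsto_nhds_unique hlim hz'
    linarith
  have hD0 : D 0 = 0 := by
    have := hadd 0 0
    rw [add_zero] at this
    linarith
  let A : E →+ ℝ := { toFun := D, map_zero' := hD0, map_add' := hadd }
  have hAc : Continuous A := by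
    refine continuous_of_continuousAt_zero A ?_
    have hc : Tendsto (fun h => |W (y + h) - W y| + C / (1 - θ) * ‖h‖ ^ (1 + γ)) (𝓝 0)
        (𝓝 (|W (y + 0) - W y| + C / (1 - θ) * ‖(0 : E)‖ ^ (1 + γ))) := by
      have h1 : Continuous fun h : E => ‖h‖ ^ (1 + γ) :=
        continuous_norm.rpow_const fun _ => Or.inr (by linarith)
      exact (by fun_prop : Continuous fun h => |W (y + h) - W y| + C / (1 - θ) * ‖h‖ ^ (1 + γ)).tendsto 0
    rw [add_zero, sub_self, abs_zero, norm_zero, Real.zero_rpow (by linarith), mul_zero,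
      add_zero] at hc
    rw [ContinuousAt, map_zero]
    refine squeeze_zero_norm (fun h => ?_) hc
    have h1 := abs_le.mp (hbound h)
    change |D h| ≤ _
    rw [abs_le]
    have h2 := abs_le.mp (le_refl |W (y + h) - W y|)
    constructor <;> linarith [h1.1, h1.2, h2.1, h2.2]
  refine ⟨(InnerProductSpace.toDual ℝ E).symm (A.toRealLinearMap hAc), fun h => ?_⟩
  rw [InnerProductSpace.toDual_symm_apply]
  exact hbound h

/-- Interior gradient Hölder estimate. -/
theorem exists_holder_gradient (E : Type*) [NormedAddCommGroup E] [InnerProductSpace ℝ E]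
    [FiniteDimensional ℝ E] [MeasurableSpace E] [BorelSpace E] {Γ : ℝ} (hΓ : 0 ≤ Γ) :
    ∃ γ ∈ Ioo (0 : ℝ) 1, ∃ C > (0 : ℝ), ∃ N > (0 : ℝ), ∀ W : E → ℝ, Continuous W →
      (∀ x, |W x| ≤ 1) → SlopeJetPair W Γ N (ball 0 (15 / 16)) →
      ∃ P : E → E, (∀ x ∈ ball (0 : E) (1 / 2), HasFDerivAt W (innerSL ℝ (P x)) x) ∧
        ∀ x ∈ ball (0 : E) (1 / 2), ∀ y ∈ ball (0 : E) (1 / 2),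
          ‖P x - P y‖ ≤ C * ‖x - y‖ ^ γ := by
  set L := 1000 * (1 + Γ) with hL
  have hL0 : 0 < L := by positivity
  obtain ⟨γ, hγ, C, hC, hsd⟩ := second_difference_le E hΓ hL0.le
  have hθ1 : (1 / 2 : ℝ) ^ γ < 1 := Real.rpow_lt_one (by norm_num) (by norm_num) hγ.1
  set C₁ := C / (1 - (1 / 2 : ℝ) ^ γ) with hC₁
  have hC₁0 : 0 < C₁ := div_pos hC (by linarith)
  refine ⟨γ, hγ, 12 * C₁, by positivity, 2 * L, by positivity, fun W hW hW1 hJ => ?_⟩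
  have hLip : ∀ x ∈ ball (0 : E) (3 / 4), ∀ y ∈ ball (0 : E) (3 / 4), |W x - W y| ≤ L * ‖x - y‖ :=
    fun x hx y hy => lipschitz_of_slopeJetPair hΓ hL hW hW1 hJ hx hy
  have hS := hsd W hW hW1 hLip
    (hJ.jetPair hL0.le (by linarith) isOpen_ball (ball_subset_ball (by norm_num)) hLip)
  have hex : ∀ x ∈ ball (0 : E) (1 / 2), ∃ p : E, ∀ h,
      |W (x + h) - W x - ⟪p, h⟫| ≤ C₁ * ‖h‖ ^ (1 + γ) := fun x hx =>
    exists_slope_of_second_difference hW hC.le hγ.1 hS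
      (isOpen_ball.mem_nhds (ball_subset_ball (by norm_num) hx))
  choose! P hP using hex
  refine ⟨P, fun x hx => hasFDerivAt_of_rpow_bound hγ.1 (hP x hx), fun x hx y hy => ?_⟩
  rcases eq_or_ne x y with rfl | hne
  · rw [sub_self, norm_zero]; positivity
  have hd : 0 < ‖x - y‖ := norm_pos_iff.mpr (sub_ne_zero.mpr hne)
  set d := ‖x - y‖ with hdd
  have h2 : (2 * d) ^ (1 + γ) ≤ 4 * d ^ (1 + γ) := by
    rw [Real.mul_rpow (by norm_num) hd.le]
    gcongr
    calc (2 : ℝ) ^ (1 + γ) ≤ 2 ^ (2 : ℝ) :=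
          Real.rpow_le_rpow_of_exponent_le (by norm_num) (by linarith [hγ.2])
      _ = 4 := by norm_num
  have hle : ∀ t, 0 ≤ t → t ≤ 2 * d → C₁ * t ^ (1 + γ) ≤ 4 * C₁ * d ^ (1 + γ) := by
    intro t ht htd
    have : t ^ (1 + γ) ≤ (2 * d) ^ (1 + γ) := Real.rpow_le_rpow ht htd (by linarith [hγ.1])
    nlinarith
  have key := slope_diff_le (g := W) (x := x) (y := y) (p := P x) (q := P y)
    (κ := 4 * C₁ * d ^ (1 + γ)) hd ?_ ?_ ?_
  · rw [Real.rpow_add hd, Real.rpow_one] at key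
    have : ‖P x - P y‖ * d ≤ (12 * C₁ * d ^ γ) * d := by linarith
    exact le_of_mul_le_mul_right this hd
  · intro z hz
    have := hP x hx (y + z - x)
    rw [add_sub_cancel] at this
    refine this.trans (hle _ (norm_nonneg _) ?_)
    calc ‖y + z - x‖ = ‖z - (x - y)‖ := by congr 1; abel
      _ ≤ ‖z‖ + ‖x - y‖ := norm_sub_le _ _
      _ = 2 * d := by rw [hz, ← hdd]; ring
  · intro z hz
    exact (hP y hy z).trans (hle _ (norm_nonneg _) (by linarith))
  · have := hP x hx (y - x)
    rw [add_sub_cancel] at this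
    refine this.trans (hle _ (norm_nonneg _) ?_)
    rw [norm_sub_rev, ← hdd]; linarith

end SecondDifferences

section Pucci

variable {n : ℕ}

theorem trace_mul_le_of_mem_ellMat {lam Lam c : ℝ} (hlam : 0 ≤ lam) (hc : 0 ≤ c)
    {A M : Matrix (Fin n) (Fin n) ℝ} (hA : A ∈ EllMat n lam Lam) (hM : M.IsSymm)
    (hMc : ∀ v : Fin n → ℝ, v ⬝ᵥ M *ᵥ v ≤ c * (v ⬝ᵥ v)) {v : Fin n → ℝ} (hv : v ⬝ᵥ v = 1) :
    (A * M).trace ≤ n * Lam * c - lam * (c - v ⬝ᵥ M *ᵥ v) := by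
  set N : Matrix (Fin n) (Fin n) ℝ := c • (1 : Matrix (Fin n) (Fin n) ℝ) - M with hN
  have hNv : ∀ w, w ⬝ᵥ N *ᵥ w = c * (w ⬝ᵥ w) - w ⬝ᵥ M *ᵥ w := by
    intro w
    rw [hN, sub_mulVec, dotProduct_sub, smul_mulVec, one_mulVec, dotProduct_smul, smul_eq_mul]
  have hpos : N.PosSemidef := by
    refine PosSemidef.of_dotProduct_mulVec_nonneg ?_ fun w => ?_
    · rw [IsHermitian, conjTranspose_eq_transpose_of_trivial, hN, transpose_sub, transpose_smul,
        transpose_one, hM]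
    · rw [star_trivial, hNv]
      linarith [hMc w]
  obtain ⟨m, z, hz⟩ := posSemidef_iff_eq_sum_vecMulVec.mp hpos
  simp only [star_trivial] at hz
  have htr : (A * N).trace = ∑ i, z i ⬝ᵥ A *ᵥ z i := by
    rw [hz, Finset.mul_sum, trace_sum]
    refine Finset.sum_congr rfl fun i _ => ?_
    rw [mul_vecMulVec, trace_vecMulVec, dotProduct_comm]
  have hvN : v ⬝ᵥ N *ᵥ v = ∑ i, (z i ⬝ᵥ v) ^ 2 := by
    rw [hz, sum_mulVec, dotProduct_sum]
    refine Finset.sum_congr rfl fun i _ => ?_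
    rw [vecMulVec_mulVec, dotProduct_smul]
    simp [dotProduct_comm v, sq]
  have h1 : lam * (v ⬝ᵥ N *ᵥ v) ≤ (A * N).trace := by
    rw [hvN, htr, Finset.mul_sum]
    refine Finset.sum_le_sum fun i _ => ?_
    refine le_trans ?_ (hA.2 (z i)).1
    refine mul_le_mul_of_nonneg_left ?_ hlam
    have := Finset.sum_mul_sq_le_sq_mul_sq Finset.univ (z i) v
    have e : ∀ w : Fin n → ℝ, ∑ i, w i ^ 2 = w ⬝ᵥ w := fun w => by simp [dotProduct, sq]
    rw [e, e, hv, mul_one] at this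
    exact this
  have h2 : A.trace ≤ n * Lam := by
    have : ∀ i, A i i ≤ Lam := by
      intro i
      have := (hA.2 (Pi.single i 1)).2
      simpa using this
    calc A.trace = ∑ i, A i i := rfl
      _ ≤ ∑ _i : Fin n, Lam := Finset.sum_le_sum fun i _ => this i
      _ = n * Lam := by simp
  have h3 : (A * N).trace = c * A.trace - (A * M).trace := by
    rw [hN, mul_sub, trace_sub, mul_smul_comm, mul_one, trace_smul, smul_eq_mul]
  rw [hNv, hv, mul_one] at h1
  have := mul_le_mul_of_nonneg_left h2 hc
  linarith

theorem pucciSup_le {lam Lam c : ℝ} (hlam : 0 ≤ lam) (hlL : lam ≤ Lam) (hc : 0 ≤ c)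
    {M : Matrix (Fin n) (Fin n) ℝ} (hM : M.IsSymm)
    (hMc : ∀ v : Fin n → ℝ, v ⬝ᵥ M *ᵥ v ≤ c * (v ⬝ᵥ v)) {v : Fin n → ℝ} (hv : v ⬝ᵥ v = 1) :
    pucciSup n lam Lam M ≤ n * Lam * c - lam * (c - v ⬝ᵥ M *ᵥ v) := by
  refine csSup_le ⟨_, mem_image_of_mem _ (x := Lam • 1) ⟨?_, fun w => ?_⟩⟩ ?_
  · rw [IsSymm, transpose_smul, transpose_one]
  · rw [smul_mulVec, one_mulVec, dotProduct_smul, smul_eq_mul]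
    have hw : 0 ≤ w ⬝ᵥ w := Finset.sum_nonneg fun i _ => mul_self_nonneg (w i)
    exact ⟨mul_le_mul_of_nonneg_right hlL hw, le_rfl⟩
  · rintro _ ⟨A, hA, rfl⟩
    exact trace_mul_le_of_mem_ellMat hlam hc hA hM hMc hv

/-- Matrix of the bilinear form of an operator. -/
def formMatrix (T : Euc n →L[ℝ] Euc n) : Matrix (Fin n) (Fin n) ℝ :=
  fun i j => ⟪T (EuclideanSpace.single i 1), EuclideanSpace.single j 1⟫

theorem formMatrix_isSymm {T : Euc n →L[ℝ] Euc n} (hT : ∀ v w, ⟪T v, w⟫ = ⟪T w, v⟫) :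
    (formMatrix T).IsSymm := by
  ext i j
  exact hT _ _

theorem formMatrix_sub (T S : Euc n →L[ℝ] Euc n) :
    formMatrix T - formMatrix S = formMatrix (T - S) := by
  ext i j
  simp only [formMatrix, Matrix.sub_apply, _root_.sub_apply, inner_sub_left]

theorem dotProduct_formMatrix_mulVec (T : Euc n →L[ℝ] Euc n) (x : Euc n) :
    x.ofLp ⬝ᵥ formMatrix T *ᵥ x.ofLp = ⟪T x, x⟫ := by
  have hx : x = ∑ i, x i • EuclideanSpace.single i (1 : ℝ) := by
    ext j
    simp [Pi.single_apply]
  conv_rhs => rw [hx, map_sum, sum_inner]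
  rw [dotProduct]
  refine Finset.sum_congr rfl fun i _ => ?_
  rw [mulVec, dotProduct, inner_sum, Finset.mul_sum]
  refine Finset.sum_congr rfl fun j _ => ?_
  rw [map_smul, real_inner_smul_left, real_inner_smul_right, formMatrix]
  ring

/-- Quadratic polynomial with prescribed jet at `ζ`. -/
def quadPoly (c : ℝ) (v ζ : Euc n) (T : Euc n →L[ℝ] Euc n) (x : Euc n) : ℝ :=
  c + ⟪v, x - ζ⟫ + ⟪T (x - ζ), x - ζ⟫ / 2

theorem contDiff_quadPoly (c : ℝ) (v ζ : Euc n) (T : Euc n →L[ℝ] Euc n) :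
    ContDiff ℝ 2 (quadPoly c v ζ T) := by
  unfold quadPoly
  have h : ContDiff ℝ 2 fun x : Euc n => x - ζ := contDiff_id.sub contDiff_const
  exact (contDiff_const.add (contDiff_const.inner ℝ h)).add
    (((T.contDiff.comp h).inner ℝ h).div_const 2)

theorem hasFDerivAt_quadPoly (c : ℝ) (v ζ : Euc n) {T : Euc n →L[ℝ] Euc n}
    (hT : ∀ v w, ⟪T v, w⟫ = ⟪T w, v⟫) (x : Euc n) :
    HasFDerivAt (quadPoly c v ζ T) (innerSL ℝ (v + T (x - ζ))) x := by
  have h : HasFDerivAt (fun x : Euc n => x - ζ) (ContinuousLinearMap.id ℝ (Euc n)) x :=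
    (hasFDerivAt_id x).sub_const ζ
  have h1 : HasFDerivAt (fun x : Euc n => ⟪v, x - ζ⟫) (innerSL ℝ v) x := by
    have := ((innerSL ℝ v).hasFDerivAt (x := x - ζ)).comp x h
    rwa [ContinuousLinearMap.comp_id] at this
  have h2 := (T.hasFDerivAt.comp x h).inner ℝ h
  have h3 := ((h1.const_add c).add (h2.mul_const (1 / 2)))
  have e : quadPoly c v ζ T = (fun x => c + ⟪v, x - ζ⟫) + fun y => ⟪(T ∘ fun x => x - ζ) y, y - ζ⟫ * (1 / 2) := by
    ext y
    simp only [quadPoly, Pi.add_apply, Function.comp_apply]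
    ring
  rw [e]
  refine h3.congr_fderiv ?_
  ext w
  simp [fderivInnerCLM_apply, inner_sub_right, hT w, real_inner_comm]
  ring

theorem gradient_quadPoly (c : ℝ) (v ζ : Euc n) {T : Euc n →L[ℝ] Euc n}
    (hT : ∀ v w, ⟪T v, w⟫ = ⟪T w, v⟫) : gradient (quadPoly c v ζ T) ζ = v := by
  have := hasFDerivAt_quadPoly c v ζ hT ζ
  rw [sub_self, map_zero, add_zero] at this
  exact HasGradientAt.gradient this

theorem hess_quadPoly (c : ℝ) (v ζ : Euc n) {T : Euc n →L[ℝ] Euc n}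
    (hT : ∀ v w, ⟪T v, w⟫ = ⟪T w, v⟫) : hess (quadPoly c v ζ T) ζ = formMatrix T := by
  ext i j
  have h : fderiv ℝ (quadPoly c v ζ T) = fun x => innerSL ℝ (v + T (x - ζ)) :=
    funext fun x => (hasFDerivAt_quadPoly c v ζ hT x).fderiv
  have h1 : HasFDerivAt (fun x : Euc n => v + T (x - ζ)) T ζ := by
    have h : HasFDerivAt (fun x : Euc n => x - ζ) (ContinuousLinearMap.id ℝ (Euc n)) ζ :=
      (hasFDerivAt_id ζ).sub_const ζ
    simpa using (T.hasFDerivAt.comp ζ h).const_add v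
  have h2 : HasFDerivAt (fun x => innerSL ℝ (v + T (x - ζ))) ((innerSL ℝ).comp T) ζ :=
    (innerSL ℝ (E := Euc n)).hasFDerivAt.comp ζ h1
  rw [hess, iteratedFDeriv_two_apply, h, h2.fderiv]
  simp [formMatrix]

end Pucci

section ViscosityJets

variable {n : ℕ} {κ q μ N τ : ℝ} {F : Matrix (Fin n) (Fin n) ℝ → ℝ} {f u W : Euc n → ℝ}
  {ξ : Euc n} {b : ℝ}

theorem coeff_ge (hq : 0 ≤ q) (hμ : 0 < μ) (hτ : 0 ≤ τ) (hξ : κ + μ + τ * N ≤ ‖ξ‖) {p : Euc n}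
    (hp : ‖p‖ ≤ N) : κ < ‖ξ + τ • p‖ ∧ μ ^ q ≤ max (‖ξ + τ • p‖ - κ) 0 ^ q := by
  have h1 := norm_sub_norm_le ξ (-(τ • p))
  rw [norm_neg, sub_neg_eq_add, norm_smul, Real.norm_eq_abs, abs_of_nonneg hτ] at h1
  have h2 := mul_le_mul_of_nonneg_left hp hτ
  exact ⟨by linarith, Real.rpow_le_rpow hμ.le (le_max_of_le_left (by linarith)) hq⟩

/-- Operator bound from superjets of the normalized subsolution. -/
theorem GradSubSol.form_ge (hu : GradSubSol κ (mainG κ q F) f (ball 0 1) u) (hq : 0 ≤ q)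
    (hμ : 0 < μ) (hτ : 0 < τ) (hξ : κ + μ + τ * N ≤ ‖ξ‖)
    (hf : ∀ x ∈ ball (0 : Euc n) 1, |f x| ≤ τ * μ ^ q / 2)
    (hW : ∀ x ∈ ball (0 : Euc n) (15 / 16), u x = ⟪ξ, x⟫ + b + τ * W x) {ζ p : Euc n}
    (hζ : ζ ∈ ball (0 : Euc n) (15 / 16)) (hp : ‖p‖ ≤ N) {X : Euc n →L[ℝ] Euc n}
    (hX : SupJet W ζ p X) (hXs : ∀ v w, ⟪X v, w⟫ = ⟪X w, v⟫) {η : ℝ} (hη : 0 < η) :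
    -(τ / 2) ≤ F (formMatrix (τ • (X + (2 * η) • ContinuousLinearMap.id ℝ (Euc n)))) := by
  set T := τ • (X + (2 * η) • ContinuousLinearMap.id ℝ (Euc n)) with hTdef
  have hTf : ∀ v w, ⟪T v, w⟫ = τ * (⟪X v, w⟫ + 2 * η * ⟪v, w⟫) := by
    intro v w
    simp only [hTdef, _root_.add_apply, _root_.smul_apply, ContinuousLinearMap.id_apply,
      inner_add_left, real_inner_smul_left]
  have hT : ∀ v w, ⟪T v, w⟫ = ⟪T w, v⟫ := by
    intro v w
    rw [hTf, hTf, hXs v w, real_inner_comm w v]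
  have hζ1 : ζ ∈ ball (0 : Euc n) 1 := ball_subset_ball (by norm_num) hζ
  obtain ⟨hc1, hc2⟩ := coeff_ge hq hμ hτ.le hξ hp
  have hmax : IsLocalMax (fun x => u x - quadPoly (⟪ξ, ζ⟫ + b) (ξ + τ • p) ζ T x) ζ := by
    have hev := hX η hη
    have htend : Tendsto (fun x => x - ζ) (𝓝 ζ) (𝓝 0) := by
      have hc : Continuous fun x : Euc n => x - ζ := by fun_prop
      simpa using hc.tendsto ζ
    filter_upwards [htend.eventually hev, isOpen_ball.mem_nhds hζ] with x hx hxb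
    rw [hW x hxb, hW ζ hζ]
    rw [add_sub_cancel] at hx
    simp only [quadPoly, sub_self, map_zero, inner_zero_right, hTf, inner_add_left,
      real_inner_smul_left, real_inner_self_eq_norm_sq, inner_sub_right ξ]
    have := mul_le_mul_of_nonneg_left hx hτ.le
    linarith
  have h := hu ζ hζ1 _ (contDiff_quadPoly _ _ _ _) hmax (by rwa [gradient_quadPoly _ _ _ hT])
  rw [gradient_quadPoly _ _ _ hT, hess_quadPoly _ _ _ hT] at h
  simp only [mainG] at h
  have hf1 := (abs_le.mp (hf ζ hζ1)).1
  have hμq : 0 < μ ^ q := Real.rpow_pos_of_pos hμ q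
  by_contra hcon
  push Not at hcon
  nlinarith

/-- Operator bound from subjets of the normalized supersolution. -/
theorem GradSupSol.form_le (hu : GradSupSol κ (mainG κ q F) f (ball 0 1) u) (hq : 0 ≤ q)
    (hμ : 0 < μ) (hτ : 0 < τ) (hξ : κ + μ + τ * N ≤ ‖ξ‖)
    (hf : ∀ x ∈ ball (0 : Euc n) 1, |f x| ≤ τ * μ ^ q / 2)
    (hW : ∀ x ∈ ball (0 : Euc n) (15 / 16), u x = ⟪ξ, x⟫ + b + τ * W x) {ζ p : Euc n}
    (hζ : ζ ∈ ball (0 : Euc n) (15 / 16)) (hp : ‖p‖ ≤ N) {Y : Euc n →L[ℝ] Euc n}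
    (hY : SubJet W ζ p Y) (hYs : ∀ v w, ⟪Y v, w⟫ = ⟪Y w, v⟫) {η : ℝ} (hη : 0 < η) :
    F (formMatrix (τ • (Y - (2 * η) • ContinuousLinearMap.id ℝ (Euc n)))) ≤ τ / 2 := by
  set T := τ • (Y - (2 * η) • ContinuousLinearMap.id ℝ (Euc n)) with hTdef
  have hTf : ∀ v w, ⟪T v, w⟫ = τ * (⟪Y v, w⟫ - 2 * η * ⟪v, w⟫) := by
    intro v w
    simp only [hTdef, _root_.sub_apply, _root_.smul_apply, ContinuousLinearMap.id_apply,
      inner_sub_left, real_inner_smul_left]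
  have hT : ∀ v w, ⟪T v, w⟫ = ⟪T w, v⟫ := by
    intro v w
    rw [hTf, hTf, hYs v w, real_inner_comm w v]
  have hζ1 : ζ ∈ ball (0 : Euc n) 1 := ball_subset_ball (by norm_num) hζ
  obtain ⟨hc1, hc2⟩ := coeff_ge hq hμ hτ.le hξ hp
  have hmin : IsLocalMin (fun x => u x - quadPoly (⟪ξ, ζ⟫ + b) (ξ + τ • p) ζ T x) ζ := by
    have hev := hY η hη
    have htend : Tendsto (fun x => x - ζ) (𝓝 ζ) (𝓝 0) := by
      have hc : Continuous fun x : Euc n => x - ζ := by fun_prop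
      simpa using hc.tendsto ζ
    filter_upwards [htend.eventually hev, isOpen_ball.mem_nhds hζ] with x hx hxb
    rw [hW x hxb, hW ζ hζ]
    rw [add_sub_cancel] at hx
    simp only [quadPoly, sub_self, map_zero, inner_zero_right, hTf, inner_add_left,
      real_inner_smul_left, real_inner_self_eq_norm_sq, inner_sub_right ξ]
    have := mul_le_mul_of_nonneg_left hx hτ.le
    linarith
  have h := hu ζ hζ1 _ (contDiff_quadPoly _ _ _ _) hmin (by rwa [gradient_quadPoly _ _ _ hT])
  rw [gradient_quadPoly _ _ _ hT, hess_quadPoly _ _ _ hT] at h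
  simp only [mainG] at h
  have hf1 := (abs_le.mp (hf ζ hζ1)).2
  have hμq : 0 < μ ^ q := Real.rpow_pos_of_pos hμ q
  by_contra hcon
  push Not at hcon
  nlinarith

/-- The normalized solution satisfies the Hessian comparison of the linearized equation. -/
theorem GradSol.slopeJetPair {lam Lam : ℝ} (hlam : 0 < lam) (hlL : lam ≤ Lam)
    (hF : IsUniformlyElliptic n lam Lam F)
    (hu : GradSol κ (mainG κ q F) f (ball 0 1) u) (hq : 0 ≤ q)
    (hμ : 0 < μ) (hτ : 0 < τ) (hξ : κ + μ + τ * N ≤ ‖ξ‖)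
    (hf : ∀ x ∈ ball (0 : Euc n) 1, |f x| ≤ τ * μ ^ q / 2)
    (hW : ∀ x ∈ ball (0 : Euc n) (15 / 16), u x = ⟪ξ, x⟫ + b + τ * W x) :
    SlopeJetPair W ((n * Lam + 1) / lam) N (ball 0 (15 / 16)) := by
  intro ζ₁ hζ₁ ζ₂ hζ₂ p₁ p₂ Y X hp₁ hp₂ hY hX hYs hXs c hc hlow v
  have hnL : 0 ≤ n * Lam := mul_nonneg (Nat.cast_nonneg n) (by linarith)
  have hunit : ∀ e : Euc n, ‖e‖ = 1 → lam * (⟪Y e, e⟫ - ⟪X e, e⟫) ≤ 1 + n * Lam * c := by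
    intro e he
    refine le_of_forall_pos_le_add fun ε hε => ?_
    set η := ε / (4 * (n * Lam) + 1) with hη
    have hη0 : 0 < η := by positivity
    have hηε : 4 * (n * Lam) * η ≤ ε := by
      have hne : (4 * (n * Lam) + 1 : ℝ) ≠ 0 := by positivity
      have : (4 * (n * Lam) + 1) * η = ε := mul_div_cancel₀ _ hne
      linarith
    have h1 := hu.1.form_ge hq hμ hτ hξ hf hW hζ₂ hp₂ hX hXs hη0
    have h2 := hu.2.form_le hq hμ hτ hξ hf hW hζ₁ hp₁ hY hYs hη0
    set T₁ := τ • (X + (2 * η) • ContinuousLinearMap.id ℝ (Euc n)) with hT₁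
    set T₂ := τ • (Y - (2 * η) • ContinuousLinearMap.id ℝ (Euc n)) with hT₂
    have hTf₁ : ∀ v w, ⟪T₁ v, w⟫ = τ * (⟪X v, w⟫ + 2 * η * ⟪v, w⟫) := by
      intro v w
      simp only [hT₁, _root_.add_apply, _root_.smul_apply, ContinuousLinearMap.id_apply,
        inner_add_left, real_inner_smul_left]
    have hTf₂ : ∀ v w, ⟪T₂ v, w⟫ = τ * (⟪Y v, w⟫ - 2 * η * ⟪v, w⟫) := by
      intro v w
      simp only [hT₂, _root_.sub_apply, _root_.smul_apply, ContinuousLinearMap.id_apply,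
        inner_sub_left, real_inner_smul_left]
    have hs₁ : (formMatrix T₁).IsSymm := formMatrix_isSymm fun v w => by
      rw [hTf₁, hTf₁, hXs v w, real_inner_comm w v]
    have hs₂ : (formMatrix T₂).IsSymm := formMatrix_isSymm fun v w => by
      rw [hTf₂, hTf₂, hYs v w, real_inner_comm w v]
    have hform : ∀ x : Euc n, x.ofLp ⬝ᵥ (formMatrix T₁ - formMatrix T₂) *ᵥ x.ofLp =
        τ * (⟪X x, x⟫ - ⟪Y x, x⟫ + 4 * η * ‖x‖ ^ 2) := by
      intro x
      rw [formMatrix_sub, dotProduct_formMatrix_mulVec, _root_.sub_apply, inner_sub_left, hTf₁,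
        hTf₂, real_inner_self_eq_norm_sq]
      ring
    have hself : ∀ x : Euc n, x.ofLp ⬝ᵥ x.ofLp = ‖x‖ ^ 2 := by
      intro x
      rw [EuclideanSpace.real_norm_sq_eq, dotProduct]
      exact Finset.sum_congr rfl fun i _ => (sq _).symm
    have h3 := pucciSup_le (c := τ * (c + 4 * η)) hlam.le hlL (by positivity) (hs₁.sub hs₂)
      (fun w => by
        have e1 := hform (WithLp.toLp 2 w)
        have e2 := hself (WithLp.toLp 2 w)
        simp only at e1 e2
        rw [e1, e2]
        have := mul_le_mul_of_nonneg_left (hlow (WithLp.toLp 2 w)) hτ.le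
        linarith) (v := e.ofLp) (by rw [hself, he, one_pow])
    rw [hform, he] at h3
    have h4 := (hF _ _ hs₁ hs₂).2
    have h5 : τ * (lam * (⟪Y e, e⟫ - ⟪X e, e⟫)) ≤
        τ * (1 + n * Lam * (c + 4 * η) - lam * c) := by linarith
    have h6 := le_of_mul_le_mul_left h5 hτ
    have h7 := mul_nonneg hlam.le hc
    linarith
  rcases eq_or_ne v 0 with rfl | hne
  · simp
  have hv : 0 < ‖v‖ := norm_pos_iff.mpr hne
  have h1 := hunit (‖v‖⁻¹ • v) (by rw [norm_smul, norm_inv, norm_norm, inv_mul_cancel₀ hv.ne'])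
  simp only [map_smul, real_inner_smul_left, real_inner_smul_right] at h1
  have h2 : lam * (⟪Y v, v⟫ - ⟪X v, v⟫) ≤ (1 + n * Lam * c) * ‖v‖ ^ 2 := by
    have := mul_le_mul_of_nonneg_right h1 (sq_nonneg ‖v‖)
    refine le_trans (le_of_eq ?_) this
    field_simp
  rw [div_mul_eq_mul_div, div_mul_eq_mul_div, le_div_iff₀ hlam]
  have h3 : 0 ≤ (n * Lam + c) * ‖v‖ ^ 2 := by positivity
  linarith

end ViscosityJets

/-- The distance to an affine function, normalized and extended to a bounded continuous
function on the whole space. -/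
theorem exists_normalized_extension {n : ℕ} {u : Euc n → ℝ} {ξ : Euc n} {b τ : ℝ} (hτ : 0 < τ)
    (hu : ContinuousOn u (ball 0 1))
    (hub : ∀ x ∈ ball (0 : Euc n) 1, |u x - (⟪ξ, x⟫ + b)| ≤ τ) :
    ∃ W : Euc n → ℝ, Continuous W ∧ (∀ x, |W x| ≤ 1) ∧
      ∀ x ∈ ball (0 : Euc n) (15 / 16), u x = ⟪ξ, x⟫ + b + τ * W x := by
  set g : Euc n → Euc n := fun x => ((15 / 16) / max (15 / 16) ‖x‖) • x with hg
  have hpos : ∀ x : Euc n, 0 < max (15 / 16 : ℝ) ‖x‖ := fun x =>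
    lt_of_lt_of_le (by norm_num) (le_max_left _ _)
  have hgc : Continuous g := by
    refine Continuous.smul (continuous_const.div ?_ fun x => (hpos x).ne') continuous_id
    fun_prop
  have hgb : ∀ x, g x ∈ ball (0 : Euc n) 1 := by
    intro x
    rw [mem_ball_zero_iff, hg, norm_smul, Real.norm_of_nonneg (by positivity), div_mul_eq_mul_div,
      div_lt_one (hpos x)]
    have h1 := le_max_left (15 / 16 : ℝ) ‖x‖
    have h2 := le_max_right (15 / 16 : ℝ) ‖x‖
    linarith
  have hgid : ∀ x ∈ ball (0 : Euc n) (15 / 16), g x = x := by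
    intro x hx
    have hx' : ‖x‖ ≤ 15 / 16 := (mem_ball_zero_iff.mp hx).le
    rw [hg]
    simp only [max_eq_left hx']
    rw [div_self (by norm_num), one_smul]
  refine ⟨fun x => (u (g x) - (⟪ξ, g x⟫ + b)) / τ, ?_, fun x => ?_, fun x hx => ?_⟩
  · have hug : Continuous fun x => u (g x) := hu.comp_continuous hgc hgb
    exact (hug.sub ((continuous_const.inner hgc).add continuous_const)).div_const τ
  · rw [abs_div, abs_of_pos hτ]
    exact div_le_one_of_le₀ (hub _ (hgb x)) hτ.le
  · simp only [hgid x hx]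
    field_simp
    ring

/-- Differentiability transfers from the normalized function to the original one. -/
theorem hasGradientAt_of_normalized {n : ℕ} {u W : Euc n → ℝ} {ξ p x : Euc n} {b τ r : ℝ}
    (hWu : ∀ x ∈ ball (0 : Euc n) r, u x = ⟪ξ, x⟫ + b + τ * W x)
    (hx : x ∈ ball (0 : Euc n) r) (hW : HasFDerivAt W (innerSL ℝ p) x) :
    HasGradientAt u (ξ + τ • p) x := by
  have hlin : HasFDerivAt (fun y : Euc n => ⟪ξ, y⟫) (innerSL ℝ ξ) x := (innerSL ℝ ξ).hasFDerivAt
  have hsum : HasFDerivAt u (innerSL ℝ (ξ + τ • p)) x := by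
    rw [map_add, map_smul]
    refine ((hlin.add_const b).add (hW.const_mul τ)).congr_of_eventuallyEq ?_
    filter_upwards [isOpen_ball.mem_nhds hx] with y hy using hWu y hy
  exact hsum

end Regularity

/-- Corollary 5.9: under the hypotheses of the iterative
approximation proposition, `u` is differentiable in `B_{1/2}` and its gradient is
`γ`-Hölder continuous at the origin. -/
theorem gradient_holder_at_origin
    (n : ℕ) (hn : 1 ≤ n) (lam Lam : ℝ) (hlam : 0 < lam) (hlamLam : lam ≤ Lam) :
    ∃ γ ∈ Ioo (0 : ℝ) 1, ∃ κ₀ ∈ Ioo (0 : ℝ) 1, ∃ C > (0 : ℝ),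
      ∀ q μ : ℝ, 0 ≤ q → μ ∈ Ioo (0 : ℝ) 1 → ∃ ς₀ > 0, ∃ τ₀ > 0,
      ∀ κ : ℝ, 0 ≤ κ → κ ≤ κ₀ →
      ∀ F : Matrix (Fin n) (Fin n) ℝ → ℝ, IsUniformlyElliptic n lam Lam F →
      ∀ f u : Euc n → ℝ,
        ContinuousOn f (ball 0 1) → ContinuousOn u (ball 0 1) →
        GradSol κ (mainG κ q F) f (ball 0 1) u →
        (∀ x ∈ ball (0 : Euc n) 1, |f x| ≤ ς₀) →
      ∀ ξ : Euc n, ∀ b : ℝ, κ + 3 * μ ≤ ‖ξ‖ →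
        (∀ x ∈ ball (0 : Euc n) 1, |u x - (⟪ξ, x⟫ + b)| ≤ τ₀) →
        (∀ x ∈ ball (0 : Euc n) (1/2), DifferentiableAt ℝ u x) ∧
        ∀ x ∈ ball (0 : Euc n) (1/2),
          ‖gradient u x - gradient u 0‖ ≤ τ₀ * C * ‖x‖ ^ γ := by
  have hΓ : 0 ≤ (n * Lam + 1) / lam := by
    have : 0 ≤ n * Lam := mul_nonneg (Nat.cast_nonneg n) (by linarith)
    positivity
  obtain ⟨γ, hγ, C, hC, N, hN, hreg⟩ := exists_holder_gradient (Euc n) hΓ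
  refine ⟨γ, hγ, 1 / 2, by norm_num, C, hC, fun q μ hq hμ => ?_⟩
  have hμ0 : 0 < μ := hμ.1
  have hτ : 0 < 2 * μ / N := by positivity
  have hτN : 2 * μ / N * N = 2 * μ := div_mul_cancel₀ _ hN.ne'
  generalize 2 * μ / N = τ at hτ hτN
  refine ⟨τ * μ ^ q / 2, by positivity, τ, hτ, ?_⟩
  intro κ _ _ F hF f u _ hu hsol hf ξ b hξ hub
  obtain ⟨W, hWc, hW1, hWu⟩ := exists_normalized_extension hτ hu hub
  obtain ⟨P, hP, hPh⟩ := hreg W hWc hW1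
    (hsol.slopeJetPair hlam hlamLam hF hq hμ0 hτ (by linarith) hf hWu)
  have hgrad : ∀ x ∈ ball (0 : Euc n) (1 / 2), HasGradientAt u (ξ + τ • P x) x :=
    fun x hx => hasGradientAt_of_normalized hWu
      (ball_subset_ball (by norm_num) hx) (hP x hx)
  have h0 : (0 : Euc n) ∈ ball (0 : Euc n) (1 / 2) := mem_ball_self (by norm_num)
  refine ⟨fun x hx => (hgrad x hx).differentiableAt, fun x hx => ?_⟩
  rw [(hgrad x hx).gradient, (hgrad 0 h0).gradient, add_sub_add_left_eq_sub, ← smul_sub,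
    norm_smul, Real.norm_of_nonneg hτ.le, mul_assoc]
  have := hPh x hx 0 h0
  rw [sub_zero] at this
  gcongr

end
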